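/- There exists a homeomorphism H of the Sierpiński carpet S onto itself and a Borel probability measure μ on S such that: (1) μ is H-invariant, has full support, and the system (S, H, μ) is Bernoulli; (2) the set of periodic points of H is dense in S; and (3) H does not have Bowen's specification property. -/

import Mathlib

open MeasureTheory

/-- The Sierpiński carpet: points of `[0,1]²` admitting ternary expansions with no index at
which both digits equal `1`. -/
def sierpinskiCarpet : Set (ℝ × ℝ) :=
  {p | ∃ a b : ℕ → Fin 3, (∀ i, ¬(a i = 1 ∧ b i = 1)) ∧
    p.1 = ∑' i : ℕ, (a i : ℝ) / 3 ^ (i + 1) ∧ p.2 = ∑' i : ℕ, (b i : ℝ) / 3 ^ (i + 1)}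


/-- `(X, T, μ)` is a Bernoulli system: there are a finite alphabet `A` with a probability
measure `p` and a measure-theoretic isomorphism `φ` from the two-sided product space
`(A^ℤ, p^⊗ℤ)` (the product measure `ν` is characterized by its values on cylinder sets)
to `(X, μ)` intertwining the left shift with `T` almost everywhere. -/
def IsBernoulliSystem {X : Type*} [MeasurableSpace X] (T : X → X) (μ : Measure X) : Prop :=
  ∃ (A : Type) (_ : Fintype A),
    letI : MeasurableSpace A := ⊤
    ∃ (p : Measure A) (ν : Measure (ℤ → A)),
      IsProbabilityMeasure p ∧ IsProbabilityMeasure ν ∧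
      (∀ (F : Finset ℤ) (B : ℤ → Set A),
        ν {ω : ℤ → A | ∀ i ∈ F, ω i ∈ B i} = ∏ i ∈ F, p (B i)) ∧
      ∃ φ : (ℤ → A) → X,
        Measurable φ ∧ MeasurePreserving φ ν μ ∧
        (∃ ψ : X → (ℤ → A), Measurable ψ ∧ MeasurePreserving ψ μ ν ∧
          (∀ᵐ ω ∂ν, ψ (φ ω) = ω) ∧ (∀ᵐ x ∂μ, φ (ψ x) = x)) ∧
        (∀ᵐ ω ∂ν, φ (fun i => ω (i + 1)) = T (φ ω))

/-- Bowen's specification property. -/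
def BowenSpecification {X : Type*} [MetricSpace X] (T : X → X) : Prop :=
  ∀ ε : ℝ, 0 < ε → ∃ N : ℕ, 0 < N ∧
    ∀ s : ℕ, 2 ≤ s → ∀ y : ℕ → X, ∀ j k : ℕ → ℕ,
      j 0 = 0 → (∀ m, m < s → j m ≤ k m) →
      (∀ m, m + 1 < s → k m < j (m + 1) ∧ N ≤ j (m + 1) - k m) →
      ∃ x : X, ∀ m, m < s → ∀ i, j m ≤ i → i ≤ k m →
        dist (T^[i] x) (T^[i] (y m)) < ε

namespace CarpetDynamics

open Metric Set Filter Topology Asymptotics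

/-! ### Blow-ups of the square and conical derivatives -/

/-- The square `[-1,1]²`, as the unit ball of the sup norm. -/
abbrev square : Set (ℝ × ℝ) := closedBall 0 1

/-- The direction of a vector, as a point of the unit sphere of the sup norm. -/
noncomputable def dir (v : ℝ × ℝ) : ℝ × ℝ := ‖v‖⁻¹ • v

theorem norm_dir {v : ℝ × ℝ} (hv : v ≠ 0) : ‖dir v‖ = 1 := by
  simp [dir, norm_smul, norm_ne_zero_iff.2 hv]

theorem continuousAt_dir {v : ℝ × ℝ} (hv : v ≠ 0) : ContinuousAt dir v := by
  unfold dir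
  exact (continuousAt_id.norm.inv₀ (norm_ne_zero_iff.2 hv)).smul continuousAt_id

theorem dir_smul {c : ℝ} (hc : 0 < c) (v : ℝ × ℝ) : dir (c • v) = dir v := by
  rcases eq_or_ne v 0 with rfl | hv
  · simp
  · simp only [dir, norm_smul, Real.norm_eq_abs, abs_of_pos hc, smul_smul]
    congr 1
    have := norm_ne_zero_iff.2 hv
    field_simp

theorem dir_eq_self {v : ℝ × ℝ} (hv : ‖v‖ = 1) : dir v = v := by simp [dir, hv]

theorem norm_smul_dir (v : ℝ × ℝ) : ‖v‖ • dir v = v := by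
  rcases eq_or_ne v 0 with rfl | hv
  · simp [dir]
  · rw [dir, smul_smul, mul_inv_cancel₀ (norm_ne_zero_iff.2 hv), one_smul]

/-- A compact space `X` presented as the square blown up at the points of `D`: `β` is the blow-down
map and `δ d` records the direction in which `d` is approached. -/
structure IsBlowup {X : Type*} [TopologicalSpace X] (D : Set (ℝ × ℝ)) (β : X → ℝ × ℝ)
    (δ : ℝ × ℝ → X → ℝ × ℝ) : Prop where
  continuous_blowdown : Continuous β
  range_blowdown : range β = square
  eq_of_notMem : ∀ s s', β s = β s' → β s ∉ D → s = s'
  continuous_direction : ∀ d ∈ D, Continuous (δ d)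
  norm_direction : ∀ d ∈ D, ∀ s, ‖δ d s‖ = 1
  direction_eq : ∀ d ∈ D, ∀ s, β s ≠ d → δ d s = dir (β s - d)
  eq_of_direction_eq : ∀ d ∈ D, ∀ s s', β s = d → β s' = d → δ d s = δ d s' → s = s'

theorem exists_open_preimage_subset {X Y : Type*} [TopologicalSpace X] [CompactSpace X]
    [TopologicalSpace Y] [T2Space Y] {f : X → Y} (hf : Continuous f) {x : X}
    (hx : ∀ x', f x' = f x → x' = x) {U : Set X} (hU : IsOpen U) (hxU : x ∈ U) :
    ∃ V, IsOpen V ∧ f x ∈ V ∧ f ⁻¹' V ⊆ U := by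
  refine ⟨(f '' Uᶜ)ᶜ, (hU.isClosed_compl.isCompact.image hf).isClosed.isOpen_compl, ?_, ?_⟩
  · rintro ⟨x', hx', h⟩
    exact hx' (hx x' h ▸ hxU)
  · intro x' h
    by_contra h'
    exact h ⟨x', h', rfl⟩

theorem mem_square {p : ℝ × ℝ} : p ∈ square ↔ ‖p‖ ≤ 1 := by simp [square]

namespace IsBlowup

variable {X : Type*} [TopologicalSpace X] {D : Set (ℝ × ℝ)} {β : X → ℝ × ℝ}
  {δ : ℝ × ℝ → X → ℝ × ℝ}

theorem tendsto_add_smul (d v : ℝ × ℝ) :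
    Tendsto (fun r : ℝ => d + r • v) (𝓝[>] 0) (𝓝 d) := by
  have : Continuous fun r : ℝ => d + r • v := by fun_prop
  simpa using (this.tendsto 0).mono_left nhdsWithin_le_nhds

theorem exists_direction_eq [CompactSpace X] (h : IsBlowup D β δ) (hD : D ⊆ ball 0 1)
    {d v : ℝ × ℝ} (hd : d ∈ D)
    (hv : ‖v‖ = 1) : ∃ s, β s = d ∧ δ d s = v := by
  have hcl : IsClosed (range fun s => (β s, δ d s)) :=
    (isCompact_range (h.continuous_blowdown.prodMk (h.continuous_direction d hd))).isClosed
  have hlim : Tendsto (fun r : ℝ => (d + r • v, v)) (𝓝[>] 0) (𝓝 (d, v)) :=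
    (tendsto_add_smul d v).prodMk_nhds tendsto_const_nhds
  have hmem : (d, v) ∈ range fun s => (β s, δ d s) := by
    refine hcl.mem_of_tendsto hlim ?_
    filter_upwards [tendsto_add_smul d v (isOpen_ball.mem_nhds (hD hd)), self_mem_nhdsWithin]
      with r hr hr0
    obtain ⟨s, hs⟩ : d + r • v ∈ range β := h.range_blowdown ▸ ball_subset_closedBall hr
    have hr0 : 0 < r := hr0
    have hv0 : v ≠ 0 := by rintro rfl; simp at hv
    refine ⟨s, Prod.ext hs ?_⟩
    have hne : β s ≠ d := by simp [hs, hr0.ne', hv0]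
    simp only
    rw [h.direction_eq d hd s hne, hs, add_sub_cancel_left, dir_smul hr0, dir_eq_self hv]
  obtain ⟨s, hs⟩ := hmem
  exact ⟨s, congrArg Prod.fst hs, congrArg Prod.snd hs⟩

theorem exists_match {X' : Type*} [TopologicalSpace X'] [CompactSpace X']
    {β' : X' → ℝ × ℝ} {δ' : ℝ × ℝ → X' → ℝ × ℝ} (h : IsBlowup D β δ) (h' : IsBlowup D β' δ')
    (hD : D ⊆ ball 0 1) (s : X) :
    ∃ s' : X', β' s' = β s ∧ ∀ d ∈ D, δ' d s' = δ d s := by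
  by_cases hs : β s ∈ D
  · obtain ⟨s', h1, h2⟩ := h'.exists_direction_eq hD hs (h.norm_direction _ hs s)
    refine ⟨s', h1, fun d hd => ?_⟩
    by_cases hds : β s = d
    · rw [← hds, h2]
    · rw [h.direction_eq d hd s hds, h'.direction_eq d hd s' (h1 ▸ hds), h1]
  · obtain ⟨s', h1⟩ : β s ∈ range β' := by
      rw [h'.range_blowdown, ← h.range_blowdown]; exact mem_range_self s
    refine ⟨s', h1, fun d hd => ?_⟩
    have hds : β s ≠ d := fun e => hs (e ▸ hd)
    rw [h.direction_eq d hd s hds, h'.direction_eq d hd s' (h1 ▸ hds), h1]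

theorem eq_of_match (h : IsBlowup D β δ) {s s' : X} (hβ : β s = β s')
    (hδ : ∀ d ∈ D, δ d s = δ d s') : s = s' := by
  by_cases hs : β s ∈ D
  · exact h.eq_of_direction_eq _ hs s s' rfl hβ.symm (hδ _ hs)
  · exact h.eq_of_notMem _ _ hβ hs

/-- Two blow-ups of the square at the same set are homeomorphic over the square. -/
theorem exists_homeomorph [CompactSpace X] [T2Space X] {X' : Type*} [TopologicalSpace X']
    [CompactSpace X']
    {β' : X' → ℝ × ℝ} {δ' : ℝ × ℝ → X' → ℝ × ℝ} (h : IsBlowup D β δ)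
    (h' : IsBlowup D β' δ') (hD : D ⊆ ball 0 1) :
    ∃ e : X' ≃ₜ X, ∀ s, β (e s) = β' s := by
  choose f hf1 hf2 using h'.exists_match h hD
  choose g hg1 hg2 using h.exists_match h' hD
  let e : X' ≃ X :=
    { toFun := f
      invFun := g
      left_inv := fun s => h'.eq_of_match (by rw [hg1, hf1])
        (fun d hd => by rw [hg2 _ d hd, hf2 _ d hd])
      right_inv := fun s => h.eq_of_match (by rw [hf1, hg1])
        (fun d hd => by rw [hf2 _ d hd, hg2 _ d hd]) }
  let j : X → (ℝ × ℝ) × (D → ℝ × ℝ) := fun s => (β s, fun d => δ d s)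
  have hj : Continuous j := h.continuous_blowdown.prodMk
    (continuous_pi fun d => h.continuous_direction d d.2)
  have hji : Function.Injective j := fun s s' hss => h.eq_of_match (congrArg Prod.fst hss)
    fun d hd => congrFun (congrArg Prod.snd hss) ⟨d, hd⟩
  have hje : IsClosedEmbedding j := hj.isClosedEmbedding hji
  have hcont : Continuous e := by
    rw [hje.isInducing.continuous_iff]
    have : j ∘ e = fun s => (β' s, fun d : D => δ' d s) := by
      funext s
      refine Prod.ext (hf1 s) ?_
      funext d
      exact hf2 s d d.2
    rw [this]
    exact h'.continuous_blowdown.prodMk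
      (continuous_pi fun d => h'.continuous_direction d d.2)
  exact ⟨hcont.homeoOfEquivCompactToT2, hf1⟩

theorem dense_notMem [CompactSpace X] (h : IsBlowup D β δ) (hD : D ⊆ ball 0 1) (hc : D.Countable) :
    Dense {s | β s ∉ D} := by
  rw [dense_iff_inter_open]
  rintro U hU ⟨s, hs⟩
  by_cases hsD : β s ∈ D
  swap
  · exact ⟨s, hs, hsD⟩
  set d := β s with hd
  obtain ⟨O, hO, hsO, hOU⟩ := exists_open_preimage_subset
    (h.continuous_blowdown.prodMk (h.continuous_direction d hsD)) (x := s)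
    (fun x' hx' => h.eq_of_direction_eq d hsD x' s (congrArg Prod.fst hx') rfl
      (congrArg Prod.snd hx')) hU hs
  have hopen : IsOpen {w : ℝ × ℝ | w ≠ d ∧ w ∈ ball (0 : ℝ × ℝ) 1 ∧ (w, dir (w - d)) ∈ O} := by
    rw [isOpen_iff_mem_nhds]
    rintro w ⟨h1, h2, h3⟩
    have hcw : ContinuousAt (fun w => (w, dir (w - d))) w :=
      continuousAt_id.prodMk (ContinuousAt.comp (g := dir) (continuousAt_dir (sub_ne_zero.2 h1))
        (by fun_prop))
    filter_upwards [isOpen_ne.mem_nhds h1, isOpen_ball.mem_nhds h2,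
      hcw.preimage_mem_nhds (hO.mem_nhds h3)] with w' h1 h2 h3 using ⟨h1, h2, h3⟩
  have hv := h.norm_direction d hsD s
  set v := δ d s
  have hv0 : v ≠ 0 := by intro e; simp [e] at hv
  have hne : {w : ℝ × ℝ | w ≠ d ∧ w ∈ ball (0 : ℝ × ℝ) 1 ∧ (w, dir (w - d)) ∈ O}.Nonempty := by
    have hlim : Tendsto (fun r : ℝ => (d + r • v, v)) (𝓝[>] 0) (𝓝 (d, v)) :=
      (tendsto_add_smul d v).prodMk_nhds tendsto_const_nhds
    have : ∀ᶠ r : ℝ in 𝓝[>] 0, d + r • v ∈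
        {w : ℝ × ℝ | w ≠ d ∧ w ∈ ball (0 : ℝ × ℝ) 1 ∧ (w, dir (w - d)) ∈ O} := by
      filter_upwards [tendsto_add_smul d v (isOpen_ball.mem_nhds (hD hsD)), self_mem_nhdsWithin,
        hlim (hO.mem_nhds hsO)] with r hr hr0 hrO
      have hr0 : 0 < r := hr0
      refine ⟨by simp [hr0.ne', hv0], hr, ?_⟩
      rw [add_sub_cancel_left, dir_smul hr0, dir_eq_self hv]
      exact hrO
    obtain ⟨r, hr⟩ := this.exists
    exact ⟨_, hr⟩
  obtain ⟨w, ⟨hw1, hw2, hw3⟩, hwD⟩ := (hc.dense_compl ℝ).inter_open_nonempty _ hopen hne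
  obtain ⟨s', rfl⟩ : w ∈ range β := h.range_blowdown ▸ ball_subset_closedBall hw2
  refine ⟨s', hOU ?_, hwD⟩
  simp only [mem_preimage]
  rwa [h.direction_eq d hsD s' hw1]

end IsBlowup

/-- Continuous, positively homogeneous, injective maps: the possible directional derivatives of
homeomorphisms lifting to blow-ups. -/
structure IsConical (A : ℝ × ℝ → ℝ × ℝ) : Prop where
  continuous : Continuous A
  map_smul : ∀ c : ℝ, 0 ≤ c → ∀ v, A (c • v) = c • A v
  injective : Function.Injective A

theorem IsConical.map_zero {A : ℝ × ℝ → ℝ × ℝ} (hA : IsConical A) : A 0 = 0 := by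
  simpa using hA.map_smul 0 le_rfl 0

theorem IsConical.ne_zero {A : ℝ × ℝ → ℝ × ℝ} (hA : IsConical A) {v : ℝ × ℝ} (hv : v ≠ 0) :
    A v ≠ 0 := fun h => hv (hA.injective (h.trans hA.map_zero.symm))

theorem IsConical.dir_injOn {A : ℝ × ℝ → ℝ × ℝ} (hA : IsConical A) {v w : ℝ × ℝ}
    (hv : ‖v‖ = 1) (hw : ‖w‖ = 1) (h : dir (A v) = dir (A w)) : v = w := by
  have hv0 : v ≠ 0 := by rintro rfl; simp at hv
  have hw0 : w ≠ 0 := by rintro rfl; simp at hw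
  have hAv := norm_pos_iff.2 (hA.ne_zero hv0)
  have hAw := norm_pos_iff.2 (hA.ne_zero hw0)
  have h1 : A v = (‖A v‖ / ‖A w‖) • A w := by
    calc A v = ‖A v‖ • dir (A v) := (norm_smul_dir _).symm
      _ = ‖A v‖ • dir (A w) := by rw [h]
      _ = _ := by rw [dir, smul_smul, div_eq_mul_inv]
  rw [← hA.map_smul _ (by positivity)] at h1
  have h2 := hA.injective h1
  have h3 : ‖A v‖ / ‖A w‖ = 1 := by
    have := congrArg norm h2
    rw [norm_smul, hv, hw, Real.norm_eq_abs, abs_of_pos (by positivity)] at this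
    linarith
  rw [h2, h3, one_smul]

/-- `Φ` has the (possibly nonlinear) conical derivative `A` at `d`. -/
def HasConicalDerivAt (Φ : ℝ × ℝ → ℝ × ℝ) (A : ℝ × ℝ → ℝ × ℝ) (d : ℝ × ℝ) : Prop :=
  (fun w => Φ w - Φ d - A (w - d)) =o[𝓝 d] fun w => w - d

open Classical in
/-- The direction function transported by a map `Φ` with conical derivative `A` at `d`. -/
noncomputable def pushDirection {X : Type*} (β δ : X → ℝ × ℝ) (Φ A : ℝ × ℝ → ℝ × ℝ) (d : ℝ × ℝ)
    (s : X) : ℝ × ℝ :=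
  if β s = d then dir (A (δ s)) else dir (Φ (β s) - Φ d)

theorem continuous_pushDirection {X : Type*} [TopologicalSpace X] {β δ : X → ℝ × ℝ}
    {Φ A : ℝ × ℝ → ℝ × ℝ} {d : ℝ × ℝ} (hβ : Continuous β) (hδ : Continuous δ)
    (hn : ∀ s, ‖δ s‖ = 1) (heq : ∀ s, β s ≠ d → δ s = dir (β s - d)) (hA : IsConical A)
    (hΦ : Continuous fun s => Φ (β s)) (hinj : ∀ s, Φ (β s) = Φ d → β s = d)
    (hder : HasConicalDerivAt Φ A d) : Continuous (pushDirection β δ Φ A d) := by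
  classical
  rw [continuous_iff_continuousAt]
  intro s₀
  have hne : ∀ s, δ s ≠ 0 := fun s h => by simpa [h] using hn s
  by_cases hs : β s₀ = d
  · let err : X → ℝ × ℝ := fun s => ‖β s - d‖⁻¹ • (Φ (β s) - Φ d - A (β s - d))
    have herr : Tendsto err (𝓝 s₀) (𝓝 0) := by
      have h1 := hder.comp_tendsto (hs ▸ hβ.tendsto s₀ : Tendsto β (𝓝 s₀) (𝓝 d))
      have h2 := (isLittleO_iff_tendsto' (by
        filter_upwards with s
        simp only [Function.comp_apply, norm_eq_zero]
        intro h
        have : β s = d := sub_eq_zero.1 h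
        simp [this, hA.map_zero])).1 (h1.norm_norm)
      rw [tendsto_zero_iff_norm_tendsto_zero]
      refine h2.congr fun s => ?_
      simp [err, norm_smul, div_eq_inv_mul]
    have hρ : Tendsto (fun s => A (δ s) + err s) (𝓝 s₀) (𝓝 (A (δ s₀))) := by
      simpa using ((hA.continuous.comp hδ).tendsto s₀).add herr
    have := (continuousAt_dir (hA.ne_zero (hne s₀))).tendsto.comp hρ
    rw [ContinuousAt, pushDirection, if_pos hs]
    refine this.congr fun s => ?_
    simp only [Function.comp_apply, pushDirection]
    split_ifs with h
    · simp [err, h]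
    · have hpos : 0 < ‖β s - d‖⁻¹ := inv_pos.2 (norm_pos_iff.2 (sub_ne_zero.2 h))
      rw [← dir_smul hpos (Φ (β s) - Φ d)]
      congr 1
      simp only [err]
      rw [heq s h, dir, hA.map_smul _ hpos.le, ← smul_add]
      congr 1
      abel
  · have : ∀ᶠ s in 𝓝 s₀, β s ≠ d := hβ.continuousAt.eventually_ne hs
    have h2 : ContinuousAt (fun s => dir (Φ (β s) - Φ d)) s₀ :=
      ContinuousAt.comp (g := dir)
        (continuousAt_dir (sub_ne_zero.2 fun h => hs (hinj s₀ h)))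
        (hΦ.continuousAt.sub continuousAt_const)
    refine h2.congr ?_
    filter_upwards [this] with s h
    simp [pushDirection, h]

theorem norm_pushDirection {X : Type*} {β δ : X → ℝ × ℝ} {Φ A : ℝ × ℝ → ℝ × ℝ} {d : ℝ × ℝ}
    (hn : ∀ s, ‖δ s‖ = 1) (hA : IsConical A) (hinj : ∀ s, Φ (β s) = Φ d → β s = d) (s : X) :
    ‖pushDirection β δ Φ A d s‖ = 1 := by
  unfold pushDirection
  split_ifs with h
  · exact norm_dir (hA.ne_zero fun h => by simpa [h] using hn s)
  · exact norm_dir (sub_ne_zero.2 fun hs => h (hinj s hs))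

/-- Blow-ups are transported by homeomorphisms of the square with conical derivatives. -/
theorem IsBlowup.push {X : Type*} [TopologicalSpace X] {D : Set (ℝ × ℝ)} {β : X → ℝ × ℝ}
    {δ : ℝ × ℝ → X → ℝ × ℝ} (h : IsBlowup D β δ) (hD : D ⊆ square) {Φ : ℝ × ℝ → ℝ × ℝ}
    (hc : ContinuousOn Φ square) (hi : InjOn Φ square) (him : Φ '' square = square)
    (hder : ∀ d ∈ D, ∃ A, IsConical A ∧ HasConicalDerivAt Φ A d) :
    ∃ δ', IsBlowup (Φ '' D) (Φ ∘ β) δ' := by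
  classical
  have hmem : ∀ s, β s ∈ square := fun s => h.range_blowdown ▸ mem_range_self s
  have hcβ : Continuous fun s => Φ (β s) := hc.comp_continuous h.continuous_blowdown hmem
  have hchoice : ∀ e ∈ Φ '' D, ∃ d ∈ D, Φ d = e ∧ ∃ A, IsConical A ∧ HasConicalDerivAt Φ A d := by
    rintro _ ⟨d, hd, rfl⟩
    exact ⟨d, hd, rfl, hder d hd⟩
  choose! g hgD hgΦ A hA hAder using hchoice
  have hinj : ∀ e ∈ Φ '' D, ∀ s, Φ (β s) = Φ (g e) → β s = g e := fun e he s hs =>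
    hi (hmem s) (hD (hgD e he)) hs
  have hinj' : ∀ e ∈ Φ '' D, ∀ s, Φ (β s) = e → β s = g e := fun e he s hs =>
    hinj e he s (hs.trans (hgΦ e he).symm)
  refine ⟨fun e => pushDirection β (δ (g e)) Φ (A e) (g e), hcβ, ?_, ?_, ?_, ?_, ?_, ?_⟩
  · rw [range_comp, h.range_blowdown, him]
  · intro s s' hss hs
    have := hi (hmem s) (hmem s') hss
    exact h.eq_of_notMem s s' this fun hs' => hs ⟨_, hs', rfl⟩
  · intro e he
    exact continuous_pushDirection h.continuous_blowdown (h.continuous_direction _ (hgD e he))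
      (h.norm_direction _ (hgD e he)) (h.direction_eq _ (hgD e he)) (hA e he) hcβ (hinj e he)
      (hAder e he)
  · intro e he
    exact norm_pushDirection (h.norm_direction _ (hgD e he)) (hA e he) (hinj e he)
  · intro e he s hs
    have : β s ≠ g e := fun h' => hs (by simp [h', hgΦ e he])
    simp [pushDirection, this, hgΦ e he]
  · intro e he s s' hs hs' hss
    have h1 := hinj' e he s hs
    have h2 := hinj' e he s' hs'
    simp only [pushDirection, h1, h2, if_true] at hss
    exact h.eq_of_direction_eq _ (hgD e he) s s' h1 h2
      ((hA e he).dir_injOn (h.norm_direction _ (hgD e he) s) (h.norm_direction _ (hgD e he) _) hss)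

/-! ### The radial collapse of a square annulus -/

/-- The radial collapse of the annulus `1/3 ≤ ‖z‖ ≤ 1` onto the square. -/
noncomputable def collapse (z : ℝ × ℝ) : ℝ × ℝ := (3 / 2 : ℝ) • z - (1 / 2 : ℝ) • dir z

theorem collapse_eq_self {z : ℝ × ℝ} (hz : ‖z‖ = 1) : collapse z = z := by
  rw [collapse, dir_eq_self hz, ← sub_smul]
  norm_num

theorem collapse_eq_smul (z : ℝ × ℝ) :
    collapse z = (3 / 2 - 1 / (2 * ‖z‖)) • z := by
  rw [collapse, dir, smul_smul, ← sub_smul]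
  congr 2
  rw [one_div, one_div, mul_inv]

theorem collapse_coeff_nonneg {z : ℝ × ℝ} (hz : 1 / 3 ≤ ‖z‖) : 0 ≤ 3 / 2 - 1 / (2 * ‖z‖) := by
  have : 0 < ‖z‖ := by linarith
  rw [sub_nonneg, div_le_div_iff₀ (by positivity) (by norm_num)]
  linarith

theorem collapse_coeff_pos {z : ℝ × ℝ} (hz : 1 / 3 < ‖z‖) : 0 < 3 / 2 - 1 / (2 * ‖z‖) := by
  have : 0 < ‖z‖ := by linarith
  rw [sub_pos, div_lt_div_iff₀ (by positivity) (by norm_num)]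
  linarith

theorem norm_collapse {z : ℝ × ℝ} (hz : 1 / 3 ≤ ‖z‖) : ‖collapse z‖ = 3 / 2 * ‖z‖ - 1 / 2 := by
  have : 0 < ‖z‖ := by linarith
  rw [collapse_eq_smul, norm_smul, Real.norm_eq_abs, abs_of_nonneg (collapse_coeff_nonneg hz)]
  field_simp

theorem dir_collapse {z : ℝ × ℝ} (hz : 1 / 3 < ‖z‖) : dir (collapse z) = dir z := by
  rw [collapse_eq_smul, dir_smul (collapse_coeff_pos hz)]

theorem eq_of_collapse_eq {z w : ℝ × ℝ} (hz : 1 / 3 < ‖z‖) (hw : 1 / 3 ≤ ‖w‖)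
    (h : collapse z = collapse w) : z = w := by
  have h1 := congrArg norm h
  rw [norm_collapse hz.le, norm_collapse hw] at h1
  have h2 : ‖z‖ = ‖w‖ := by linarith
  have h3 : dir z = dir w := by rw [← dir_collapse hz, h, dir_collapse (h2 ▸ hz)]
  rw [← norm_smul_dir z, ← norm_smul_dir w, h2, h3]

theorem collapse_eq_zero {z : ℝ × ℝ} (hz : 1 / 3 ≤ ‖z‖) : collapse z = 0 ↔ ‖z‖ = 1 / 3 := by
  rw [← norm_eq_zero, norm_collapse hz]
  constructor <;> intro h <;> linarith

theorem norm_collapse_sub_le {z w : ℝ × ℝ} (hz : 1 / 3 ≤ ‖z‖) (hw : 1 / 3 ≤ ‖w‖) :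
    ‖collapse z - collapse w‖ ≤ 3 / 2 * ‖z - w‖ := by
  have hz0 : 0 < ‖z‖ := by linarith
  have hw0 : 0 < ‖w‖ := by linarith
  have key : collapse z - collapse w = (3 / 2 - 1 / (2 * ‖z‖)) • (z - w) +
      ((‖z‖ - ‖w‖) / (2 * ‖w‖ * ‖z‖)) • w := by
    rw [collapse_eq_smul, collapse_eq_smul, smul_sub, sub_add, ← sub_smul]
    congr 2
    field_simp
    ring
  have h1 := collapse_coeff_nonneg hz
  calc ‖collapse z - collapse w‖
      ≤ ‖(3 / 2 - 1 / (2 * ‖z‖)) • (z - w)‖ + ‖((‖z‖ - ‖w‖) / (2 * ‖w‖ * ‖z‖)) • w‖ := by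
        rw [key]; exact norm_add_le _ _
    _ = (3 / 2 - 1 / (2 * ‖z‖)) * ‖z - w‖ + |‖z‖ - ‖w‖| / (2 * ‖z‖) := by
        rw [norm_smul, norm_smul, Real.norm_eq_abs, Real.norm_eq_abs, abs_of_nonneg h1, abs_div,
          abs_of_pos (by positivity : 0 < 2 * ‖w‖ * ‖z‖)]
        congr 1
        field_simp
    _ ≤ (3 / 2 - 1 / (2 * ‖z‖)) * ‖z - w‖ + ‖z - w‖ / (2 * ‖z‖) := by
        gcongr
        exact abs_norm_sub_norm_le z w
    _ = _ := by ring

/-- The one-sided derivative of `|·|` away from zero. -/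
theorem abs_eq_abs_add_eventually {x : ℝ} (hx : x ≠ 0) :
    ∃ s : ℝ, |s| = 1 ∧ s * x = |x| ∧ ∀ᶠ y in 𝓝 x, |y| = |x| + s * (y - x) := by
  rcases hx.lt_or_gt with h | h
  · refine ⟨-1, by simp, by rw [abs_of_neg h]; ring, ?_⟩
    filter_upwards [gt_mem_nhds h] with y hy
    rw [abs_of_neg h, abs_of_neg hy]; ring
  · refine ⟨1, by simp, by rw [abs_of_pos h]; ring, ?_⟩
    filter_upwards [lt_mem_nhds h] with y hy
    rw [abs_of_pos h, abs_of_pos hy]; ring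

/-- The sup norm coincides near a nonzero vector with an affine-homogeneous function. -/
theorem exists_norm_conicalDeriv {z : ℝ × ℝ} (hz : z ≠ 0) :
    ∃ N : ℝ × ℝ → ℝ, Continuous N ∧ (∀ c : ℝ, 0 ≤ c → ∀ v, N (c • v) = c * N v) ∧
      (∀ v (t : ℝ), N (v + t • z) = N v + t * ‖z‖) ∧ (∀ v, |N v| ≤ ‖v‖) ∧
      ∀ᶠ w in 𝓝 z, ‖w‖ = ‖z‖ + N (w - z) := by
  have hfst : Tendsto (Prod.fst : ℝ × ℝ → ℝ) (𝓝 z) (𝓝 z.1) := continuous_fst.tendsto z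
  have hsnd : Tendsto (Prod.snd : ℝ × ℝ → ℝ) (𝓝 z) (𝓝 z.2) := continuous_snd.tendsto z
  have hcont : Continuous fun w : ℝ × ℝ => |w.1| - |w.2| := by fun_prop
  have hn : ∀ w : ℝ × ℝ, ‖w‖ = max |w.1| |w.2| := fun w => rfl
  rcases lt_trichotomy |z.1| |z.2| with h | h | h
  · obtain ⟨s, hs, hsx, hev⟩ := abs_eq_abs_add_eventually (x := z.2)
      (fun h0 => by rw [h0, abs_zero] at h; exact absurd h (abs_nonneg _).not_gt)
    have hnz : ‖z‖ = |z.2| := by rw [hn, max_eq_right h.le]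
    refine ⟨fun v => s * v.2, by fun_prop, fun c _ v => by simp; ring, fun v t => ?_, fun v => ?_,
      ?_⟩
    · simp only [Prod.snd_add, Prod.smul_snd, smul_eq_mul]
      rw [hnz, ← hsx]; ring
    · simp only [abs_mul, hs, one_mul]; exact norm_snd_le v
    · have : ∀ᶠ w : ℝ × ℝ in 𝓝 z, |w.1| - |w.2| < 0 :=
        (hcont.tendsto z).eventually (gt_mem_nhds (by linarith))
      filter_upwards [this, hsnd.eventually hev] with w h1 h2
      rw [hn w, max_eq_right (by linarith), h2, hnz]; rfl
  · have hz1 : z.1 ≠ 0 := by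
      intro h0
      rw [h0, abs_zero, eq_comm, abs_eq_zero] at h
      exact hz (Prod.ext h0 h)
    have hz2 : z.2 ≠ 0 := by
      intro h0
      rw [h0, abs_zero, abs_eq_zero] at h
      exact hz1 h
    obtain ⟨s, hs, hsx, hev⟩ := abs_eq_abs_add_eventually hz1
    obtain ⟨s', hs', hsx', hev'⟩ := abs_eq_abs_add_eventually hz2
    have hnz : ‖z‖ = |z.1| := by rw [hn, ← h, max_self]
    refine ⟨fun v => max (s * v.1) (s' * v.2), by fun_prop, fun c hc v => ?_, fun v t => ?_,
      fun v => ?_, ?_⟩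
    · simp only [Prod.smul_fst, Prod.smul_snd, smul_eq_mul]
      rw [mul_max_of_nonneg _ _ hc]
      congr 1 <;> ring
    · simp only [Prod.snd_add, Prod.smul_snd, smul_eq_mul, Prod.fst_add, Prod.smul_fst]
      rw [max_add]
      congr 1
      · rw [hnz, ← hsx]; ring
      · rw [hnz, h, ← hsx']; ring
    · refine abs_max_le_max_abs_abs.trans ?_
      rw [abs_mul, abs_mul, hs, hs', one_mul, one_mul, hn]
    · filter_upwards [hfst.eventually hev, hsnd.eventually hev'] with w h1 h2
      rw [hn w, h1, h2, hnz, ← h, add_max]; rfl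
  · obtain ⟨s, hs, hsx, hev⟩ := abs_eq_abs_add_eventually (x := z.1)
      (fun h0 => by rw [h0, abs_zero] at h; exact absurd h (abs_nonneg _).not_gt)
    have hnz : ‖z‖ = |z.1| := by rw [hn, max_eq_left h.le]
    refine ⟨fun v => s * v.1, by fun_prop, fun c _ v => by simp; ring, fun v t => ?_, fun v => ?_,
      ?_⟩
    · simp only [Prod.fst_add, Prod.smul_fst, smul_eq_mul]
      rw [hnz, ← hsx]; ring
    · simp only [abs_mul, hs, one_mul]; exact norm_fst_le v
    · have : ∀ᶠ w : ℝ × ℝ in 𝓝 z, 0 < |w.1| - |w.2| :=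
        (hcont.tendsto z).eventually (lt_mem_nhds (by linarith))
      filter_upwards [this, hfst.eventually hev] with w h1 h2
      rw [hn w, max_eq_left (by linarith), h2, hnz]; rfl

theorem collapse_conicalDeriv {z : ℝ × ℝ} (hz : 1 / 3 < ‖z‖) :
    ∃ A, IsConical A ∧ HasConicalDerivAt collapse A z := by
  have hn : 0 < ‖z‖ := by linarith
  obtain ⟨N, hNc, hNs, hNa, hNb, hNe⟩ := exists_norm_conicalDeriv (norm_pos_iff.1 hn)
  set n := ‖z‖ with hn'
  set k : ℝ := 3 / 2 - 1 / (2 * n) with hk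
  have hk0 : 0 < k := collapse_coeff_pos hz
  refine ⟨fun v => k • v + (N v / (2 * n ^ 2)) • z, ⟨by fun_prop, fun c hc v => ?_, ?_⟩, ?_⟩
  · simp only [hNs c hc, smul_add, smul_smul]
    congr 2 <;> ring
  · intro v v' hvv
    simp only at hvv
    set t : ℝ := (N v - N v') / (2 * n ^ 2) / k with ht
    have h1 : v' = v + t • z := by
      have h2 : k • (v' - v) = ((N v - N v') / (2 * n ^ 2)) • z := by
        clear_value k
        rw [sub_div, sub_smul]
        linear_combination (norm := module) (-1 : ℝ) • hvv
      have h3 : v' - v = t • z := by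
        rw [ht, div_eq_inv_mul, ← smul_smul, ← h2, smul_smul, inv_mul_cancel₀ hk0.ne', one_smul]
      rw [← h3]; abel
    have h4 : t = 0 := by
      have h5 : N v' = N v + t * n := by rw [h1, hNa]
      have h6 : t * k = (N v - N v') / (2 * n ^ 2) := by rw [ht]; field_simp
      rw [h5, hk] at h6
      field_simp at h6
      have h7 : t * (n * (3 * n)) = 0 := by linarith
      exact (mul_eq_zero.1 h7).resolve_right (by positivity)
    simpa [h4, eq_comm] using h1
  · set g : ℝ × (ℝ × ℝ) → ℝ × ℝ := fun q => q.1⁻¹ • q.2 with hg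
    have hgd : HasFDerivAt g ((n⁻¹ • ContinuousLinearMap.snd ℝ ℝ (ℝ × ℝ)) +
        ((-(n ^ 2)⁻¹) • ContinuousLinearMap.fst ℝ ℝ (ℝ × ℝ)).smulRight z) (n, z) := by
      have h1 : HasFDerivAt (fun q : ℝ × (ℝ × ℝ) => q.1⁻¹)
          ((-(n ^ 2)⁻¹) • ContinuousLinearMap.fst ℝ ℝ (ℝ × ℝ)) (n, z) := by
        have := (hasDerivAt_inv hn.ne').comp_hasFDerivAt (n, z)
          (hasFDerivAt_fst (𝕜 := ℝ) (p := (n, z)))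
        exact this
      exact h1.smul (hasFDerivAt_snd (𝕜 := ℝ) (p := (n, z)))
    have hlim : Tendsto (fun w : ℝ × ℝ => (n + N (w - z), w)) (𝓝 z) (𝓝 (n, z)) := by
      have : Continuous fun w : ℝ × ℝ => (n + N (w - z), w) := by fun_prop
      have hN0 : N 0 = 0 := by simpa using hNs 0 le_rfl 0
      simpa [hN0] using this.tendsto z
    have h1 := hgd.isLittleO.comp_tendsto hlim
    have h2 : ((fun q : ℝ × (ℝ × ℝ) => q - (n, z)) ∘ fun w : ℝ × ℝ => (n + N (w - z), w))
        =O[𝓝 z] fun w => w - z := by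
      refine IsBigO.of_bound 1 (Eventually.of_forall fun w => ?_)
      simp only [Function.comp_apply, Prod.mk_sub_mk, add_sub_cancel_left, one_mul]
      exact max_le (hNb _) le_rfl
    have h3 := (h1.trans_isBigO h2).const_smul_left (-(1 / 2 : ℝ))
    refine h3.congr' ?_ (Eventually.of_forall fun _ => rfl)
    filter_upwards [hNe] with w hw
    have hd : ∀ u : ℝ × ℝ, dir u = ‖u‖⁻¹ • u := fun _ => rfl
    simp only [Function.comp_apply, collapse, hd, hw, hg, ← hn', Pi.smul_apply]
    generalize hm : n + N (w - z) = m
    have hN : N (w - z) = m - n := by linarith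
    ext <;> simp [hk, hN] <;> field_simp <;> ring

/-! ### Coding maps and the branches of the collapsed carpet -/

/-- An iterated function system of uniform contractions has a continuous coding map. -/
theorem exists_coding {I Y : Type*} [TopologicalSpace I] [DiscreteTopology I] [CompactSpace I]
    [MetricSpace Y] [CompleteSpace Y] [Nonempty Y] {K : NNReal} (hK : K < 1) {h : I → Y → Y}
    (hh : ∀ i, LipschitzWith K (h i)) :
    ∃ b : (ℕ → I) → Y, Continuous b ∧ ∀ a, b a = h (a 0) (b fun n => a (n + 1)) := by
  have hcont : Continuous fun q : I × Y => h q.1 q.2 := by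
    rw [continuous_prod_of_discrete_left]
    exact fun i => (hh i).continuous
  let Θ : C(ℕ → I, Y) → C(ℕ → I, Y) := fun b =>
    ⟨fun a => h (a 0) (b fun n => a (n + 1)),
      hcont.comp (f := fun a : ℕ → I => (a 0, b fun n => a (n + 1))) (by fun_prop)⟩
  have hΘ : ContractingWith K Θ := by
    refine ⟨hK, LipschitzWith.of_dist_le_mul fun b b' => ?_⟩
    rw [ContinuousMap.dist_le (by positivity)]
    intro a
    refine ((hh (a 0)).dist_le_mul _ _).trans ?_
    gcongr
    exact ContinuousMap.dist_apply_le_dist _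
  obtain ⟨y⟩ := ‹Nonempty Y›
  have : Nonempty C(ℕ → I, Y) := ⟨ContinuousMap.const _ y⟩
  refine ⟨hΘ.fixedPoint, (ContractingWith.fixedPoint Θ hΘ).continuous, fun a => ?_⟩
  conv_lhs => rw [← hΘ.fixedPoint_isFixedPt]
  rfl

/-- The digits of the carpet: the eight tiles of the `3 × 3` grid other than the central one. -/
abbrev Digit : Type := {x : Fin 3 × Fin 3 // ¬(x.1 = 1 ∧ x.2 = 1)}

/-- The inverse branches of `z ↦ 3 z` onto the eight tiles of the square. -/
noncomputable def tile (i : Digit) (z : ℝ × ℝ) : ℝ × ℝ :=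
  ((z.1 + 2 * ((i.1.1 : ℝ) - 1)) / 3, (z.2 + 2 * ((i.1.2 : ℝ) - 1)) / 3)

theorem tile_sub (i : Digit) (z w : ℝ × ℝ) : tile i z - tile i w = (1 / 3 : ℝ) • (z - w) := by
  ext <;> simp [tile] <;> ring

theorem tile_injective (i : Digit) : Function.Injective (tile i) := by
  intro z w h
  have := tile_sub i z w
  rw [h, sub_self, eq_comm, smul_eq_zero] at this
  exact sub_eq_zero.1 (this.resolve_left (by norm_num))

theorem fin_three_cases (k : Fin 3) : k = 0 ∨ k = 1 ∨ k = 2 := by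
  fin_cases k <;> simp

theorem norm_le_iff_abs {z : ℝ × ℝ} {r : ℝ} : ‖z‖ ≤ r ↔ |z.1| ≤ r ∧ |z.2| ≤ r := max_le_iff

theorem norm_lt_iff_abs {z : ℝ × ℝ} {r : ℝ} : ‖z‖ < r ↔ |z.1| < r ∧ |z.2| < r := max_lt_iff

theorem abs_fst_le (z : ℝ × ℝ) : |z.1| ≤ ‖z‖ := norm_fst_le z

theorem abs_snd_le (z : ℝ × ℝ) : |z.2| ≤ ‖z‖ := norm_snd_le z

theorem norm_tile_le (i : Digit) {z : ℝ × ℝ} (hz : ‖z‖ ≤ 1) : ‖tile i z‖ ≤ 1 := by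
  rw [norm_le_iff_abs, abs_le, abs_le] at *
  obtain ⟨⟨a, b⟩, h⟩ := i
  simp only [tile]
  rcases fin_three_cases a with rfl | rfl | rfl <;>
    rcases fin_three_cases b with rfl | rfl | rfl <;>
    norm_num <;> refine ⟨⟨?_, ?_⟩, ?_, ?_⟩ <;> linarith

theorem norm_tile_lt (i : Digit) {z : ℝ × ℝ} (hz : ‖z‖ < 1) : ‖tile i z‖ < 1 := by
  rw [norm_lt_iff_abs, abs_lt, abs_lt] at *
  obtain ⟨⟨a, b⟩, h⟩ := i
  simp only [tile]
  rcases fin_three_cases a with rfl | rfl | rfl <;>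
    rcases fin_three_cases b with rfl | rfl | rfl <;>
    norm_num <;> refine ⟨⟨?_, ?_⟩, ?_, ?_⟩ <;> linarith

theorem le_norm_tile (i : Digit) {z : ℝ × ℝ} (hz : ‖z‖ ≤ 1) : 1 / 3 ≤ ‖tile i z‖ := by
  by_contra! h
  rw [norm_le_iff_abs, abs_le, abs_le] at hz
  rw [norm_lt_iff_abs, abs_lt, abs_lt] at h
  obtain ⟨⟨a, b⟩, hi⟩ := i
  simp only [tile] at h
  rcases fin_three_cases a with rfl | rfl | rfl <;>
    rcases fin_three_cases b with rfl | rfl | rfl <;>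
    norm_num at h hi <;> linarith

theorem lt_norm_tile (i : Digit) {z : ℝ × ℝ} (hz : ‖z‖ < 1) : 1 / 3 < ‖tile i z‖ := by
  by_contra! h
  rw [norm_lt_iff_abs, abs_lt, abs_lt] at hz
  rw [norm_le_iff_abs, abs_le, abs_le] at h
  obtain ⟨⟨a, b⟩, hi⟩ := i
  simp only [tile] at h
  rcases fin_three_cases a with rfl | rfl | rfl <;>
    rcases fin_three_cases b with rfl | rfl | rfl <;>
    norm_num at h hi <;> linarith

theorem abs_eq_one_of_add_eq {a b : Fin 3} (hab : a ≠ b) {x y : ℝ} (hx : |x| ≤ 1) (hy : |y| ≤ 1)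
    (h : (x + 2 * ((a : ℝ) - 1)) / 3 = (y + 2 * ((b : ℝ) - 1)) / 3) : 1 ≤ |x| ∧ 1 ≤ |y| := by
  rw [abs_le] at hx hy
  rw [le_abs, le_abs]
  rcases fin_three_cases a with rfl | rfl | rfl <;>
    rcases fin_three_cases b with rfl | rfl | rfl <;>
    norm_num at h hab
  all_goals first
    | exact ⟨Or.inl (by linarith), Or.inr (by linarith)⟩
    | exact ⟨Or.inr (by linarith), Or.inl (by linarith)⟩

theorem norm_eq_one_of_tile_eq {i j : Digit} (hij : i ≠ j) {z w : ℝ × ℝ} (hz : ‖z‖ ≤ 1)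
    (hw : ‖w‖ ≤ 1) (h : tile i z = tile j w) : ‖z‖ = 1 ∧ ‖w‖ = 1 := by
  have h1 := congrArg Prod.fst h
  have h2 := congrArg Prod.snd h
  have hz' := norm_le_iff_abs.1 hz
  have hw' := norm_le_iff_abs.1 hw
  by_cases h3 : i.1.1 = j.1.1
  · have h4 : i.1.2 ≠ j.1.2 := fun h4 => hij (Subtype.ext (Prod.ext h3 h4))
    have := abs_eq_one_of_add_eq h4 hz'.2 hw'.2 h2
    exact ⟨hz.antisymm (this.1.trans (abs_snd_le _)), hw.antisymm (this.2.trans (abs_snd_le _))⟩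
  · have := abs_eq_one_of_add_eq h3 hz'.1 hw'.1 h1
    exact ⟨hz.antisymm (this.1.trans (abs_fst_le _)), hw.antisymm (this.2.trans (abs_fst_le _))⟩

theorem exists_tile_coordinate {x : ℝ} (hx : |x| ≤ 1) :
    ∃ a : Fin 3, |3 * x - 2 * ((a : ℝ) - 1)| ≤ 1 ∧ (a = 1 → |x| < 1 / 3) := by
  simp only [abs_le, abs_lt] at *
  rcases le_or_gt x (-(1 / 3)) with h | h
  · exact ⟨0, by norm_num; constructor <;> linarith⟩
  · rcases le_or_gt (1 / 3) x with h' | h'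
    · exact ⟨2, by norm_num; constructor <;> linarith, fun h => absurd h (by decide)⟩
    · exact ⟨1, by norm_num; refine ⟨⟨?_, ?_⟩, ?_, ?_⟩ <;> linarith⟩

theorem exists_tile {z : ℝ × ℝ} (hz : ‖z‖ ≤ 1) (hz' : 1 / 3 ≤ ‖z‖) :
    ∃ i w, ‖w‖ ≤ 1 ∧ tile i w = z := by
  have h := norm_le_iff_abs.1 hz
  obtain ⟨a, ha, ha'⟩ := exists_tile_coordinate h.1
  obtain ⟨b, hb, hb'⟩ := exists_tile_coordinate h.2
  refine ⟨⟨(a, b), fun hab => ?_⟩,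
    (3 * z.1 - 2 * ((a : ℝ) - 1), 3 * z.2 - 2 * ((b : ℝ) - 1)), norm_le_iff_abs.2 ⟨ha, hb⟩, ?_⟩
  · exact (norm_lt_iff_abs.2 ⟨ha' hab.1, hb' hab.2⟩).not_ge hz'
  · ext <;> simp [tile]

/-- The inverse branches of the collapsed carpet. -/
noncomputable def branch (i : Digit) (z : ℝ × ℝ) : ℝ × ℝ := collapse (tile i z)

theorem norm_branch_le (i : Digit) {z : ℝ × ℝ} (hz : ‖z‖ ≤ 1) : ‖branch i z‖ ≤ 1 := by
  rw [branch, norm_collapse (le_norm_tile i hz)]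
  linarith [norm_tile_le i hz]

theorem norm_branch_lt (i : Digit) {z : ℝ × ℝ} (hz : ‖z‖ < 1) : ‖branch i z‖ < 1 := by
  rw [branch, norm_collapse (le_norm_tile i hz.le)]
  linarith [norm_tile_lt i hz]

theorem norm_branch_sub_le (i : Digit) {z w : ℝ × ℝ} (hz : ‖z‖ ≤ 1) (hw : ‖w‖ ≤ 1) :
    ‖branch i z - branch i w‖ ≤ 1 / 2 * ‖z - w‖ := by
  refine (norm_collapse_sub_le (le_norm_tile i hz) (le_norm_tile i hw)).trans ?_
  rw [tile_sub, norm_smul]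
  norm_num
  linarith

theorem branch_conicalDeriv (i : Digit) {d : ℝ × ℝ} (hd : ‖d‖ < 1) :
    ∃ A, IsConical A ∧ HasConicalDerivAt (branch i) A d := by
  obtain ⟨A, hA, hder⟩ := collapse_conicalDeriv (lt_norm_tile i hd)
  refine ⟨fun v => A ((1 / 3 : ℝ) • v), ⟨hA.continuous.comp (by fun_prop), fun c hc v => ?_,
    fun v w h => ?_⟩, ?_⟩
  · simp only [smul_comm _ c v, hA.map_smul c hc]
  · exact smul_right_injective _ (by norm_num : (1 / 3 : ℝ) ≠ 0) (hA.injective h)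
  · have hc : Continuous (tile i) := by unfold tile; fun_prop
    have h1 := hder.comp_tendsto (hc.tendsto d)
    have h2 : ((fun w => w - tile i d) ∘ tile i) =O[𝓝 d] fun w => w - d := by
      refine IsBigO.of_bound 1 (Eventually.of_forall fun w => ?_)
      simp only [Function.comp_apply, tile_sub, norm_smul]
      norm_num
      linarith [norm_nonneg (w - d)]
    refine (h1.trans_isBigO h2).congr_left fun w => ?_
    simp [Function.comp_apply, branch, tile_sub]

theorem exists_branch {w : ℝ × ℝ} (hw : ‖w‖ ≤ 1) : ∃ i z, ‖z‖ ≤ 1 ∧ branch i z = w := by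
  rcases eq_or_ne w 0 with rfl | h0
  · have h : ‖((1 / 3 : ℝ), (0 : ℝ))‖ = 1 / 3 := by
      simp [Prod.norm_def]
    obtain ⟨i, z, hz, hiz⟩ := exists_tile (z := ((1 / 3 : ℝ), (0 : ℝ)))
      (by rw [h]; norm_num) h.ge
    exact ⟨i, z, hz, by rw [branch, hiz, collapse_eq_zero h.ge, h]⟩
  · set r : ℝ := 2 / 3 * ‖w‖ + 1 / 3 with hr
    have hn := norm_pos_iff.2 h0
    have hr0 : 0 < r := by positivity
    have h : ‖r • dir w‖ = r := by
      rw [norm_smul, norm_dir h0, mul_one, Real.norm_eq_abs, abs_of_pos hr0]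
    obtain ⟨i, z, hz, hiz⟩ := exists_tile (z := r • dir w) (by rw [h]; linarith)
      (by rw [h]; linarith)
    refine ⟨i, z, hz, ?_⟩
    rw [branch, hiz, collapse, dir_smul hr0, dir_eq_self (norm_dir h0), smul_smul, ← sub_smul]
    conv_rhs => rw [← norm_smul_dir w]
    congr 1
    rw [hr]; ring

/-! ### The carpet as a blow-up of the square -/

/-- The real number with ternary digits `a`. -/
noncomputable def ternary (a : ℕ → Fin 3) : ℝ := ∑' i : ℕ, (a i : ℝ) / 3 ^ (i + 1)

theorem fin_three_cast_le (k : Fin 3) : (k : ℝ) ≤ 2 := by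
  exact_mod_cast Nat.lt_succ_iff.1 k.2

theorem ternary_term_le (a : ℕ → Fin 3) (i : ℕ) :
    (a i : ℝ) / 3 ^ (i + 1) ≤ 2 / 3 * (1 / 3) ^ i := by
  rw [pow_succ, one_div_pow]
  have := fin_three_cast_le (a i)
  have h3 : (0 : ℝ) < 3 ^ i := by positivity
  rw [div_le_iff₀ (by positivity)]
  field_simp
  linarith

theorem summable_geometric_third : Summable fun i : ℕ => 2 / 3 * (1 / 3 : ℝ) ^ i :=
  (summable_geometric_of_lt_one (by norm_num) (by norm_num)).mul_left _

theorem summable_ternary (a : ℕ → Fin 3) : Summable fun i : ℕ => (a i : ℝ) / 3 ^ (i + 1) :=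
  Summable.of_nonneg_of_le (fun i => by positivity) (ternary_term_le a) summable_geometric_third

theorem ternary_nonneg (a : ℕ → Fin 3) : 0 ≤ ternary a := tsum_nonneg fun i => by positivity

theorem ternary_le_one (a : ℕ → Fin 3) : ternary a ≤ 1 := by
  refine ((summable_ternary a).tsum_le_tsum (ternary_term_le a) summable_geometric_third).trans ?_
  rw [tsum_mul_left, tsum_geometric_of_lt_one (by norm_num) (by norm_num)]
  norm_num

theorem ternary_eq (a : ℕ → Fin 3) :
    ternary a = ((a 0 : ℝ) + ternary fun n => a (n + 1)) / 3 := by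
  rw [ternary, (summable_ternary a).tsum_eq_zero_add, add_div, ternary, ← tsum_div_const]
  congr 1
  · simp
  · congr 1
    funext i
    rw [pow_succ 3 (i + 1)]
    field_simp

theorem continuous_ternary : Continuous ternary := by
  refine continuous_tsum (fun i => ?_) summable_geometric_third fun i a => ?_
  · exact (continuous_of_discreteTopology (f := fun k : Fin 3 => (k : ℝ) / 3 ^ (i + 1))).comp
      (continuous_apply i)
  · rw [Real.norm_eq_abs, abs_of_nonneg (by positivity)]
    exact ternary_term_le a i

/-- The point of `[-1,1]²` with a given address in the carpet rescaled to the square. -/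
noncomputable def address (a : ℕ → Digit) : ℝ × ℝ :=
  (2 * ternary (fun n => (a n).1.1) - 1, 2 * ternary (fun n => (a n).1.2) - 1)

theorem address_eq (a : ℕ → Digit) : address a = tile (a 0) (address fun n => a (n + 1)) := by
  ext
  · simp only [address, tile]
    rw [ternary_eq]; ring
  · simp only [address, tile]
    rw [ternary_eq]; ring

theorem norm_address_le (a : ℕ → Digit) : ‖address a‖ ≤ 1 := by
  rw [norm_le_iff_abs, abs_le, abs_le]
  have h1 := ternary_nonneg (fun n => (a n).1.1)
  have h2 := ternary_nonneg (fun n => (a n).1.2)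
  have h3 := ternary_le_one (fun n => (a n).1.1)
  have h4 := ternary_le_one (fun n => (a n).1.2)
  simp only [address]
  refine ⟨⟨?_, ?_⟩, ?_, ?_⟩ <;> linarith

theorem exists_collapsed :
    ∃ b : (ℕ → Digit) → ℝ × ℝ, Continuous b ∧ (∀ a, ‖b a‖ ≤ 1) ∧
      ∀ a, b a = branch (a 0) (b fun n => a (n + 1)) := by
  let h : Digit → square → square := fun i z =>
    ⟨branch i z, mem_square.2 (norm_branch_le i (mem_square.1 z.2))⟩
  have hK : (1 / 2 : NNReal) < 1 := by
    rw [← NNReal.coe_lt_coe]; norm_num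
  have hh : ∀ i, LipschitzWith (1 / 2 : NNReal) (h i) := fun i =>
    LipschitzWith.of_dist_le_mul fun z w => by
      have := norm_branch_sub_le i (mem_square.1 z.2) (mem_square.1 w.2)
      simpa [Subtype.dist_eq, dist_eq_norm, h] using this
  have : Nonempty square := ⟨⟨0, mem_square.2 (by simp)⟩⟩
  obtain ⟨b, hb, hb'⟩ := exists_coding hK hh
  exact ⟨fun a => b a, by fun_prop, fun a => mem_square.1 (b a).2,
    fun a => congrArg Subtype.val (hb' a)⟩

/-- The point of the square to which the carpet point of a given address is collapsed. -/
noncomputable def collapsed : (ℕ → Digit) → ℝ × ℝ := Classical.choose exists_collapsed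

theorem continuous_collapsed : Continuous collapsed := (Classical.choose_spec exists_collapsed).1

theorem norm_collapsed_le (a : ℕ → Digit) : ‖collapsed a‖ ≤ 1 :=
  (Classical.choose_spec exists_collapsed).2.1 a

theorem collapsed_eq (a : ℕ → Digit) : collapsed a = branch (a 0) (collapsed fun n => a (n + 1)) :=
  (Classical.choose_spec exists_collapsed).2.2 a

theorem eq_of_forall_norm_sub_le {z w : ℝ × ℝ}
    (h : ∀ n : ℕ, ‖z - w‖ ≤ 2 * (1 / 2 : ℝ) ^ n) : z = w := by
  have h1 : Tendsto (fun n : ℕ => 2 * (1 / 2 : ℝ) ^ n) atTop (𝓝 (2 * 0)) :=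
    (tendsto_pow_atTop_nhds_zero_of_lt_one (by norm_num) (by norm_num)).const_mul _
  rw [mul_zero] at h1
  have h2 := ge_of_tendsto' h1 h
  exact sub_eq_zero.1 (norm_eq_zero.1 (h2.antisymm (norm_nonneg _)))

theorem norm_sub_le_two {z w : ℝ × ℝ} (hz : ‖z‖ ≤ 1) (hw : ‖w‖ ≤ 1) : ‖z - w‖ ≤ 2 :=
  (norm_sub_le _ _).trans (by linarith)

theorem norm_tile_sub (i : Digit) (z w : ℝ × ℝ) : ‖tile i z - tile i w‖ ≤ 1 / 2 * ‖z - w‖ := by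
  rw [tile_sub, norm_smul]
  norm_num
  linarith [norm_nonneg (z - w)]

theorem collapsed_eq_address_of_norm_address {a : ℕ → Digit} (h : ‖address a‖ = 1) :
    collapsed a = address a := by
  refine eq_of_forall_norm_sub_le fun n => ?_
  induction n generalizing a with
  | zero => simpa using norm_sub_le_two (norm_collapsed_le a) (norm_address_le a)
  | succ n ih =>
    have h1 : ‖address fun n => a (n + 1)‖ = 1 := by
      refine (norm_address_le _).antisymm (not_lt.1 fun hlt => ?_)
      have := norm_tile_lt (a 0) hlt
      rw [← address_eq, h] at this
      exact lt_irrefl _ this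
    have h2 : address a = branch (a 0) (address fun n => a (n + 1)) := by
      rw [branch, ← address_eq, collapse_eq_self h]
    rw [h2, collapsed_eq, pow_succ]
    have := norm_branch_sub_le (a 0) (norm_collapsed_le fun n => a (n + 1))
      (norm_address_le fun n => a (n + 1))
    linarith [ih h1]

theorem collapsed_eq_address_of_norm_collapsed {a : ℕ → Digit} (h : ‖collapsed a‖ = 1) :
    collapsed a = address a := by
  refine eq_of_forall_norm_sub_le fun n => ?_
  induction n generalizing a with
  | zero => simpa using norm_sub_le_two (norm_collapsed_le a) (norm_address_le a)
  | succ n ih =>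
    have h1 : ‖collapsed fun n => a (n + 1)‖ = 1 := by
      refine (norm_collapsed_le _).antisymm (not_lt.1 fun hlt => ?_)
      have := norm_branch_lt (a 0) hlt
      rw [← collapsed_eq, h] at this
      exact lt_irrefl _ this
    have h2 : collapsed a = tile (a 0) (collapsed fun n => a (n + 1)) := by
      rw [collapsed_eq, branch, norm_collapse (le_norm_tile _ (norm_collapsed_le _))] at h
      rw [collapsed_eq, branch, collapse_eq_self (by linarith)]
    rw [h2, address_eq, pow_succ]
    have := norm_tile_sub (a 0) (collapsed fun n => a (n + 1)) (address fun n => a (n + 1))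
    linarith [ih h1]

theorem collapsed_congr {a a' : ℕ → Digit} (h : address a = address a') :
    collapsed a = collapsed a' := by
  refine eq_of_forall_norm_sub_le fun n => ?_
  induction n generalizing a a' with
  | zero => simpa using norm_sub_le_two (norm_collapsed_le a) (norm_collapsed_le a')
  | succ n ih =>
    have h' := h
    rw [address_eq a, address_eq a'] at h'
    by_cases h0 : a 0 = a' 0
    · rw [h0] at h'
      have h1 := ih (tile_injective _ h')
      rw [collapsed_eq a, collapsed_eq a', h0, pow_succ]
      have := norm_branch_sub_le (a' 0) (norm_collapsed_le fun n => a (n + 1))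
        (norm_collapsed_le fun n => a' (n + 1))
      linarith
    · obtain ⟨h1, h2⟩ := norm_eq_one_of_tile_eq h0 (norm_address_le _) (norm_address_le _) h'
      rw [collapsed_eq a, collapsed_eq a', collapsed_eq_address_of_norm_address h1,
        collapsed_eq_address_of_norm_address h2, branch, branch, h', sub_self, norm_zero]
      positivity

/-- The points of the square to which the boundaries of the holes of the carpet collapse. -/
noncomputable def holes : Set (ℝ × ℝ) := range fun l : List Digit => l.foldr branch 0

theorem norm_lt_of_mem_holes {d : ℝ × ℝ} (hd : d ∈ holes) : ‖d‖ < 1 := by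
  obtain ⟨l, rfl⟩ := hd
  induction l with
  | nil => simp
  | cons i l ih => exact norm_branch_lt i ih

theorem branch_mem_holes (i : Digit) {d : ℝ × ℝ} (hd : d ∈ holes) : branch i d ∈ holes := by
  obtain ⟨l, rfl⟩ := hd
  exact ⟨i :: l, rfl⟩

theorem zero_mem_holes : 0 ∈ holes := ⟨[], rfl⟩

theorem countable_holes : holes.Countable := countable_range _

theorem exists_mem_holes_norm_sub_le (n : ℕ) {w : ℝ × ℝ} (hw : ‖w‖ ≤ 1) :
    ∃ d ∈ holes, ‖w - d‖ ≤ 2 * (1 / 2 : ℝ) ^ n := by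
  induction n generalizing w with
  | zero =>
    exact ⟨0, zero_mem_holes, by simpa using norm_sub_le_two hw (by simp : ‖(0 : ℝ × ℝ)‖ ≤ 1)⟩
  | succ n ih =>
    obtain ⟨i, z, hz, rfl⟩ := exists_branch hw
    obtain ⟨d, hd, h⟩ := ih hz
    refine ⟨branch i d, branch_mem_holes i hd, ?_⟩
    have := norm_branch_sub_le i hz (norm_lt_of_mem_holes hd).le
    rw [pow_succ]
    linarith

theorem exists_collapsed_norm_sub_le (n : ℕ) {w : ℝ × ℝ} (hw : ‖w‖ ≤ 1) :
    ∃ a, ‖w - collapsed a‖ ≤ 2 * (1 / 2 : ℝ) ^ n := by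
  induction n generalizing w with
  | zero =>
    exact ⟨fun _ => ⟨(0, 0), by simp⟩, by simpa using norm_sub_le_two hw (norm_collapsed_le _)⟩
  | succ n ih =>
    obtain ⟨i, z, hz, rfl⟩ := exists_branch hw
    obtain ⟨a, h⟩ := ih hz
    refine ⟨fun n => Nat.casesOn n i a, ?_⟩
    rw [collapsed_eq, pow_succ]
    have := norm_branch_sub_le i hz (norm_collapsed_le a)
    exact this.trans (by linarith)

theorem tendsto_two_mul_half_pow : Tendsto (fun n : ℕ => 2 * (1 / 2 : ℝ) ^ n) atTop (𝓝 0) := by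
  simpa using (tendsto_pow_atTop_nhds_zero_of_lt_one (r := (1 / 2 : ℝ)) (by norm_num)
    (by norm_num)).const_mul 2

theorem mem_closure_of_forall {s : Set (ℝ × ℝ)} {w : ℝ × ℝ}
    (h : ∀ n : ℕ, ∃ d ∈ s, ‖w - d‖ ≤ 2 * (1 / 2 : ℝ) ^ n) : w ∈ closure s := by
  rw [Metric.mem_closure_iff]
  intro ε hε
  obtain ⟨n, hn⟩ := (tendsto_two_mul_half_pow.eventually (gt_mem_nhds hε)).exists
  obtain ⟨d, hd, h⟩ := h n
  exact ⟨d, hd, by rw [dist_eq_norm]; linarith⟩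

theorem square_subset_closure_holes : square ⊆ closure holes := fun _ hw =>
  mem_closure_of_forall fun n => exists_mem_holes_norm_sub_le n (mem_square.1 hw)

theorem range_collapsed : range collapsed = square := by
  apply Subset.antisymm
  · rintro _ ⟨a, rfl⟩
    exact mem_square.2 (norm_collapsed_le a)
  · intro w hw
    have hcl : IsClosed (range collapsed) := (isCompact_range continuous_collapsed).isClosed
    rw [← hcl.closure_eq]
    refine mem_closure_of_forall fun n => ?_
    obtain ⟨a, ha⟩ := exists_collapsed_norm_sub_le n (mem_square.1 hw)
    exact ⟨_, ⟨a, rfl⟩, ha⟩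

theorem tile_collapsed_eq_address {a : ℕ → Digit} (h : ‖collapsed fun n => a (n + 1)‖ = 1) :
    tile (a 0) (collapsed fun n => a (n + 1)) = address a := by
  rw [collapsed_eq_address_of_norm_collapsed h, ← address_eq]

theorem address_eq_of_collapsed_eq {a a' : ℕ → Digit} (h : collapsed a = collapsed a')
    (hd : collapsed a ∉ holes) : address a = address a' := by
  refine eq_of_forall_norm_sub_le fun n => ?_
  induction n generalizing a a' with
  | zero => simpa using norm_sub_le_two (norm_address_le a) (norm_address_le a')
  | succ n ih =>
    have h0 : collapsed a ≠ 0 := fun h0 => hd (h0 ▸ zero_mem_holes)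
    have h1 := h
    rw [collapsed_eq a, collapsed_eq a'] at h1
    rw [collapsed_eq a, branch, Ne, collapse_eq_zero (le_norm_tile _ (norm_collapsed_le _))] at h0
    have h2 := eq_of_collapse_eq
      ((le_norm_tile _ (norm_collapsed_le _)).lt_of_ne (Ne.symm h0))
      (le_norm_tile _ (norm_collapsed_le _)) h1
    by_cases h3 : a 0 = a' 0
    · rw [h3] at h2
      have h4 := ih (tile_injective _ h2)
        (fun h5 => hd (by rw [collapsed_eq]; exact branch_mem_holes _ h5))
      rw [address_eq a, address_eq a', h3, pow_succ]
      have := norm_tile_sub (a' 0) (address fun n => a (n + 1)) (address fun n => a' (n + 1))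
      linarith
    · obtain ⟨h4, h5⟩ := norm_eq_one_of_tile_eq h3 (norm_collapsed_le _) (norm_collapsed_le _) h2
      rw [← tile_collapsed_eq_address h4, ← tile_collapsed_eq_address h5, h2, sub_self, norm_zero]
      positivity

theorem tile_collapsed_of_collapsed_eq_zero {a : ℕ → Digit} (h : collapsed a = 0) :
    tile (a 0) (collapsed fun n => a (n + 1)) = address a ∧ ‖address a‖ = 1 / 3 := by
  have h1 := le_norm_tile (a 0) (norm_collapsed_le fun n => a (n + 1))
  rw [collapsed_eq, branch, collapse_eq_zero h1] at h
  have h2 : ‖collapsed fun n => a (n + 1)‖ = 1 := by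
    refine (norm_collapsed_le _).antisymm (not_lt.1 fun hlt => ?_)
    exact (lt_norm_tile (a 0) hlt).ne' h
  rw [← tile_collapsed_eq_address h2]
  exact ⟨rfl, h⟩

/-- Direction functions for the collapsed carpet, on the level of addresses. -/
theorem exists_collapsed_direction {d : ℝ × ℝ} (hd : d ∈ holes) :
    ∃ δ : (ℕ → Digit) → ℝ × ℝ, Continuous δ ∧ (∀ a, ‖δ a‖ = 1) ∧
      (∀ a, collapsed a ≠ d → δ a = dir (collapsed a - d)) ∧
      ∀ a a', collapsed a = d → collapsed a' = d → (δ a = δ a' ↔ address a = address a') := by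
  obtain ⟨l, rfl⟩ := hd
  beta_reduce
  have htail : Continuous fun (a : ℕ → Digit) (n : ℕ) => a (n + 1) := by fun_prop
  induction l with
  | nil =>
    have hge : ∀ a : ℕ → Digit, 1 / 3 ≤ ‖tile (a 0) (collapsed fun n => a (n + 1))‖ :=
      fun a => le_norm_tile _ (norm_collapsed_le _)
    have hne : ∀ a : ℕ → Digit, tile (a 0) (collapsed fun n => a (n + 1)) ≠ 0 := fun a h => by
      have := hge a
      rw [h, norm_zero] at this
      norm_num at this
    have hc : Continuous fun a : ℕ → Digit => tile (a 0) (collapsed fun n => a (n + 1)) := by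
      have h1 : Continuous fun q : Digit × (ℝ × ℝ) => tile q.1 q.2 := by
        rw [continuous_prod_of_discrete_left]
        intro i; simp only [tile]; fun_prop
      exact h1.comp (f := fun a : ℕ → Digit => (a 0, collapsed fun n => a (n + 1)))
        ((continuous_apply 0).prodMk (continuous_collapsed.comp htail))
    refine ⟨fun a => dir (tile (a 0) (collapsed fun n => a (n + 1))), ?_,
      fun a => norm_dir (hne a), fun a ha => ?_, fun a a' ha ha' => ?_⟩
    · exact continuous_iff_continuousAt.2 fun a =>
        ContinuousAt.comp (g := dir) (continuousAt_dir (hne a)) hc.continuousAt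
    · simp only [List.foldr_nil, sub_zero] at ha ⊢
      rw [collapsed_eq, branch, Ne, collapse_eq_zero (hge a)] at ha
      rw [collapsed_eq a, branch, dir_collapse ((hge a).lt_of_ne (Ne.symm ha))]
    · obtain ⟨h1, h2⟩ := tile_collapsed_of_collapsed_eq_zero ha
      obtain ⟨h1', h2'⟩ := tile_collapsed_of_collapsed_eq_zero ha'
      simp only [h1, h1']
      refine ⟨fun h => ?_, fun h => by rw [h]⟩
      rw [← norm_smul_dir (address a), ← norm_smul_dir (address a'), h, h2, h2']
  | cons i l ih =>
    obtain ⟨δ, hδc, hδn, hδe, hδi⟩ := ih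
    set d := l.foldr branch 0 with hdl
    have hdh : d ∈ holes := ⟨l, rfl⟩
    have hd1 := norm_lt_of_mem_holes hdh
    obtain ⟨A, hA, hder⟩ := branch_conicalDeriv i hd1
    have hbr : ∀ j (z : ℝ × ℝ), ‖z‖ ≤ 1 → branch j z = branch i d → j = i ∧ z = d := by
      intro j z hz h
      have h1 := eq_of_collapse_eq (lt_norm_tile i hd1) (le_norm_tile j hz) h.symm
      by_cases hji : j = i
      · subst hji
        exact ⟨rfl, (tile_injective _ h1).symm⟩
      · exact absurd (norm_eq_one_of_tile_eq (Ne.symm hji) hd1.le hz h1).1 hd1.ne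
    have hfold : (i :: l).foldr branch 0 = branch i d := rfl
    rw [hfold]
    let t : (ℕ → Digit) → (ℕ → Digit) := fun a n => a (n + 1)
    have hcoll : ∀ a : ℕ → Digit, a 0 = i → collapsed a = branch i (collapsed (t a)) :=
        fun a ha => by
      rw [collapsed_eq, ha]
    have hbc : ContinuousOn (branch i) square := by
      refine (LipschitzOnWith.of_dist_le_mul (K := (1 / 2 : NNReal))
        fun z hz w hw => ?_).continuousOn
      simpa [dist_eq_norm] using norm_branch_sub_le i (mem_square.1 hz) (mem_square.1 hw)
    have hinj : ∀ a, branch i (collapsed (t a)) = branch i d → collapsed (t a) = d :=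
      fun a h => (hbr i _ (norm_collapsed_le _) h).2
    set P := pushDirection (fun a => collapsed (t a)) (fun a => δ (t a)) (branch i) A d with hP
    have hPc : Continuous P := continuous_pushDirection (continuous_collapsed.comp htail)
      (hδc.comp htail) (fun a => hδn _) (fun a => hδe _) hA
      (hbc.comp_continuous (continuous_collapsed.comp htail)
        fun a => mem_square.2 (norm_collapsed_le _)) hinj hder
    have hPn := norm_pushDirection (fun a => hδn (t a)) hA hinj
    classical
    have hzero : Continuous fun a : ℕ → Digit => a 0 := continuous_apply 0
    have hclopen : IsClopen {a : ℕ → Digit | a 0 = i} :=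
      (isClopen_discrete {i}).preimage hzero
    refine ⟨fun a => if a 0 = i then P a else dir (collapsed a - branch i d), ?_, ?_, ?_, ?_⟩
    · refine continuous_if (fun a ha => ?_) hPc.continuousOn ?_
      · rw [hclopen.frontier_eq] at ha
        exact ha.elim
      · intro a ha
        have ha' : a 0 ≠ i := by
          have h1 : IsClosed {a : ℕ → Digit | ¬a 0 = i} := hclopen.compl.1
          rwa [h1.closure_eq] at ha
        refine ContinuousAt.continuousWithinAt (ContinuousAt.comp (g := dir) (continuousAt_dir ?_)
          (continuous_collapsed.continuousAt.sub continuousAt_const))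
        rw [sub_ne_zero, collapsed_eq]
        exact fun h => ha' (hbr _ _ (norm_collapsed_le _) h).1
    · intro a
      simp only
      split_ifs with ha
      · exact hPn a
      · refine norm_dir ?_
        rw [sub_ne_zero, collapsed_eq]
        exact fun h => ha (hbr _ _ (norm_collapsed_le _) h).1
    · intro a ha
      simp only
      split_ifs with h0
      · have h1 : collapsed (t a) ≠ d := fun h => ha (by rw [hcoll a h0, h])
        simp only [hP, pushDirection, h1, if_false, hcoll a h0]
      · rfl
    · intro a a' ha ha'
      rw [collapsed_eq] at ha ha'
      obtain ⟨h0, h1⟩ := hbr _ _ (norm_collapsed_le _) ha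
      obtain ⟨h0', h1'⟩ := hbr _ _ (norm_collapsed_le _) ha'
      have e1 : collapsed (t a) = d := h1
      have e1' : collapsed (t a') = d := h1'
      simp only [h0, h0', if_true, hP, pushDirection, e1, e1']
      rw [address_eq a, address_eq a', h0, h0', (tile_injective i).eq_iff, ← hδi _ _ h1 h1']
      refine ⟨fun h => hA.dir_injOn (hδn _) (hδn _) h, fun h => ?_⟩
      change δ (t a) = δ (t a') at h
      rw [h]

/-- The carpet point with a given address. -/
noncomputable def carpetPoint (a : ℕ → Digit) : sierpinskiCarpet :=
  ⟨(ternary fun n => (a n).1.1, ternary fun n => (a n).1.2),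
    fun n => (a n).1.1, fun n => (a n).1.2, fun n => (a n).2, rfl, rfl⟩

theorem continuous_carpetPoint : Continuous carpetPoint := by
  refine Continuous.subtype_mk (Continuous.prodMk ?_ ?_) _
  · exact continuous_ternary.comp (continuous_pi fun n =>
      (continuous_of_discreteTopology (f := fun i : Digit => i.1.1)).comp (continuous_apply n))
  · exact continuous_ternary.comp (continuous_pi fun n =>
      (continuous_of_discreteTopology (f := fun i : Digit => i.1.2)).comp (continuous_apply n))

theorem surjective_carpetPoint : Function.Surjective carpetPoint := by
  rintro ⟨⟨x, y⟩, a, b, hab, hx, hy⟩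
  exact ⟨fun n => ⟨(a n, b n), hab n⟩, Subtype.ext (Prod.ext hx.symm hy.symm)⟩

theorem carpetPoint_eq_iff {a a' : ℕ → Digit} :
    carpetPoint a = carpetPoint a' ↔ address a = address a' := by
  rw [Subtype.ext_iff]
  simp [carpetPoint, address]

instance compactSpace_sierpinskiCarpet : CompactSpace sierpinskiCarpet :=
  isCompact_univ_iff.1 (surjective_carpetPoint.range_eq ▸ isCompact_range continuous_carpetPoint)

theorem exists_descend {f : (ℕ → Digit) → ℝ × ℝ} (hf : Continuous f)
    (h : ∀ a a', address a = address a' → f a = f a') :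
    ∃ g : sierpinskiCarpet → ℝ × ℝ, Continuous g ∧ ∀ a, g (carpetPoint a) = f a := by
  have hq : IsQuotientMap carpetPoint :=
    (continuous_carpetPoint.isClosedMap).isQuotientMap continuous_carpetPoint surjective_carpetPoint
  have hg : ∀ a, f (Function.surjInv surjective_carpetPoint (carpetPoint a)) = f a := fun a =>
    h _ _ (carpetPoint_eq_iff.1 (Function.surjInv_eq surjective_carpetPoint _))
  refine ⟨fun s => f (Function.surjInv surjective_carpetPoint s), ?_, hg⟩
  rw [hq.continuous_iff]
  exact hf.congr fun a => (hg a).symm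

/-- The carpet is a blow-up of the square at a countable dense set. -/
theorem exists_isBlowup_carpet :
    ∃ (β : sierpinskiCarpet → ℝ × ℝ) (δ : ℝ × ℝ → sierpinskiCarpet → ℝ × ℝ),
      IsBlowup holes β δ := by
  obtain ⟨β, hβc, hβ⟩ := exists_descend continuous_collapsed fun _ _ => collapsed_congr
  have hδ : ∀ d ∈ holes, ∃ δ : sierpinskiCarpet → ℝ × ℝ, Continuous δ ∧ (∀ s, ‖δ s‖ = 1) ∧
      (∀ s, β s ≠ d → δ s = dir (β s - d)) ∧
      ∀ s s', β s = d → β s' = d → δ s = δ s' → s = s' := by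
    intro d hd
    obtain ⟨δ, hδc, hδn, hδe, hδi⟩ := exists_collapsed_direction hd
    obtain ⟨δ', hδ'c, hδ'⟩ := exists_descend hδc (fun a a' h => by
      have h1 := collapsed_congr h
      by_cases h2 : collapsed a = d
      · exact (hδi a a' h2 (h1 ▸ h2)).2 h
      · rw [hδe a h2, hδe a' (h1 ▸ h2), h1])
    refine ⟨δ', hδ'c, fun s => ?_, fun s => ?_, fun s s' => ?_⟩
    · obtain ⟨a, rfl⟩ := surjective_carpetPoint s
      rw [hδ', hδn]
    · obtain ⟨a, rfl⟩ := surjective_carpetPoint s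
      rw [hδ', hβ]
      exact hδe a
    · obtain ⟨a, rfl⟩ := surjective_carpetPoint s
      obtain ⟨a', rfl⟩ := surjective_carpetPoint s'
      rw [hδ', hβ, hδ', hβ, carpetPoint_eq_iff]
      exact fun h h' => (hδi a a' h h').1
  choose! δ hδc hδn hδe hδi using hδ
  refine ⟨β, δ, hβc, ?_, fun s s' h hs => ?_, hδc, hδn, hδe, hδi⟩
  · rw [← range_collapsed, ← surjective_carpetPoint.range_comp]
    exact congrArg range (funext hβ)
  · obtain ⟨a, rfl⟩ := surjective_carpetPoint s
    obtain ⟨a', rfl⟩ := surjective_carpetPoint s'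
    rw [hβ] at h hs
    rw [hβ] at h
    exact carpetPoint_eq_iff.2 (address_eq_of_collapsed_eq h hs)

/-! ### Homogeneity of countable dense subsets of the square -/

/-- A Lipschitz map with constant `K` vanishing off the open unit ball. -/
structure IsPerturbation (K : ℝ) (g : ℝ × ℝ → ℝ × ℝ) : Prop where
  lipschitz : ∀ x y, ‖g x - g y‖ ≤ K * ‖x - y‖
  eq_zero : ∀ x, 1 ≤ ‖x‖ → g x = 0

namespace IsPerturbation

variable {K K' : ℝ} {g g' : ℝ × ℝ → ℝ × ℝ}

theorem add (h : IsPerturbation K g) (h' : IsPerturbation K' g') :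
    IsPerturbation (K + K') (g + g') where
  lipschitz x y := by
    have : (g + g') x - (g + g') y = (g x - g y) + (g' x - g' y) := by
      simp only [Pi.add_apply]; abel
    rw [this, add_mul]
    exact (norm_add_le _ _).trans (add_le_add (h.lipschitz x y) (h'.lipschitz x y))
  eq_zero x hx := by simp [h.eq_zero x hx, h'.eq_zero x hx]

theorem mono (h : IsPerturbation K g) (hK : K ≤ K') : IsPerturbation K' g where
  lipschitz x y := (h.lipschitz x y).trans (by gcongr)
  eq_zero := h.eq_zero

theorem norm_le (h : IsPerturbation K g) {x : ℝ × ℝ} (hx : ‖x‖ ≤ 1) :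
    ‖g x‖ ≤ K * (1 - ‖x‖) := by
  obtain ⟨u, hu, hux⟩ : ∃ u : ℝ × ℝ, ‖u‖ = 1 ∧ ‖x‖ • u = x := by
    rcases eq_or_ne x 0 with rfl | h0
    · exact ⟨(1, 0), by simp [Prod.norm_def], by simp⟩
    · exact ⟨dir x, norm_dir h0, norm_smul_dir x⟩
  have h1 := h.lipschitz x u
  rw [h.eq_zero u hu.ge, sub_zero] at h1
  have h2 : ‖x - u‖ = 1 - ‖x‖ := by
    have : x - u = -((1 - ‖x‖) • u) := by rw [sub_smul, hux, one_smul]; abel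
    rw [this, norm_neg, norm_smul, hu, mul_one, Real.norm_eq_abs, abs_of_nonneg (by linarith)]
  rwa [h2] at h1

theorem norm_le_const (h : IsPerturbation K g) (hK : 0 ≤ K) (x : ℝ × ℝ) : ‖g x‖ ≤ K := by
  rcases le_total ‖x‖ 1 with hx | hx
  · refine (h.norm_le hx).trans ?_
    nlinarith [norm_nonneg x]
  · simpa [h.eq_zero x hx] using hK

theorem norm_add_lt (h : IsPerturbation K g) (hK : K < 1) {x : ℝ × ℝ} (hx : ‖x‖ < 1) :
    ‖x + g x‖ < 1 := by
  have := h.norm_le hx.le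
  refine (norm_add_le _ _).trans_lt ?_
  nlinarith

theorem eq_of_add_eq (h : IsPerturbation K g) (hK : K < 1) {x y : ℝ × ℝ}
    (hxy : x + g x = y + g y) : x = y := by
  have h1 : x - y = -(g x - g y) := by
    rw [neg_sub, sub_eq_sub_iff_add_eq_add, hxy, add_comm]
  have h2 := h.lipschitz x y
  rw [← norm_neg, ← h1] at h2
  have : ‖x - y‖ = 0 := le_antisymm (by nlinarith [norm_nonneg (x - y)]) (norm_nonneg _)
  exact sub_eq_zero.1 (norm_eq_zero.1 this)

theorem exists_add_eq (h : IsPerturbation K g) (hK0 : 0 ≤ K) (hK : K < 1) (y : ℝ × ℝ) :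
    ∃ x, x + g x = y := by
  have hc : ContractingWith ⟨K, hK0⟩ fun x => y - g x := by
    refine ⟨NNReal.coe_lt_coe.1 hK, LipschitzWith.of_dist_le_mul fun x x' => ?_⟩
    rw [dist_eq_norm, dist_eq_norm, sub_sub_sub_cancel_left, ← norm_neg, neg_sub]
    exact h.lipschitz x x'
  refine ⟨hc.fixedPoint, ?_⟩
  have := hc.fixedPoint_isFixedPt
  rw [Function.IsFixedPt] at this
  exact eq_sub_iff_add_eq.1 this.symm

theorem norm_lt_of_norm_add_lt (h : IsPerturbation K g) {x : ℝ × ℝ} (hx : ‖x + g x‖ < 1) :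
    ‖x‖ < 1 := by
  by_contra! h1
  rw [h.eq_zero x h1, add_zero] at hx
  exact h1.not_gt hx

theorem image_square (h : IsPerturbation K g) (hK0 : 0 ≤ K) (hK : K < 1) :
    (fun x => x + g x) '' square = square := by
  ext y
  simp only [mem_image, mem_square]
  constructor
  · rintro ⟨x, hx, rfl⟩
    rcases hx.lt_or_eq with hx | hx
    · exact (h.norm_add_lt hK hx).le
    · rw [h.eq_zero x hx.ge, add_zero, hx]
  · intro hy
    obtain ⟨x, rfl⟩ := h.exists_add_eq hK0 hK y
    refine ⟨x, ?_, rfl⟩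
    by_contra! hx
    rw [h.eq_zero x hx.le, add_zero] at hy
    exact hx.not_ge hy

end IsPerturbation

/-- Local perturbations with prescribed value at a point, uniformly near a given point. -/
theorem exists_bump_perturbation {P : Set (ℝ × ℝ)} (hP : P.Finite) {p : ℝ × ℝ} (hp : ‖p‖ < 1)
    (hpP : p ∉ P) {η : ℝ} (hη : 0 < η) :
    ∃ ρ > 0, ∀ d, ‖d - p‖ < ρ → ∀ v : ℝ × ℝ, ‖v‖ < ρ →
      ∃ u, IsPerturbation η u ∧ Differentiable ℝ u ∧ (∀ x ∈ P, u x = 0) ∧ u d = v := by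
  have hO : IsOpen (ball (0 : ℝ × ℝ) 1 \ P) := isOpen_ball.sdiff hP.isClosed
  obtain ⟨w, hws, hwd, hwr⟩ := hO.exists_contDiff_support_eq (n := 1)
  have hw0 : ∀ x, x ∉ ball (0 : ℝ × ℝ) 1 \ P → w x = 0 := fun x hx => by
    rwa [← hws, Function.notMem_support] at hx
  have hcs : HasCompactSupport w := by
    refine HasCompactSupport.of_support_subset_isCompact (isCompact_closedBall (0 : ℝ × ℝ) 1) ?_
    rw [hws]
    exact sdiff_subset.trans ball_subset_closedBall
  obtain ⟨C, hC⟩ := hwd.lipschitzWith_of_hasCompactSupport hcs (by simp)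
  have hwp : 0 < w p := by
    have h1 : w p ≠ 0 := by
      rw [← Function.mem_support, hws]
      exact ⟨by simpa using hp, hpP⟩
    exact (hwr ⟨p, rfl⟩).1.lt_of_ne' h1
  have hcont : ∀ᶠ d in 𝓝 p, w p / 2 < w d :=
    hwd.continuous.continuousAt.eventually (lt_mem_nhds (half_lt_self hwp))
  obtain ⟨ρ₁, hρ₁, hball⟩ := Metric.eventually_nhds_iff.1 hcont
  refine ⟨min ρ₁ (η * (w p / 2) / (C + 1)), lt_min hρ₁ (by positivity), fun d hd v hv => ?_⟩
  have hwd0 : w p / 2 < w d := hball (by rw [dist_eq_norm]; exact hd.trans_le (min_le_left _ _))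
  have hwd1 : 0 < w d := by linarith
  have hv' : ‖v‖ * C ≤ η * w d := by
    have h1 := (hv.trans_le (min_le_right _ _)).le
    rw [le_div_iff₀ (by positivity)] at h1
    have h2 : η * (w p / 2) ≤ η * w d := by gcongr
    nlinarith [norm_nonneg v, C.coe_nonneg]
  refine ⟨fun x => (w x / w d) • v, ⟨fun x y => ?_, fun x hx => ?_⟩, ?_, fun x hx => ?_, ?_⟩
  · have h1 := hC.dist_le_mul x y
    rw [dist_eq_norm, dist_eq_norm] at h1
    rw [← sub_smul, ← sub_div, norm_smul, norm_div, Real.norm_of_nonneg hwd1.le, div_mul_eq_mul_div,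
      div_le_iff₀ hwd1]
    calc ‖w x - w y‖ * ‖v‖ ≤ (C * ‖x - y‖) * ‖v‖ := by gcongr
      _ = ‖v‖ * C * ‖x - y‖ := by ring
      _ ≤ η * w d * ‖x - y‖ := by gcongr
      _ = _ := by ring
  · rw [hw0 x (fun h => (mem_ball_zero_iff.1 h.1).not_ge hx), zero_div, zero_smul]
  · have hdiff : Differentiable ℝ w := hwd.differentiable (by simp)
    fun_prop
  · simp only
    rw [hw0 x (fun h => h.2 hx), zero_div, zero_smul]
  · simp only
    rw [div_self hwd1.ne', one_smul]

/-- A finite stage of the back-and-forth construction. -/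
structure IsStage (D D' : Set (ℝ × ℝ)) (g : ℝ × ℝ → ℝ × ℝ) (P : Set (ℝ × ℝ)) : Prop where
  perturbation : ∃ K, 0 ≤ K ∧ K < 1 / 2 ∧ IsPerturbation K g
  differentiable : Differentiable ℝ g
  finite : P.Finite
  mem_domain : ∀ p ∈ P, p ∈ D
  mem_codomain : ∀ p ∈ P, p + g p ∈ D'

section BackAndForth

variable {D D' : Set (ℝ × ℝ)} {g : ℝ × ℝ → ℝ × ℝ} {P : Set (ℝ × ℝ)}

theorem IsStage.exists_insert (h : IsStage D D' g P) {η : ℝ} (hη : 0 < η) {p : ℝ × ℝ} (hp : ‖p‖ < 1)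
    (hpP : p ∉ P) {R : ℝ × ℝ → ℝ × ℝ → Prop}
    (hfind : ∀ r > 0, ∃ d ∈ D, ∃ e ∈ D', R d e ∧ ‖d - p‖ < r ∧ ‖e - (d + g d)‖ < r) :
    ∃ d u, R d (d + (g + u) d) ∧ IsPerturbation η u ∧ (∀ x ∈ P, u x = 0) ∧
      IsStage D D' (g + u) (insert d P) := by
  obtain ⟨K, hK0, hK, hg⟩ := h.perturbation
  obtain ⟨ρ, hρ, hbump⟩ := exists_bump_perturbation h.finite hp hpP
    (lt_min hη (by linarith : 0 < (1 / 2 - K) / 2))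
  obtain ⟨d, hd, e, he, hR, h1, h2⟩ := hfind ρ hρ
  obtain ⟨u, hu, hud, hu0, hue⟩ := hbump d h1 _ h2
  have hde : d + (g + u) d = e := by rw [Pi.add_apply, hue]; abel
  refine ⟨d, u, hde ▸ hR, hu.mono (min_le_left _ _), hu0,
    ⟨K + (1 / 2 - K) / 2, by linarith, by linarith, hg.add (hu.mono (min_le_right _ _))⟩,
    h.differentiable.add hud, h.finite.insert d, ?_, ?_⟩
  · rintro q (rfl | hq)
    · exact hd
    · exact h.mem_domain q hq
  · rintro q (rfl | hq)
    · exact hde ▸ he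
    · simpa [hu0 q hq] using h.mem_codomain q hq

theorem IsStage.forth (h : IsStage D D' g P) (hD : D ⊆ ball 0 1) (hD' : ball 0 1 ⊆ closure D')
    {η : ℝ} (hη : 0 < η) {d : ℝ × ℝ} (hd : d ∈ D) :
    ∃ u P', IsPerturbation η u ∧ (∀ x ∈ P, u x = 0) ∧ P ⊆ P' ∧ d ∈ P' ∧
      IsStage D D' (g + u) P' := by
  by_cases hdP : d ∈ P
  · exact ⟨0, P, ⟨fun x y => by simp; positivity, fun x _ => rfl⟩, fun x _ => rfl, Subset.rfl, hdP,
      by simpa using h⟩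
  obtain ⟨K, hK0, hK, hg⟩ := h.perturbation
  have hd1 : ‖d‖ < 1 := mem_ball_zero_iff.1 (hD hd)
  obtain ⟨d', u, rfl, hu, hu0, hs⟩ := h.exists_insert hη hd1 hdP (R := fun d' _ => d' = d) (by
    intro r hr
    obtain ⟨e, he, her⟩ := Metric.mem_closure_iff.1
      (hD' (mem_ball_zero_iff.2 (hg.norm_add_lt (by linarith) hd1))) r hr
    refine ⟨d, hd, e, he, rfl, by simpa using hr, ?_⟩
    rwa [← dist_eq_norm, dist_comm])
  exact ⟨u, insert d' P, hu, hu0, subset_insert _ _, mem_insert _ _, hs⟩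

theorem IsStage.back (h : IsStage D D' g P) (hD : ball 0 1 ⊆ closure D) (hD' : D' ⊆ ball 0 1)
    {η : ℝ} (hη : 0 < η) {e : ℝ × ℝ} (he : e ∈ D') :
    ∃ u P', IsPerturbation η u ∧ (∀ x ∈ P, u x = 0) ∧ P ⊆ P' ∧
      (∃ d ∈ P', d + (g + u) d = e) ∧ IsStage D D' (g + u) P' := by
  obtain ⟨K, hK0, hK, hg⟩ := h.perturbation
  obtain ⟨p, rfl⟩ := hg.exists_add_eq hK0 (by linarith) e
  by_cases hpP : p ∈ P
  · exact ⟨0, P, ⟨fun x y => by simp; positivity, fun x _ => rfl⟩, fun x _ => rfl, Subset.rfl,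
      ⟨p, hpP, by simp⟩, by simpa using h⟩
  have hp1 : ‖p‖ < 1 := hg.norm_lt_of_norm_add_lt (mem_ball_zero_iff.1 (hD' he))
  obtain ⟨d, u, hde, hu, hu0, hs⟩ := h.exists_insert hη hp1 hpP (R := fun _ e' => e' = p + g p) (by
    intro r hr
    obtain ⟨d, hd, hdr⟩ := Metric.mem_closure_iff.1 (hD (mem_ball_zero_iff.2 hp1)) (r / 2)
      (by linarith)
    rw [dist_eq_norm] at hdr
    refine ⟨d, hd, p + g p, he, rfl, by rw [norm_sub_rev]; linarith, ?_⟩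
    have h1 : p + g p - (d + g d) = (p - d) + (g p - g d) := by abel
    rw [h1]
    have h2 := hg.lipschitz p d
    refine (norm_add_le _ _).trans_lt ?_
    nlinarith [norm_nonneg (p - d)])
  exact ⟨u, insert d P, hu, hu0, subset_insert _ _, ⟨d, mem_insert _ _, hde⟩, hs⟩

theorem IsStage.next (h : IsStage D D' g P) (hD : D ⊆ ball 0 1) (hDc : ball 0 1 ⊆ closure D)
    (hD' : D' ⊆ ball 0 1) (hDc' : ball 0 1 ⊆ closure D') {η : ℝ} (hη : 0 < η) {d e : ℝ × ℝ}
    (hd : d ∈ D) (he : e ∈ D') :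
    ∃ g' P', IsPerturbation η (g' - g) ∧ (∀ x ∈ P, g' x = g x) ∧ P ⊆ P' ∧ d ∈ P' ∧
      (∃ d' ∈ P', d' + g' d' = e) ∧ IsStage D D' g' P' := by
  obtain ⟨u, Q, hu, hu0, hPQ, hdQ, hs⟩ := h.forth hD hDc' (half_pos hη) hd
  obtain ⟨v, Q', hv, hv0, hQQ, hde, hs'⟩ := hs.back hDc hD' (half_pos hη) he
  refine ⟨g + u + v, Q', ?_, fun x hx => ?_, hPQ.trans hQQ, hQQ hdQ, hde, hs'⟩
  · have := hu.add hv
    rw [add_halves] at this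
    convert this using 1
    abel
  · simp [hu0 x hx, hv0 x (hPQ hx)]

/-- Any two countable dense subsets of the open square are exchanged by a homeomorphism of the
square that is differentiable with invertible derivatives. -/
theorem exists_backAndForth (hDn : D.Countable) (hD : D ⊆ ball 0 1) (hDc : ball 0 1 ⊆ closure D)
    (hDn' : D'.Countable) (hD' : D' ⊆ ball 0 1) (hDc' : ball 0 1 ⊆ closure D') :
    ∃ Φ : ℝ × ℝ → ℝ × ℝ, Continuous Φ ∧ Function.Injective Φ ∧ Φ '' square = square ∧
      Φ '' D = D' ∧ ∀ d, ∃ A, IsConical A ∧ HasConicalDerivAt Φ A d := by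
  have hne : ∀ {C : Set (ℝ × ℝ)}, ball 0 1 ⊆ closure C → C.Nonempty := fun hC =>
    closure_nonempty_iff.1 ⟨0, hC (by simp)⟩
  obtain ⟨e, rfl⟩ := hDn.exists_eq_range (hne hDc)
  obtain ⟨e', rfl⟩ := hDn'.exists_eq_range (hne hDc')
  let S := {s : (ℝ × ℝ → ℝ × ℝ) × Set (ℝ × ℝ) // IsStage (range e) (range e') s.1 s.2}
  have hstep : ∀ (n : ℕ) (s : S), ∃ s' : S, IsPerturbation ((1 / 2 : ℝ) ^ n) (s'.1.1 - s.1.1) ∧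
      (∀ x ∈ s.1.2, s'.1.1 x = s.1.1 x) ∧ s.1.2 ⊆ s'.1.2 ∧ e n ∈ s'.1.2 ∧
      ∃ d' ∈ s'.1.2, d' + s'.1.1 d' = e' n := by
    intro n s
    obtain ⟨g', P', h1, h2, h3, h4, h5, h6⟩ := s.2.next hD hDc hD' hDc'
      (by positivity : (0 : ℝ) < (1 / 2) ^ n) (mem_range_self n) (mem_range_self n)
    exact ⟨⟨(g', P'), h6⟩, h1, h2, h3, h4, h5⟩
  choose nxt hn1 hn2 hn3 hn4 hn5 using hstep
  let s₀ : S := ⟨(0, ∅), ⟨0, le_rfl, by norm_num, fun x y => by simp, fun x _ => rfl⟩,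
    differentiable_const _, finite_empty, by simp, by simp⟩
  let s : ℕ → S := fun n => Nat.rec s₀ (fun n s => nxt n s) n
  have hs : ∀ n, s (n + 1) = nxt n (s n) := fun n => rfl
  let G : ℕ → ℝ × ℝ → ℝ × ℝ := fun n => (s n).1.1
  let P : ℕ → Set (ℝ × ℝ) := fun n => (s n).1.2
  have hG : ∀ n, IsStage (range e) (range e') (G n) (P n) := fun n => (s n).2
  have hinc : ∀ n, IsPerturbation ((1 / 2 : ℝ) ^ n) (G (n + 1) - G n) := fun n => hn1 n (s n)
  have hfix : ∀ n, ∀ x ∈ P n, ∀ k, G (n + k) x = G n x ∧ x ∈ P (n + k) := by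
    intro n x hx k
    induction k with
    | zero => exact ⟨rfl, hx⟩
    | succ k ih => exact ⟨(hn2 (n + k) (s (n + k)) x ih.2).trans ih.1, hn3 (n + k) _ ih.2⟩
  have hsum : Summable fun n : ℕ => (1 / 2 : ℝ) ^ n := summable_geometric_two
  have hsum' : ∀ x, Summable fun n => (G (n + 1) - G n) x := fun x =>
    hsum.of_norm_bounded fun n => (hinc n).norm_le_const (by positivity) x
  have hder := hasFDerivAt_tsum (𝕜 := ℝ) (f := fun n => G (n + 1) - G n)
    (f' := fun n x => fderiv ℝ (G (n + 1) - G n) x) hsum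
    (fun n x => (((hG (n + 1)).differentiable.sub (hG n).differentiable) x).hasFDerivAt)
    (fun n x => norm_fderiv_le_of_lipschitz ℝ (C := ⟨(1 / 2 : ℝ) ^ n, by positivity⟩)
      (LipschitzWith.of_dist_le_mul fun x y => by
        rw [dist_eq_norm, dist_eq_norm]
        exact (hinc n).lipschitz x y)) (hsum' 0)
  set g : ℝ × ℝ → ℝ × ℝ := fun y => ∑' n, (G (n + 1) - G n) y with hg
  have hlim : ∀ x, Tendsto (fun n => G n x) atTop (𝓝 (g x)) := fun x => by
    refine ((hsum' x).hasSum.tendsto_sum_nat).congr fun n => ?_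
    simp only [Pi.sub_apply]
    rw [Finset.sum_range_sub (fun n => G n x)]
    simp [G, s, s₀]
  have hgp : IsPerturbation (1 / 2) g := by
    refine ⟨fun x y => ?_, fun x hx => ?_⟩
    · refine le_of_tendsto ((hlim x).sub (hlim y)).norm (Eventually.of_forall fun n => ?_)
      obtain ⟨K, hK0, hK, h⟩ := (hG n).perturbation
      exact (h.mono hK.le).lipschitz x y
    · refine tendsto_nhds_unique (hlim x) (tendsto_const_nhds.congr fun n => ?_)
      obtain ⟨K, hK0, hK, h⟩ := (hG n).perturbation
      exact (h.eq_zero x hx).symm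
  have hgfix : ∀ n, ∀ x ∈ P n, g x = G n x := fun n x hx =>
    tendsto_nhds_unique (hlim x) (tendsto_atTop_of_eventually_const (i₀ := n) fun k hk => by
      obtain ⟨j, rfl⟩ := Nat.exists_eq_add_of_le hk
      exact (hfix n x hx j).1)
  have hgd : Differentiable ℝ g := fun x => (hder x).differentiableAt
  refine ⟨fun x => x + g x, continuous_id.add hgd.continuous,
    fun x y h => hgp.eq_of_add_eq (by norm_num) h, hgp.image_square (by norm_num) (by norm_num),
    ?_, fun d => ?_⟩
  · ext y
    constructor
    · rintro ⟨_, ⟨n, rfl⟩, rfl⟩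
      have h1 : e n ∈ P (n + 1) := hn4 n (s n)
      change e n + g (e n) ∈ _
      rw [hgfix (n + 1) _ h1]
      exact (hG (n + 1)).mem_codomain _ h1
    · rintro ⟨n, rfl⟩
      obtain ⟨d', h1, h2⟩ := hn5 n (s n)
      have h1' : d' ∈ P (n + 1) := h1
      refine ⟨d', (hG (n + 1)).mem_domain _ h1', ?_⟩
      change d' + g d' = _
      rw [hgfix (n + 1) _ h1']
      exact h2
  · have hd := (hgd d).hasFDerivAt
    have hb : ∀ v, ‖fderiv ℝ g d v‖ ≤ 1 / 2 * ‖v‖ := fun v => by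
      refine (ContinuousLinearMap.le_opNorm _ v).trans ?_
      gcongr
      have hK : (((1 / 2 : NNReal)) : ℝ) = 1 / 2 := by norm_num
      rw [← hK]
      refine norm_fderiv_le_of_lipschitz ℝ (LipschitzWith.of_dist_le_mul fun x y => ?_)
      simpa only [dist_eq_norm, hK] using hgp.lipschitz x y
    refine ⟨fun v => v + fderiv ℝ g d v, ⟨by fun_prop, fun c _ v => by simp, fun v w h => ?_⟩, ?_⟩
    · have h1 : v - w = -(fderiv ℝ g d (v - w)) := by
        rw [map_sub, neg_sub, sub_eq_sub_iff_add_eq_add]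
        rw [show v + _ = w + _ from h, add_comm]
      have h2 := hb (v - w)
      rw [← norm_neg, ← h1] at h2
      exact sub_eq_zero.1 (norm_le_zero_iff.1 (by linarith))
    · refine hd.isLittleO.congr_left fun w => ?_
      dsimp only
      generalize fderiv ℝ g d (w - d) = z
      abel

end BackAndForth

/-! ### Lifting homeomorphisms to the carpet -/

/-- Homeomorphisms of the square preserving a countable dense set and having conical derivatives
along it lift to the carpet. -/
theorem exists_carpet_lift {D : Set (ℝ × ℝ)} {F : ℝ × ℝ → ℝ × ℝ} (hDn : D.Countable)
    (hD : D ⊆ ball 0 1) (hDc : ball 0 1 ⊆ closure D) (hc : ContinuousOn F square)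
    (hi : InjOn F square) (him : F '' square = square) (hFD : F '' D = D)
    (hder : ∀ d ∈ D, ∃ A, IsConical A ∧ HasConicalDerivAt F A d) :
    ∃ (H : sierpinskiCarpet ≃ₜ sierpinskiCarpet) (β : sierpinskiCarpet → ℝ × ℝ), Continuous β ∧
      range β = square ∧ (∀ s s', β s = β s' → β s ∉ D → s = s') ∧ (∀ s, β (H s) = F (β s)) ∧
      Dense {s | β s ∉ D} := by
  obtain ⟨β₀, δ₀, h₀⟩ := exists_isBlowup_carpet
  have hholes : holes ⊆ ball 0 1 := fun x hx => mem_ball_zero_iff.2 (norm_lt_of_mem_holes hx)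
  obtain ⟨Φ, hΦ, hΦi, hΦim, hΦD, hΦd⟩ := exists_backAndForth countable_holes hholes
    (ball_subset_closedBall.trans square_subset_closure_holes) hDn hD hDc
  obtain ⟨δ, h⟩ := h₀.push (hholes.trans ball_subset_closedBall) hΦ.continuousOn hΦi.injOn hΦim
    fun d _ => hΦd d
  rw [hΦD] at h
  obtain ⟨δ', h'⟩ := h.push (hD.trans ball_subset_closedBall) hc hi him hder
  rw [hFD] at h'
  obtain ⟨H, hH⟩ := h.exists_homeomorph h' hD
  exact ⟨H, Φ ∘ β₀, h.continuous_blowdown, h.range_blowdown, h.eq_of_notMem, hH,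
    h.dense_notMem hD hDn⟩

/-! ### The boundary folding -/

/-- The tent function over `[1 - 2r, 1 - 2r/3]`. -/
noncomputable def tent (r y : ℝ) : ℝ := max 0 (2 / 3 * r - |y - (1 - 4 / 3 * r)|)

theorem tent_nonneg (r y : ℝ) : 0 ≤ tent r y := le_max_left _ _

theorem tent_le {r : ℝ} (hr : 0 ≤ r) (y : ℝ) : tent r y ≤ 2 / 3 * r :=
  max_le (by positivity) (by linarith [abs_nonneg (y - (1 - 4 / 3 * r))])

theorem tent_of_mem {r y : ℝ} (h : 1 - 2 * r ≤ y) (h' : y ≤ 1 - 2 / 3 * r) :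
    tent r y = 2 / 3 * r - |y - (1 - 4 / 3 * r)| :=
  max_eq_right (by rw [sub_nonneg, abs_le]; constructor <;> linarith)

theorem tent_of_le {r y : ℝ} (h : y ≤ 1 - 2 * r) : tent r y = 0 :=
  max_eq_left (by linarith [neg_le_abs (y - (1 - 4 / 3 * r))])

theorem tent_of_ge {r y : ℝ} (h : 1 - 2 / 3 * r ≤ y) : tent r y = 0 :=
  max_eq_left (by linarith [le_abs_self (y - (1 - 4 / 3 * r))])

theorem tent_div_three (r y : ℝ) : tent (1 / 3 * r) y = 1 / 3 * tent r (3 * y - 2) := by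
  unfold tent
  rw [mul_max_of_nonneg _ _ (by norm_num), mul_zero]
  have h1 : 3 * y - 2 - (1 - 4 / 3 * r) = 3 * (y - (1 - 4 / 3 * (1 / 3 * r))) := by ring
  rw [h1, abs_mul, abs_of_pos (by norm_num : (0 : ℝ) < 3)]
  congr 1
  ring

theorem continuous_tent (r : ℝ) : Continuous (tent r) := by
  unfold tent
  fun_prop

/-- The folding of a side of the square. -/
noncomputable def fold (y : ℝ) : ℝ × ℝ :=
  ∑' j : ℕ, tent ((1 / 3) ^ j) y • ((1 : ℝ), 1 - 4 / 3 * (1 / 3 : ℝ) ^ j)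

theorem third_pow_le_one (j : ℕ) : (1 / 3 : ℝ) ^ j ≤ 1 :=
  pow_le_one₀ (by norm_num) (by norm_num)

theorem norm_tent_smul_le (y : ℝ) (j : ℕ) :
    ‖tent ((1 / 3) ^ j) y • ((1 : ℝ), 1 - 4 / 3 * (1 / 3 : ℝ) ^ j)‖ ≤ (1 / 3 : ℝ) ^ j := by
  have h1 : ‖((1 : ℝ), 1 - 4 / 3 * (1 / 3 : ℝ) ^ j)‖ ≤ 1 := by
    rw [norm_le_iff_abs]
    have := third_pow_le_one j
    have : (0 : ℝ) < (1 / 3) ^ j := by positivity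
    constructor
    · simp
    · rw [abs_le]; constructor <;> linarith
  rw [norm_smul, Real.norm_of_nonneg (tent_nonneg _ _)]
  have h2 := tent_le (r := (1 / 3 : ℝ) ^ j) (by positivity) y
  have h3 := tent_nonneg ((1 / 3 : ℝ) ^ j) y
  have : (0 : ℝ) < (1 / 3) ^ j := by positivity
  nlinarith [norm_nonneg ((1 : ℝ), 1 - 4 / 3 * (1 / 3 : ℝ) ^ j)]

theorem summable_third_pow : Summable fun j : ℕ => (1 / 3 : ℝ) ^ j :=
  summable_geometric_of_lt_one (by norm_num) (by norm_num)

theorem continuous_fold : Continuous fold :=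
  continuous_tsum (fun _ => (continuous_tent _).smul continuous_const) summable_third_pow
    fun j y => norm_tent_smul_le y j

/-- The linear map relating consecutive tents of `fold`. -/
noncomputable def shear : (ℝ × ℝ) →L[ℝ] (ℝ × ℝ) :=
  ((1 / 3 : ℝ) • ContinuousLinearMap.fst ℝ ℝ ℝ).prod
    ((2 / 9 : ℝ) • ContinuousLinearMap.fst ℝ ℝ ℝ + (1 / 9 : ℝ) • ContinuousLinearMap.snd ℝ ℝ ℝ)

theorem shear_apply (v : ℝ × ℝ) : shear v = (1 / 3 * v.1, 2 / 9 * v.1 + 1 / 9 * v.2) := rfl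

theorem shear_injective : Function.Injective shear := by
  intro v w h
  simp only [shear_apply, Prod.mk.injEq] at h
  ext <;> linarith [h.1, h.2]

theorem fold_eq_add (y : ℝ) :
    fold y = tent 1 y • ((1 : ℝ), -1 / 3) + shear (fold (3 * y - 2)) := by
  have hs : ∀ y, Summable fun j : ℕ =>
      tent ((1 / 3) ^ j) y • ((1 : ℝ), 1 - 4 / 3 * (1 / 3 : ℝ) ^ j) :=
    fun y => summable_third_pow.of_norm_bounded (norm_tent_smul_le y)
  unfold fold
  rw [(hs y).tsum_eq_zero_add, shear.map_tsum (hs _)]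
  congr 1
  · norm_num
  · refine tsum_congr fun j => ?_
    rw [pow_succ', tent_div_three, shear_apply]
    ext
    · simp
    · simp
      ring

theorem fold_of_mem {j : ℕ} {y : ℝ} (h : 1 - 2 * (1 / 3) ^ j ≤ y)
    (h' : y ≤ 1 - 2 / 3 * (1 / 3) ^ j) :
    fold y = tent ((1 / 3) ^ j) y • ((1 : ℝ), 1 - 4 / 3 * (1 / 3 : ℝ) ^ j) := by
  refine tsum_eq_single j fun i hi => ?_
  have key : ∀ {k l : ℕ}, k < l → (1 / 3 : ℝ) ^ l ≤ 1 / 3 * (1 / 3) ^ k := fun {k l} hkl => by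
    rw [← pow_succ']
    exact pow_le_pow_of_le_one (by norm_num) (by norm_num) hkl
  rcases lt_or_gt_of_ne hi with hi | hi
  · rw [tent_of_ge (by linarith [key hi]), zero_smul]
  · rw [tent_of_le (by linarith [key hi]), zero_smul]

theorem fold_of_one_le {y : ℝ} (h : 1 ≤ y) : fold y = 0 := by
  unfold fold
  rw [tsum_congr fun j => ?_, tsum_zero]
  rw [tent_of_ge (by linarith [(by positivity : (0 : ℝ) < (1 / 3) ^ j)]), zero_smul]

theorem fold_of_le {y : ℝ} (h : y ≤ -1) : fold y = 0 := by
  unfold fold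
  rw [tsum_congr fun j => ?_, tsum_zero]
  rw [tent_of_le (by linarith [third_pow_le_one j]), zero_smul]

theorem fold_of_le_third {y : ℝ} (h : y ≤ 1 / 3) : fold y = tent 1 y • ((1 : ℝ), -1 / 3) := by
  rw [fold_eq_add, fold_of_le (by linarith), map_zero, add_zero]

theorem fold_of_third_le {y : ℝ} (h : 1 / 3 ≤ y) : fold y = shear (fold (3 * y - 2)) := by
  rw [fold_eq_add, tent_of_ge (by linarith), zero_smul, zero_add]

theorem exists_tent_mem {y : ℝ} (h : -1 ≤ y) (h' : y < 1) :
    ∃ j : ℕ, 1 - 2 * (1 / 3) ^ j ≤ y ∧ y < 1 - 2 / 3 * (1 / 3 : ℝ) ^ j := by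
  obtain ⟨j, h1, h2⟩ := exists_nat_pow_near_of_lt_one (x := (1 - y) / 2) (y := 1 / 3)
    (by linarith) (by linarith) (by norm_num) (by norm_num)
  rw [pow_succ] at h1
  exact ⟨j, by linarith, by linarith⟩

/-- Where `fold` is nonzero it is given by a single tent. -/
theorem exists_fold_eq {y : ℝ} (h : fold y ≠ 0) :
    ∃ j : ℕ, 1 - 2 * (1 / 3) ^ j < y ∧ y < 1 - 2 / 3 * (1 / 3 : ℝ) ^ j ∧
      0 < tent ((1 / 3) ^ j) y ∧
      fold y = tent ((1 / 3) ^ j) y • ((1 : ℝ), 1 - 4 / 3 * (1 / 3 : ℝ) ^ j) := by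
  obtain ⟨j, h1, h2⟩ := exists_tent_mem (y := y) (not_lt.1 fun hy => h (fold_of_le hy.le))
    (not_le.1 fun hy => h (fold_of_one_le hy))
  have h3 := fold_of_mem h1 h2.le
  have h4 : tent ((1 / 3) ^ j) y ≠ 0 := fun h0 => h (by rw [h3, h0, zero_smul])
  exact ⟨j, h1.lt_of_ne fun h5 => h4 (tent_of_le h5.ge), h2, (tent_nonneg _ _).lt_of_ne' h4, h3⟩

theorem fold_fst_nonneg (y : ℝ) : 0 ≤ (fold y).1 := by
  by_cases h : fold y = 0
  · simp [h]
  obtain ⟨j, h1, h2, h3, h4⟩ := exists_fold_eq h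
  simpa [h4] using h3.le

theorem fold_fst_le (y : ℝ) : (fold y).1 ≤ 2 / 3 := by
  by_cases h : fold y = 0
  · rw [h, Prod.fst_zero]
    norm_num
  obtain ⟨j, h1, h2, h3, h4⟩ := exists_fold_eq h
  have := tent_le (r := (1 / 3 : ℝ) ^ j) (by positivity) y
  have := third_pow_le_one j
  simp only [h4, Prod.smul_mk, smul_eq_mul, mul_one]
  linarith

theorem fold_snd_lt {y : ℝ} (h : fold y ≠ 0) : |(fold y).2| < (fold y).1 := by
  obtain ⟨j, h1, h2, h3, h4⟩ := exists_fold_eq h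
  have := third_pow_le_one j
  have : (0 : ℝ) < (1 / 3) ^ j := by positivity
  simp only [h4, Prod.smul_mk, smul_eq_mul, mul_one]
  rw [abs_lt]
  constructor <;> nlinarith

theorem abs_fold_snd_le (y : ℝ) : |(fold y).2| ≤ (fold y).1 := by
  by_cases h : fold y = 0
  · simp [h]
  exact (fold_snd_lt h).le

/-- The folding of a side preserves the sectors spanned by the tents. -/
theorem fold_snd_ge {k : ℕ} {y : ℝ} (h : 1 - 2 * (1 / 3) ^ k ≤ y) :
    (1 - 2 * (1 / 3) ^ k) * (fold y).1 ≤ (fold y).2 := by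
  by_cases h0 : fold y = 0
  · simp [h0]
  obtain ⟨j, h1, h2, h3, h4⟩ := exists_fold_eq h0
  have hr : (0 : ℝ) < (1 / 3) ^ j := by positivity
  have hkj : (1 / 3 : ℝ) ^ j ≤ (1 / 3) ^ k := by
    refine pow_le_pow_of_le_one (by norm_num) (by norm_num) ?_
    by_contra! hjk
    have := pow_le_pow_of_le_one (by norm_num : (0 : ℝ) ≤ 1 / 3) (by norm_num)
      (Nat.succ_le_of_lt hjk)
    rw [Nat.succ_eq_add_one, pow_succ] at this
    linarith
  simp only [h4, Prod.smul_mk, smul_eq_mul, mul_one]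
  rw [mul_comm]
  gcongr
  linarith

theorem fold_snd_le {k : ℕ} {y : ℝ} (h : y ≤ 1 - 2 * (1 / 3) ^ k) :
    (fold y).2 ≤ (1 - 2 * (1 / 3) ^ k) * (fold y).1 := by
  by_cases h0 : fold y = 0
  · simp [h0]
  obtain ⟨j, h1, h2, h3, h4⟩ := exists_fold_eq h0
  have hr : (0 : ℝ) < (1 / 3) ^ j := by positivity
  have hkj : (1 / 3 : ℝ) ^ k ≤ (1 / 3) ^ j * (1 / 3) := by
    rw [← pow_succ]
    refine pow_le_pow_of_le_one (by norm_num) (by norm_num) (Nat.succ_le_of_lt ?_)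
    by_contra! hjk
    have := pow_le_pow_of_le_one (by norm_num : (0 : ℝ) ≤ 1 / 3) (by norm_num) hjk
    linarith
  simp only [h4, Prod.smul_mk, smul_eq_mul, mul_one]
  rw [mul_comm]
  exact mul_le_mul_of_nonneg_right (by linarith) h3.le

/-! ### The folding of the sector over a side -/

/-- The image of the point at height `s` over the point `(1, y)` of the right side. -/
noncomputable def sector (y s : ℝ) : ℝ × ℝ := s • ((1 : ℝ), y) + (1 - s) • fold y

theorem sector_fst (y s : ℝ) : (sector y s).1 = s + (1 - s) * (fold y).1 := by simp [sector]

theorem sector_snd (y s : ℝ) : (sector y s).2 = s * y + (1 - s) * (fold y).2 := by simp [sector]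

theorem sector_zero (y : ℝ) : sector y 0 = fold y := by simp [sector]

theorem abs_sector_snd_le {y s : ℝ} (hy : |y| ≤ 1) (hs : 0 ≤ s) (hs1 : s ≤ 1) :
    |(sector y s).2| ≤ (sector y s).1 := by
  rw [sector_fst, sector_snd]
  have h1 := abs_fold_snd_le y
  rw [abs_le] at *
  constructor <;> nlinarith

theorem sector_zero_ne {y y' s' : ℝ} (hs' : 0 < s') (hs1' : s' ≤ 1) :
    sector y 0 ≠ sector y' s' := by
  rw [sector_zero]
  intro h
  have hp : (fold y).1 = s' + (1 - s') * (fold y').1 := by rw [h, sector_fst]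
  have hq : (fold y).2 = s' * y' + (1 - s') * (fold y').2 := by rw [h, sector_snd]
  have h0 : fold y ≠ 0 := fun h0 => by
    rw [h0, Prod.fst_zero] at hp
    nlinarith [fold_fst_nonneg y']
  obtain ⟨j, h1, h2, h3, h4⟩ := exists_fold_eq h0
  have hr : (0 : ℝ) < (1 / 3) ^ j := by positivity
  have hr1 := third_pow_le_one j
  have hle := tent_le (r := (1 / 3 : ℝ) ^ j) hr.le y
  simp only [h4, Prod.smul_mk, smul_eq_mul, mul_one] at hp hq
  have hpow : (1 / 3 : ℝ) ^ (j + 1) = 1 / 3 * (1 / 3) ^ j := pow_succ' _ _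
  have hy1 : 1 - 2 * (1 / 3) ^ j < y' := by
    by_contra! hy
    have := fold_snd_le hy
    nlinarith [mul_pos h3 hr]
  have hy2 : y' < 1 - 2 * (1 / 3) ^ (j + 1) := by
    by_contra! hy
    have := fold_snd_ge hy
    rw [hpow] at this hy
    nlinarith [mul_pos h3 hr]
  rw [hpow] at hy2
  have h5 := fold_of_mem hy1.le (by linarith : y' ≤ 1 - 2 / 3 * (1 / 3) ^ j)
  simp only [h5, Prod.smul_mk, smul_eq_mul, mul_one] at hp hq
  have hc : y' - (1 - 4 / 3 * (1 / 3) ^ j) = 0 := by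
    have : s' * (y' - (1 - 4 / 3 * (1 / 3) ^ j)) = 0 := by
      rw [hp] at hq; linarith
    exact (mul_eq_zero.1 this).resolve_left hs'.ne'
  rw [tent_of_mem hy1.le (by linarith : y' ≤ 1 - 2 / 3 * (1 / 3) ^ j), hc, abs_zero, sub_zero] at hp
  nlinarith

theorem eq_of_height_eq {s s' v v' l : ℝ} (hs : 0 < s) (hs' : 0 < s') (hl : l < 1)
    (h : s * v = s' * v') (h' : s + (1 - s) * (l - |v|) = s' + (1 - s') * (l - |v'|)) : s = s' := by
  have habs : s * |v| = s' * |v'| := by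
    rw [← abs_of_pos hs, ← abs_of_pos hs', ← abs_mul, ← abs_mul, h]
  have key : (s - s') * (1 - l) = |v| - |v'| := by linear_combination h' - habs
  rcases lt_trichotomy s s' with hlt | heq | hlt
  · have h1 : |v'| ≤ |v| := by
      by_contra! hc
      nlinarith [abs_nonneg v]
    nlinarith
  · exact heq
  · have h1 : |v| ≤ |v'| := by
      by_contra! hc
      nlinarith [abs_nonneg v']
    nlinarith

/-- The sector map is injective away from the folded side. -/
theorem sector_eq_iff {y y' s s' : ℝ} (hy : |y| ≤ 1) (hy' : |y'| ≤ 1) (hs : 0 < s) (hs1 : s ≤ 1)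
    (hs' : 0 < s') (hs1' : s' ≤ 1) (h : sector y s = sector y' s') : y = y' ∧ s = s' := by
  have hp : s + (1 - s) * (fold y).1 = s' + (1 - s') * (fold y').1 := by
    rw [← sector_fst, h, sector_fst]
  have hq : s * y + (1 - s) * (fold y).2 = s' * y' + (1 - s') * (fold y').2 := by
    rw [← sector_snd, h, sector_snd]
  rw [abs_le] at hy hy'
  have hf := abs_le.1 (abs_fold_snd_le y)
  have hf' := abs_le.1 (abs_fold_snd_le y')
  rcases hy.2.eq_or_lt with rfl | hy1
  · have h1 : y' = 1 := by
      rw [fold_of_one_le le_rfl] at hp hq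
      simp only [Prod.fst_zero, Prod.snd_zero, mul_zero, add_zero, mul_one] at hp hq
      have : 0 ≤ (1 - s') * ((fold y').1 - (fold y').2) := mul_nonneg (by linarith) (by linarith)
      have : s' * (1 - y') ≤ 0 := by nlinarith
      nlinarith
    subst h1
    rw [fold_of_one_le le_rfl] at hp
    simpa using hp
  obtain ⟨j, h1, h2⟩ := exists_tent_mem hy.1 hy1
  have hr : (0 : ℝ) < (1 / 3) ^ j := by positivity
  have hr1 := third_pow_le_one j
  have hpow : (1 / 3 : ℝ) ^ (j + 1) = 1 / 3 * (1 / 3) ^ j := pow_succ' _ _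
  have h1' : 1 - 2 * (1 / 3) ^ j ≤ y' := by
    by_contra! hlt
    have e1 := mul_le_mul_of_nonneg_left (fold_snd_le hlt.le) (by linarith : 0 ≤ 1 - s')
    have e2 := mul_le_mul_of_nonneg_left (fold_snd_ge h1) (by linarith : 0 ≤ 1 - s)
    nlinarith
  have h2' : y' ≤ 1 - 2 * (1 / 3) ^ (j + 1) := by
    by_contra! hlt
    have e1 := mul_le_mul_of_nonneg_left (fold_snd_ge hlt.le) (by linarith : 0 ≤ 1 - s')
    have e2 := mul_le_mul_of_nonneg_left
      (fold_snd_le (by rw [hpow]; linarith : y ≤ 1 - 2 * (1 / 3) ^ (j + 1)))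
      (by linarith : 0 ≤ 1 - s)
    rw [hpow] at *
    nlinarith
  rw [hpow] at h2'
  have h2'' : y' ≤ 1 - 2 / 3 * (1 / 3) ^ j := by linarith
  rw [fold_of_mem h1 h2.le, fold_of_mem h1' h2'', tent_of_mem h1 h2.le,
    tent_of_mem h1' h2''] at hp hq
  simp only [Prod.smul_mk, smul_eq_mul, mul_one] at hp hq
  set v := y - (1 - 4 / 3 * (1 / 3 : ℝ) ^ j) with hv
  set v' := y' - (1 - 4 / 3 * (1 / 3 : ℝ) ^ j) with hv'
  have hsv : s * v = s' * v' := by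
    rw [hv, hv']; linear_combination hq - (1 - 4 / 3 * (1 / 3 : ℝ) ^ j) * hp
  have hss : s = s' := eq_of_height_eq hs hs' (by linarith) hsv hp
  subst hss
  have := mul_left_cancel₀ hs.ne' hsv
  exact ⟨by rw [hv, hv'] at this; linarith, rfl⟩

/-- The sector map is onto. -/
theorem exists_sector_eq {X Y : ℝ} (hX : X ≤ 1) (hY : |Y| ≤ X) :
    ∃ y s, |y| ≤ 1 ∧ 0 ≤ s ∧ s ≤ 1 ∧ sector y s = (X, Y) := by
  have hX0 : 0 ≤ X := (abs_nonneg _).trans hY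
  rw [abs_le] at hY
  rcases hY.2.eq_or_lt with rfl | hYX
  · exact ⟨1, Y, by simp, hX0, hX, by ext <;> simp [sector_fst, sector_snd, fold_of_one_le]⟩
  have hXp : 0 < X := by linarith
  obtain ⟨j, h1, h2⟩ := exists_tent_mem (y := Y / X) (by rw [le_div_iff₀ hXp]; linarith)
    (by rwa [div_lt_one hXp])
  rw [le_div_iff₀ hXp] at h1
  rw [div_lt_iff₀ hXp] at h2
  have hr : (0 : ℝ) < (1 / 3) ^ j := by positivity
  have hr1 := third_pow_le_one j
  set r : ℝ := (1 / 3) ^ j with hrdef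
  set A : ℝ := (Y - (1 - 4 / 3 * r) * X) / (2 / 3 * r) with hA
  have hAY : Y = (1 - 4 / 3 * r) * X + 2 / 3 * r * A := by rw [hA]; field_simp; ring
  have hAX : |A| ≤ X := by
    rw [abs_le]
    constructor <;> by_contra! hc <;> nlinarith
  suffices h : ∃ u s, |u| ≤ 1 ∧ 0 ≤ s ∧ s ≤ 1 ∧ u * s = A ∧
      s + (1 - s) * (2 / 3 * r * (1 - |u|)) = X by
    obtain ⟨u, s, hu, hs, hs1, hus, huX⟩ := h
    rw [abs_le] at hu
    have hm1 : 1 - 2 * r ≤ 1 - 4 / 3 * r + 2 / 3 * r * u := by nlinarith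
    have hm2 : 1 - 4 / 3 * r + 2 / 3 * r * u ≤ 1 - 2 / 3 * r := by nlinarith
    have hfold : fold (1 - 4 / 3 * r + 2 / 3 * r * u) =
        (2 / 3 * r * (1 - |u|)) • ((1 : ℝ), 1 - 4 / 3 * r) := by
      rw [fold_of_mem hm1 hm2, tent_of_mem hm1 hm2]
      congr 1
      rw [add_sub_cancel_left, abs_mul, abs_of_pos (by positivity)]
      ring
    refine ⟨1 - 4 / 3 * r + 2 / 3 * r * u, s, ?_, hs, hs1, ?_⟩
    · rw [abs_le]; constructor <;> linarith
    · ext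
      · rw [sector_fst, hfold]
        simpa using huX
      · rw [sector_snd, hfold, hAY, ← hus, ← huX]
        simp only [Prod.smul_mk, smul_eq_mul]
        ring
  by_cases hA0 : A = 0
  · rcases le_total X (2 / 3 * r) with hc | hc
    · refine ⟨1 - X / (2 / 3 * r), 0, ?_, le_rfl, by norm_num, by rw [hA0, mul_zero], ?_⟩
      · have : X / (2 / 3 * r) ≤ 1 := (div_le_one (by positivity)).2 hc
        have : 0 ≤ X / (2 / 3 * r) := by positivity
        rw [abs_le]; constructor <;> linarith
      · have : X / (2 / 3 * r) ≤ 1 := (div_le_one (by positivity)).2 hc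
        rw [abs_of_nonneg (by linarith)]
        field_simp
        ring
    · refine ⟨0, (X - 2 / 3 * r) / (1 - 2 / 3 * r), by simp, div_nonneg (by linarith) (by linarith),
        (div_le_one (by linarith)).2 (by linarith), by rw [hA0, zero_mul], ?_⟩
      have h3 := div_mul_cancel₀ (X - 2 / 3 * r) (by linarith : 1 - 2 / 3 * r ≠ 0)
      rw [abs_zero]
      linear_combination h3
  · have hA1 : |A| ≤ 1 := hAX.trans hX
    have hf : ContinuousOn (fun s : ℝ => s ^ 2 + 2 / 3 * r * ((1 - s) * (s - |A|)) - X * s)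
        (Icc |A| 1) := by fun_prop
    obtain ⟨s, hs, hs0⟩ := intermediate_value_Icc hA1 hf
      (show (0 : ℝ) ∈ Icc _ _ from
        ⟨by simp only [sub_self, mul_zero, add_zero]; nlinarith [abs_nonneg A],
        by simp only [sub_self, zero_mul, mul_zero]; linarith⟩)
    have hsp : 0 < s := (abs_pos.2 hA0).trans_le hs.1
    refine ⟨A / s, s, ?_, hsp.le, hs.2, div_mul_cancel₀ _ hsp.ne', ?_⟩
    · rw [abs_div, abs_of_pos hsp]
      exact (div_le_one hsp).2 hs.1
    · rw [abs_div, abs_of_pos hsp]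
      field_simp
      simp only at hs0
      linarith

/-! ### Symmetries of the square -/

/-- The exchange of coordinates. -/
noncomputable def flip : (ℝ × ℝ) →L[ℝ] (ℝ × ℝ) :=
  (ContinuousLinearMap.snd ℝ ℝ ℝ).prod (ContinuousLinearMap.fst ℝ ℝ ℝ)

@[simp] theorem flip_apply (p : ℝ × ℝ) : flip p = (p.2, p.1) := rfl

/-- The group of symmetries generated by the exchange of coordinates and the central symmetry. -/
noncomputable def sym : Bool × Bool → (ℝ × ℝ) →L[ℝ] (ℝ × ℝ)
  | (false, false) => ContinuousLinearMap.id ℝ (ℝ × ℝ)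
  | (true, false) => -ContinuousLinearMap.id ℝ (ℝ × ℝ)
  | (false, true) => flip
  | (true, true) => -flip

theorem sym_ff (p : ℝ × ℝ) : sym (false, false) p = p := rfl
theorem sym_tf (p : ℝ × ℝ) : sym (true, false) p = -p := rfl
theorem sym_ft (p : ℝ × ℝ) : sym (false, true) p = (p.2, p.1) := rfl
theorem sym_tt (p : ℝ × ℝ) : sym (true, true) p = -(p.2, p.1) := rfl

@[simp] theorem sym_sym (g : Bool × Bool) (p : ℝ × ℝ) : sym g (sym g p) = p := by
  rcases g with ⟨_ | _, _ | _⟩ <;> simp [sym_ff, sym_tf, sym_ft, sym_tt]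

theorem exists_sym_sym (g h : Bool × Bool) : ∃ k, ∀ p, sym g (sym h p) = sym k p := by
  refine ⟨(g.1 ^^ h.1, g.2 ^^ h.2), fun ⟨x, y⟩ => ?_⟩
  rcases g with ⟨_ | _, _ | _⟩ <;> rcases h with ⟨_ | _, _ | _⟩ <;>
    simp [sym_ff, sym_tf, sym_ft, sym_tt]

@[simp] theorem norm_sym (g : Bool × Bool) (p : ℝ × ℝ) : ‖sym g p‖ = ‖p‖ := by
  rcases g with ⟨_ | _, _ | _⟩ <;>
    simp [sym_ff, sym_tf, sym_ft, sym_tt, Prod.norm_def, max_comm]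

theorem exists_sym_eq (v : ℝ × ℝ) : ∃ g Y, |Y| ≤ ‖v‖ ∧ v = sym g (‖v‖, Y) := by
  obtain ⟨x, y⟩ := v
  rcases le_total |y| |x| with h | h
  · have hn : ‖(x, y)‖ = |x| := by simpa [Prod.norm_def] using h
    rw [hn]
    rcases le_total 0 x with h0 | h0
    · exact ⟨(false, false), y, h, by rw [abs_of_nonneg h0, sym_ff]⟩
    · exact ⟨(true, false), -y, by rwa [abs_neg], by rw [abs_of_nonpos h0, sym_tf]; simp⟩
  · have hn : ‖(x, y)‖ = |y| := by simpa [Prod.norm_def] using h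
    rw [hn]
    rcases le_total 0 y with h0 | h0
    · exact ⟨(false, true), x, h, by rw [abs_of_nonneg h0, sym_ft]⟩
    · exact ⟨(true, true), -x, by rwa [abs_neg], by rw [abs_of_nonpos h0, sym_tt]; simp⟩

theorem norm_one_mk {y : ℝ} (hy : |y| ≤ 1) : ‖((1 : ℝ), y)‖ = 1 := by
  simpa [Prod.norm_def] using hy

theorem exists_side {b : ℝ × ℝ} (hb : ‖b‖ = 1) : ∃ g y, |y| ≤ 1 ∧ b = sym g (1, y) := by
  obtain ⟨g, y, h1, h2⟩ := exists_sym_eq b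
  rw [hb] at h1 h2
  exact ⟨g, y, h1, h2⟩

/-! ### The folding of the boundary of the square -/

/-- The folding of the right side, extended by zero to the other sides. -/
noncomputable def sideFold (p : ℝ × ℝ) : ℝ × ℝ := max p.1 0 • fold (p.2 * (2 - p.1))

/-- The folding of the boundary of the square onto a countable star. -/
noncomputable def boundaryFold (p : ℝ × ℝ) : ℝ × ℝ :=
  sideFold p - sideFold (-p) + (flip (sideFold (flip p)) - flip (sideFold (-flip p)))

theorem continuous_boundaryFold : Continuous boundaryFold := by
  have : Continuous sideFold := by
    unfold sideFold
    have := continuous_fold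
    fun_prop
  unfold boundaryFold
  fun_prop

theorem boundaryFold_sym (g : Bool × Bool) (p : ℝ × ℝ) :
    boundaryFold (sym g p) = sym g (boundaryFold p) := by
  obtain ⟨x, y⟩ := p
  rcases g with ⟨_ | _, _ | _⟩ <;> ext <;>
    simp [sym_ff, sym_tf, sym_ft, sym_tt, boundaryFold] <;> ring

theorem boundaryFold_right {y : ℝ} (hy : |y| ≤ 1) : boundaryFold (1, y) = fold y := by
  rw [abs_le] at hy
  have h1 : sideFold (1, y) = fold y := by
    simp only [sideFold, max_eq_left zero_le_one, one_smul]
    norm_num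
  have h2 : sideFold (-(1, y)) = 0 := by
    simp [sideFold]
  have h3 : sideFold (flip (1, y)) = 0 := by
    simp only [sideFold, flip_apply]
    rw [fold_of_one_le (by linarith), smul_zero]
  have h4 : sideFold (-flip (1, y)) = 0 := by
    simp only [sideFold, flip_apply, Prod.fst_neg, Prod.snd_neg]
    rw [fold_of_le (by linarith), smul_zero]
  rw [boundaryFold, h1, h2, h3, h4]
  simp

/-- The quotient map from the closed annulus, in polar coordinates, to the square. -/
noncomputable def polarFold (b : ℝ × ℝ) (t : ℝ) : ℝ × ℝ := (1 - t) • b + t • boundaryFold b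

theorem continuous_polarFold : Continuous fun z : (ℝ × ℝ) × ℝ => polarFold z.1 z.2 := by
  have := continuous_boundaryFold
  unfold polarFold
  fun_prop

theorem polarFold_sym (g : Bool × Bool) (b : ℝ × ℝ) (t : ℝ) :
    polarFold (sym g b) t = sym g (polarFold b t) := by
  simp [polarFold, boundaryFold_sym]

theorem polarFold_right {y : ℝ} (hy : |y| ≤ 1) (t : ℝ) :
    polarFold (1, y) t = sector y (1 - t) := by
  rw [polarFold, boundaryFold_right hy, sector, sub_sub_cancel]

theorem polarFold_zero (b : ℝ × ℝ) : polarFold b 0 = b := by simp [polarFold]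

theorem polarFold_one (b : ℝ × ℝ) : polarFold b 1 = boundaryFold b := by simp [polarFold]

theorem norm_boundaryFold_le {b : ℝ × ℝ} (hb : ‖b‖ = 1) : ‖boundaryFold b‖ ≤ 2 / 3 := by
  obtain ⟨g, y, hy, rfl⟩ := exists_side hb
  rw [boundaryFold_sym, norm_sym, boundaryFold_right hy, norm_le_iff_abs,
    abs_of_nonneg (fold_fst_nonneg y)]
  exact ⟨fold_fst_le y, (abs_fold_snd_le y).trans (fold_fst_le y)⟩

theorem norm_polarFold_le {b : ℝ × ℝ} {t : ℝ} (hb : ‖b‖ = 1) (ht : 0 ≤ t) (ht1 : t ≤ 1) :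
    ‖polarFold b t‖ ≤ 1 - t / 3 := by
  refine (norm_add_le _ _).trans ?_
  rw [norm_smul, norm_smul, hb, Real.norm_of_nonneg ht, Real.norm_of_nonneg (by linarith)]
  nlinarith [norm_boundaryFold_le hb]

theorem norm_polarFold_sub_le {b : ℝ × ℝ} {t : ℝ} (hb : ‖b‖ = 1) (ht : 0 ≤ t) :
    ‖polarFold b t - b‖ ≤ 2 * t := by
  have : polarFold b t - b = t • (boundaryFold b - b) := by
    rw [polarFold, sub_smul, smul_sub, one_smul]; abel
  rw [this, norm_smul, Real.norm_of_nonneg ht, mul_comm]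
  have := norm_sub_le (boundaryFold b) b
  have := norm_boundaryFold_le hb
  gcongr
  linarith

theorem exists_polarFold_eq {w : ℝ × ℝ} (hw : ‖w‖ ≤ 1) :
    ∃ b t, ‖b‖ = 1 ∧ 0 ≤ t ∧ t ≤ 1 ∧ polarFold b t = w := by
  obtain ⟨g, Y, hY, h⟩ := exists_sym_eq w
  obtain ⟨y, s, hy, hs, hs1, hq⟩ := exists_sector_eq hw hY
  refine ⟨sym g (1, y), 1 - s, ?_, by linarith, by linarith, ?_⟩
  · rw [norm_sym, norm_one_mk hy]
  · rw [polarFold_sym, polarFold_right hy, sub_sub_cancel, hq, ← h]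

theorem fold_eq_zero_of_abs_eq {y : ℝ} (h : |(fold y).2| = (fold y).1) : fold y = 0 := by
  by_contra h0
  exact (fold_snd_lt h0).ne h

/-- Sectors over different sides only meet along their boundary rays. -/
theorem sector_eq_sym_sector {k : Bool × Bool} {y y' s s' : ℝ} (hy : |y| ≤ 1) (hy' : |y'| ≤ 1)
    (hs : 0 ≤ s) (hs1 : s ≤ 1) (hs' : 0 ≤ s') (hs1' : s' ≤ 1)
    (h : sector y s = sym k (sector y' s')) :
    (((1 : ℝ), y) = sym k (1, y') ∧ s = s') ∨ (s = 0 ∧ s' = 0 ∧ fold y = 0 ∧ fold y' = 0) ∨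
      (s = 0 ∧ s' = 0 ∧ k = (false, false) ∧ fold y = fold y') := by
  have hq := abs_le.1 (abs_sector_snd_le hy hs hs1)
  have hq' := abs_le.1 (abs_sector_snd_le hy' hs' hs1')
  have hzero : ∀ {y s : ℝ}, 0 ≤ s → s ≤ 1 → (sector y s).1 = 0 → s = 0 ∧ fold y = 0 := by
    intro y s hs hs1 h0
    have e := sector_fst y s
    have hf := fold_fst_nonneg y
    have hs0 : s = 0 := by nlinarith
    subst hs0
    refine ⟨rfl, fold_eq_zero_of_abs_eq ?_⟩
    have := abs_fold_snd_le y
    have := abs_nonneg (fold y).2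
    rw [h0] at e
    linarith
  have hedge : ∀ {y s : ℝ}, |y| ≤ 1 → 0 ≤ s → s ≤ 1 → ∀ c : ℝ, (c = 1 ∨ c = -1) →
      (sector y s).2 = c * (sector y s).1 → (sector y s).1 ≠ 0 →
      y = c ∧ (sector y s).1 = s := by
    intro y s hy hs hs1 c hc he h0
    rw [sector_fst, sector_snd] at he
    have hf := abs_le.1 (abs_fold_snd_le y)
    rw [abs_le] at hy
    have hsp : 0 < s := by
      refine hs.lt_of_ne' fun hs0 => h0 ?_
      rw [hs0, sector_zero]
      have : fold y = 0 := fold_eq_zero_of_abs_eq (by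
        have : (fold y).2 = c * (fold y).1 := by simpa [hs0] using he
        rw [this, abs_mul]
        rcases hc with rfl | rfl <;> simp [fold_fst_nonneg y])
      rw [this, Prod.fst_zero]
    have hyc : y = c := by
      rcases hc with rfl | rfl
      · have : 0 ≤ (1 - s) * ((fold y).1 - (fold y).2) := mul_nonneg (by linarith) (by linarith)
        nlinarith
      · have : 0 ≤ (1 - s) * ((fold y).1 + (fold y).2) := mul_nonneg (by linarith) (by linarith)
        nlinarith
    refine ⟨hyc, ?_⟩
    have : fold y = 0 := by
      rcases hc with rfl | rfl
      · exact fold_of_one_le hyc.ge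
      · exact fold_of_le hyc.le
    rw [sector_fst, this]
    simp
  by_cases h0 : (sector y s).1 = 0
  · obtain ⟨e1, e2⟩ := hzero hs hs1 h0
    have : sym k (sector y' s') = 0 := by rw [← h, e1, sector_zero, e2]
    have h0' : sector y' s' = 0 := by rw [← norm_eq_zero, ← norm_sym k, this, norm_zero]
    obtain ⟨e3, e4⟩ := hzero hs' hs1' (by rw [h0', Prod.fst_zero])
    exact Or.inr (Or.inl ⟨e1, e3, e2, e4⟩)
  · rcases k with ⟨_ | _, _ | _⟩
    · rw [sym_ff] at h
      rcases hs.eq_or_lt with rfl | hsp <;> rcases hs'.eq_or_lt with rfl | hsp'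
      · exact Or.inr (Or.inr ⟨rfl, rfl, rfl, by rwa [sector_zero, sector_zero] at h⟩)
      · exact absurd h (sector_zero_ne hsp' hs1')
      · exact absurd h.symm (sector_zero_ne hsp hs1)
      · obtain ⟨rfl, rfl⟩ := sector_eq_iff hy hy' hsp hs1 hsp' hs1' h
        exact Or.inl ⟨rfl, rfl⟩
    · rw [sym_ft] at h
      have e1 : (sector y s).1 = (sector y' s').2 := congrArg Prod.fst h
      have e2 : (sector y s).2 = (sector y' s').1 := congrArg Prod.snd h
      obtain ⟨rfl, e3⟩ := hedge hy hs hs1 1 (Or.inl rfl) (by linarith) h0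
      obtain ⟨rfl, e4⟩ := hedge hy' hs' hs1' 1 (Or.inl rfl) (by linarith)
        (fun h => h0 (by linarith))
      exact Or.inl ⟨by rw [sym_ft], by linarith⟩
    · rw [sym_tf] at h
      have e1 : (sector y s).1 = -(sector y' s').1 := congrArg Prod.fst h
      exact absurd (by linarith) h0
    · rw [sym_tt] at h
      have e1 : (sector y s).1 = -(sector y' s').2 := congrArg Prod.fst h
      have e2 : (sector y s).2 = -(sector y' s').1 := congrArg Prod.snd h
      obtain ⟨rfl, e3⟩ := hedge hy hs hs1 (-1) (Or.inr rfl) (by linarith) h0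
      obtain ⟨rfl, e4⟩ := hedge hy' hs' hs1' (-1) (Or.inr rfl) (by linarith)
        (fun h => h0 (by linarith))
      exact Or.inl ⟨by rw [sym_tt]; simp, by linarith⟩

/-- The kernel of the quotient map. -/
theorem polarFold_eq {b b' : ℝ × ℝ} {t t' : ℝ} (hb : ‖b‖ = 1) (hb' : ‖b'‖ = 1) (ht : 0 ≤ t)
    (ht1 : t ≤ 1) (ht' : 0 ≤ t') (ht1' : t' ≤ 1) (h : polarFold b t = polarFold b' t') :
    (b = b' ∧ t = t') ∨ (t = 1 ∧ t' = 1 ∧ ((boundaryFold b = 0 ∧ boundaryFold b' = 0) ∨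
      ∃ g y y', |y| ≤ 1 ∧ |y'| ≤ 1 ∧ b = sym g (1, y) ∧ b' = sym g (1, y') ∧
        fold y = fold y')) := by
  obtain ⟨g, y, hy, rfl⟩ := exists_side hb
  obtain ⟨g', y', hy', rfl⟩ := exists_side hb'
  obtain ⟨k, hk⟩ := exists_sym_sym g g'
  have hgk : ∀ p, sym g' p = sym g (sym k p) := fun p => by rw [← hk, sym_sym]
  rw [polarFold_sym, polarFold_sym, polarFold_right hy, polarFold_right hy', hgk] at h
  have h' := congrArg (sym g) h
  rw [sym_sym, sym_sym] at h'
  rcases sector_eq_sym_sector hy hy' (by linarith) (by linarith) (by linarith) (by linarith) h' with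
    ⟨e1, e2⟩ | ⟨e1, e2, e3, e4⟩ | ⟨e1, e2, rfl, e4⟩
  · exact Or.inl ⟨by rw [hgk, e1], by linarith⟩
  · refine Or.inr ⟨by linarith, by linarith, Or.inl ?_⟩
    rw [boundaryFold_sym, boundaryFold_sym, boundaryFold_right hy, boundaryFold_right hy', e3, e4]
    simp
  · exact Or.inr ⟨by linarith, by linarith,
      Or.inr ⟨g, y, y', hy, hy', rfl, by rw [hgk, sym_ff], e4⟩⟩

/-! ### The three-branched baker map -/

/-- The expanding factor of the baker map. -/
noncomputable def stretch : Fin 3 → ℝ → ℝ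
  | 0, x => 3 * x + 2
  | 1, x => -3 * x
  | 2, x => 3 * x - 2

/-- The contracting factor of the baker map. -/
noncomputable def shrink : Fin 3 → ℝ → ℝ
  | 0, x => (x - 2) / 3
  | 1, x => -x / 3
  | 2, x => (x + 2) / 3

@[simp] theorem stretch_zero (x : ℝ) : stretch 0 x = 3 * x + 2 := rfl
@[simp] theorem stretch_one (x : ℝ) : stretch 1 x = -3 * x := rfl
@[simp] theorem stretch_two (x : ℝ) : stretch 2 x = 3 * x - 2 := rfl
@[simp] theorem shrink_zero (x : ℝ) : shrink 0 x = (x - 2) / 3 := rfl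
@[simp] theorem shrink_one (x : ℝ) : shrink 1 x = -x / 3 := rfl
@[simp] theorem shrink_two (x : ℝ) : shrink 2 x = (x + 2) / 3 := rfl

theorem stretch_shrink (i : Fin 3) (x : ℝ) : stretch i (shrink i x) = x := by
  rcases fin_three_cases i with rfl | rfl | rfl <;> simp <;> ring

theorem shrink_stretch (i : Fin 3) (x : ℝ) : shrink i (stretch i x) = x := by
  rcases fin_three_cases i with rfl | rfl | rfl <;> simp

theorem abs_shrink_le (i : Fin 3) {x : ℝ} (hx : |x| ≤ 1) : |shrink i x| ≤ 1 := by
  rw [abs_le] at *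
  rcases fin_three_cases i with rfl | rfl | rfl <;>
    simp only [shrink_zero, shrink_one, shrink_two] <;>
    constructor <;> linarith

theorem exists_abs_stretch_le {x : ℝ} (hx : |x| ≤ 1) : ∃ i, |stretch i x| ≤ 1 := by
  rw [abs_le] at hx
  rcases le_total x (-1 / 3) with h | h
  · exact ⟨0, by rw [stretch_zero, abs_le]; constructor <;> linarith⟩
  rcases le_total x (1 / 3) with h' | h'
  · exact ⟨1, by rw [stretch_one, abs_le]; constructor <;> linarith⟩
  · exact ⟨2, by rw [stretch_two, abs_le]; constructor <;> linarith⟩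

theorem stretch_neg (i : Fin 3) (x : ℝ) : stretch i.rev (-x) = -stretch i x := by
  rcases fin_three_cases i with rfl | rfl | rfl
  · change 3 * (-x) - 2 = -(3 * x + 2); ring
  · change -3 * (-x) = -(-3 * x); ring
  · change 3 * (-x) + 2 = -(3 * x - 2); ring

theorem shrink_neg (i : Fin 3) (x : ℝ) : shrink i.rev (-x) = -shrink i x := by
  rcases fin_three_cases i with rfl | rfl | rfl
  · change (-x + 2) / 3 = -((x - 2) / 3); ring
  · change -(-x) / 3 = -(-x / 3); ring
  · change (-x - 2) / 3 = -((x + 2) / 3); ring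

/-- The branches of the baker map. -/
noncomputable def snake (i : Fin 3) (p : ℝ × ℝ) : ℝ × ℝ := (stretch i p.1, shrink i p.2)

theorem snake_neg (i : Fin 3) (p : ℝ × ℝ) : snake i.rev (-p) = -snake i p := by
  simp [snake, stretch_neg, shrink_neg]

theorem snake_flip_snake (i : Fin 3) (p : ℝ × ℝ) : snake i (flip (snake i p)) = flip p := by
  simp [snake, stretch_shrink, shrink_stretch]

theorem norm_snake_le {i : Fin 3} {p : ℝ × ℝ} (hp : ‖p‖ ≤ 1) (hi : |stretch i p.1| ≤ 1) :
    ‖snake i p‖ ≤ 1 := by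
  rw [norm_le_iff_abs] at *
  exact ⟨hi, abs_shrink_le i hp.2⟩

theorem continuous_snake (i : Fin 3) : Continuous (snake i) := by
  unfold snake
  rcases fin_three_cases i with rfl | rfl | rfl <;> simp only [stretch_zero, stretch_one,
    stretch_two, shrink_zero, shrink_one, shrink_two] <;> fun_prop

theorem snake_ne_zero {i : Fin 3} {p : ℝ × ℝ} (hp : ‖p‖ ≤ 1) (hp0 : p ≠ 0) : snake i p ≠ 0 := by
  rw [norm_le_iff_abs, abs_le, abs_le] at hp
  intro h
  have h1 : stretch i p.1 = 0 := congrArg Prod.fst h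
  have h2 : shrink i p.2 = 0 := congrArg Prod.snd h
  rcases fin_three_cases i with rfl | rfl | rfl
  · rw [shrink_zero] at h2; linarith
  · rw [stretch_one] at h1; rw [shrink_one] at h2
    exact hp0 (Prod.ext (by simp; linarith) (by simp; linarith))
  · rw [shrink_two] at h2; linarith

/-- The linear part of the middle branch. -/
noncomputable def saddle : (ℝ × ℝ) →L[ℝ] (ℝ × ℝ) :=
  ((-3 : ℝ) • ContinuousLinearMap.fst ℝ ℝ ℝ).prod ((-1 / 3 : ℝ) • ContinuousLinearMap.snd ℝ ℝ ℝ)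

theorem saddle_apply (v : ℝ × ℝ) : saddle v = (-3 * v.1, -1 / 3 * v.2) := rfl

theorem snake_one (p : ℝ × ℝ) : snake 1 p = saddle p := by
  ext <;> simp [snake, saddle_apply]; ring

theorem saddle_flip_saddle (v : ℝ × ℝ) : saddle (flip (saddle v)) = flip v := by
  rw [← snake_one, ← snake_one, snake_flip_snake]

theorem saddle_ne_zero {v : ℝ × ℝ} (hv : v ≠ 0) : saddle v ≠ 0 := by
  intro h
  have h1 := congrArg Prod.fst h
  have h2 := congrArg Prod.snd h
  simp only [saddle_apply, Prod.fst_zero, Prod.snd_zero] at h1 h2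
  exact hv (Prod.ext (by simp; linarith) (by simp; linarith))

/-! ### The quotient map in Cartesian coordinates -/

/-- The quotient map from the punctured square. -/
noncomputable def squareFold (p : ℝ × ℝ) : ℝ × ℝ := polarFold (dir p) ‖p‖

theorem dir_sym (g : Bool × Bool) (p : ℝ × ℝ) : dir (sym g p) = sym g (dir p) := by
  simp [dir]

theorem squareFold_sym (g : Bool × Bool) (p : ℝ × ℝ) :
    squareFold (sym g p) = sym g (squareFold p) := by
  rw [squareFold, dir_sym, norm_sym, polarFold_sym, squareFold]

theorem squareFold_neg (p : ℝ × ℝ) : squareFold (-p) = -squareFold p :=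
  squareFold_sym (true, false) p

theorem squareFold_flip (p : ℝ × ℝ) : squareFold (flip p) = flip (squareFold p) :=
  squareFold_sym (false, true) p

theorem squareFold_smul {b : ℝ × ℝ} (hb : ‖b‖ = 1) {t : ℝ} (ht : 0 < t) :
    squareFold (t • b) = polarFold b t := by
  rw [squareFold, dir_smul ht, dir_eq_self hb, norm_smul, hb, mul_one, Real.norm_of_nonneg ht.le]

theorem squareFold_of_norm_eq_one {b : ℝ × ℝ} (hb : ‖b‖ = 1) : squareFold b = boundaryFold b := by
  rw [squareFold, dir_eq_self hb, hb, polarFold_one]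

theorem squareFold_right {y : ℝ} (hy : |y| ≤ 1) : squareFold (1, y) = fold y := by
  rw [squareFold_of_norm_eq_one (norm_one_mk hy), boundaryFold_right hy]

theorem squareFold_left {y : ℝ} (hy : |y| ≤ 1) : squareFold (-1, y) = -fold (-y) := by
  rw [← squareFold_right (by rwa [abs_neg]), ← squareFold_neg]
  simp

theorem squareFold_top {y : ℝ} (hy : |y| ≤ 1) : squareFold (y, 1) = flip (fold y) := by
  rw [← squareFold_right hy, ← squareFold_flip]
  rfl

theorem continuousAt_squareFold {p : ℝ × ℝ} (hp : p ≠ 0) : ContinuousAt squareFold p :=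
  continuous_polarFold.continuousAt.comp₂ (continuousAt_dir hp) continuousAt_id.norm

theorem norm_squareFold_lt {p : ℝ × ℝ} (hp : ‖p‖ ≤ 1) (hp0 : p ≠ 0) : ‖squareFold p‖ < 1 := by
  have := norm_polarFold_le (norm_dir hp0) (norm_nonneg p) hp
  have := norm_pos_iff.2 hp0
  unfold squareFold
  linarith

/-! ### Compatibility of the branches with the quotient map -/

theorem fold_reflect {y y' : ℝ} (hy : y ≤ 1 / 3) (hy' : y' ≤ 1 / 3) (h : y + y' = -2 / 3) :
    fold y = fold y' := by
  rw [fold_of_le_third hy, fold_of_le_third hy']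
  have : y - (1 - 4 / 3 * 1) = -(y' - (1 - 4 / 3 * 1)) := by linarith
  rw [tent, tent, this, abs_neg]

theorem squareFold_snake_overlap {y : ℝ} (hy : |y| ≤ 1) :
    squareFold (snake 1 (1 / 3, y)) = squareFold (snake 2 (1 / 3, y)) := by
  have h1 : snake 1 (1 / 3, y) = (-1, -y / 3) := by simp [snake]
  have h2 : snake 2 (1 / 3, y) = (-1, (y + 2) / 3) := by
    ext <;> simp [snake]
    norm_num
  rw [h1, h2, squareFold_left (show |-y / 3| ≤ 1 from abs_shrink_le 1 hy),
    squareFold_left (show |(y + 2) / 3| ≤ 1 from abs_shrink_le 2 hy)]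
  rw [abs_le] at hy
  rw [fold_reflect (y := -(-y / 3)) (y' := -((y + 2) / 3)) (by linarith) (by linarith) (by ring)]

theorem squareFold_snake_eq {p : ℝ × ℝ} (hp : ‖p‖ ≤ 1) {i i' : Fin 3}
    (hi : |stretch i p.1| ≤ 1) (hi' : |stretch i' p.1| ≤ 1) :
    squareFold (snake i p) = squareFold (snake i' p) := by
  have key : ∀ q : ℝ × ℝ, ‖q‖ ≤ 1 → |stretch 1 q.1| ≤ 1 → |stretch 2 q.1| ≤ 1 →
      squareFold (snake 1 q) = squareFold (snake 2 q) := by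
    rintro ⟨x, y⟩ hq h1 h2
    simp only [stretch_one, stretch_two, abs_le] at h1 h2
    obtain rfl : x = 1 / 3 := by linarith [h1.1, h1.2, h2.1, h2.2]
    exact squareFold_snake_overlap (norm_le_iff_abs.1 hq).2
  have key' : |stretch 0 p.1| ≤ 1 → |stretch 1 p.1| ≤ 1 →
      squareFold (snake 0 p) = squareFold (snake 1 p) := by
    intro h0 h1
    have h := key (-p) (by rwa [norm_neg])
      (by have := stretch_neg 1 p.1; rw [Prod.fst_neg]; change stretch 1 _ = _ at this
          rwa [this, abs_neg])
      (by have := stretch_neg 0 p.1; rw [Prod.fst_neg]; change stretch 2 _ = _ at this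
          rwa [this, abs_neg])
    have e1 := snake_neg 1 p
    have e2 := snake_neg 0 p
    change snake 1 _ = _ at e1
    change snake 2 _ = _ at e2
    rw [e1, e2, squareFold_neg, squareFold_neg, neg_inj] at h
    exact h.symm
  have hno : |stretch 0 p.1| ≤ 1 → ¬ |stretch 2 p.1| ≤ 1 := by
    intro h1 h2
    simp only [stretch_zero, stretch_two, abs_le] at h1 h2
    linarith [h1.2, h2.1]
  rcases fin_three_cases i with rfl | rfl | rfl <;> rcases fin_three_cases i' with rfl | rfl | rfl
  · rfl
  · exact key' hi hi'
  · exact absurd hi' (hno hi)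
  · exact (key' hi' hi).symm
  · rfl
  · exact key p hp hi hi'
  · exact absurd hi (hno hi')
  · exact (key p hp hi' hi).symm
  · rfl

theorem squareFold_snake_right {y : ℝ} (hy : |y| ≤ 1) {i : Fin 3}
    (hi : |stretch i 1| ≤ 1) : squareFold (snake i (1, y)) = shear (fold y) := by
  rcases fin_three_cases i with rfl | rfl | rfl
  · norm_num at hi
  · norm_num at hi
  · have h1 : snake 2 (1, y) = (1, (y + 2) / 3) := by
      ext <;> simp [snake]
      norm_num
    rw [h1, squareFold_right (show |(y + 2) / 3| ≤ 1 from abs_shrink_le 2 hy)]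
    rw [abs_le] at hy
    rw [fold_of_third_le (by linarith)]
    congr 2
    ring

theorem squareFold_snake_top {y : ℝ} (hy : |y| ≤ 1) {i : Fin 3} (hi : |stretch i y| ≤ 1) :
    (1 / 3 ≤ y ∧ squareFold (snake i (y, 1)) = flip (fold (3 * y - 2))) ∨
      (y ≤ 1 / 3 ∧ squareFold (snake i (y, 1)) = squareFold (3 * (fold y).1 - 1, -1 / 3)) := by
  rw [abs_le] at hy
  rcases fin_three_cases i with rfl | rfl | rfl
  · rw [stretch_zero, abs_le] at hi
    refine Or.inr ⟨by linarith, congrArg squareFold ?_⟩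
    rw [fold_of_le_third (by linarith), tent_of_mem (by linarith) (by linarith),
      abs_of_nonpos (by linarith)]
    ext <;> simp [snake] <;> ring
  · rw [stretch_one, abs_le] at hi
    refine Or.inr ⟨by linarith, congrArg squareFold ?_⟩
    rw [fold_of_le_third (by linarith), tent_of_mem (by linarith) (by linarith),
      abs_of_nonneg (by linarith)]
    ext <;> simp [snake]
    ring
  · have hi' := hi
    rw [stretch_two, abs_le] at hi
    refine Or.inl ⟨by linarith, ?_⟩
    have h1 : snake 2 (y, 1) = (3 * y - 2, 1) := by
      ext <;> simp [snake]
      norm_num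
    rw [h1, squareFold_top (show |3 * y - 2| ≤ 1 from hi')]

theorem squareFold_snake_top_eq {y y' : ℝ} (hy : |y| ≤ 1) (hy' : |y'| ≤ 1) {i i' : Fin 3}
    (hi : |stretch i y| ≤ 1) (hi' : |stretch i' y'| ≤ 1) (h : fold y = fold y') :
    squareFold (snake i (y, 1)) = squareFold (snake i' (y', 1)) := by
  have cross : ∀ {y y' : ℝ}, |y| ≤ 1 → |y'| ≤ 1 → 1 / 3 ≤ y → y' ≤ 1 / 3 → fold y = fold y' →
      flip (fold (3 * y - 2)) = squareFold (3 * (fold y').1 - 1, -1 / 3) := by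
    intro y y' _ _ h1 h2 he
    have e1 := fold_snd_ge (k := 1) (y := y) (by linarith)
    have e2 := fold_of_le_third h2
    have e3 := tent_nonneg 1 y'
    have e4 : fold y' = 0 := by
      rw [he, e2] at e1
      simp only [Prod.smul_mk, smul_eq_mul, mul_one] at e1
      have : tent 1 y' = 0 := by linarith
      rw [e2, this, zero_smul]
    have e5 : fold (3 * y - 2) = 0 := shear_injective (by
      rw [← fold_of_third_le h1, he, e4, map_zero])
    rw [e5, e4, Prod.fst_zero, mul_zero, zero_sub, squareFold_left (by rw [abs_le]; norm_num),
      fold_of_le_third (by norm_num), tent_of_ge (by norm_num)]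
    simp
  rcases squareFold_snake_top hy hi with ⟨h1, e1⟩ | ⟨h1, e1⟩ <;>
    rcases squareFold_snake_top hy' hi' with ⟨h2, e2⟩ | ⟨h2, e2⟩
  · rw [e1, e2, shear_injective (by rw [← fold_of_third_le h1, ← fold_of_third_le h2, h] :
      shear (fold (3 * y - 2)) = shear (fold (3 * y' - 2)))]
  · rw [e1, e2, cross hy hy' h1 h2 h]
  · rw [e1, e2, cross hy' hy h2 h1 h.symm]
  · rw [e1, e2, h]

theorem squareFold_snake_side_eq (g : Bool × Bool) {y y' : ℝ} (hy : |y| ≤ 1) (hy' : |y'| ≤ 1)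
    {i i' : Fin 3} (hi : |stretch i (sym g (1, y)).1| ≤ 1)
    (hi' : |stretch i' (sym g (1, y')).1| ≤ 1) (h : fold y = fold y') :
    squareFold (snake i (sym g (1, y))) = squareFold (snake i' (sym g (1, y'))) := by
  have hneg : ∀ {j : Fin 3} {x : ℝ}, |stretch j (-x)| ≤ 1 → |stretch j.rev x| ≤ 1 := by
    intro j x hj
    rwa [← neg_neg x, stretch_neg, abs_neg]
  have hneg' : ∀ (j : Fin 3) (p : ℝ × ℝ),
      squareFold (snake j (-p)) = -squareFold (snake j.rev p) := by
    intro j p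
    rw [← squareFold_neg, ← snake_neg, Fin.rev_rev]
  rcases g with ⟨_ | _, _ | _⟩
  · simp only [sym_ff] at *
    rw [squareFold_snake_right hy hi, squareFold_snake_right hy' hi', h]
  · simp only [sym_ft] at *
    exact squareFold_snake_top_eq hy hy' hi hi' h
  · simp only [sym_tf] at *
    rw [hneg', hneg', squareFold_snake_right hy (hneg hi), squareFold_snake_right hy' (hneg hi'), h]
  · simp only [sym_tt] at *
    rw [hneg', hneg', squareFold_snake_top_eq hy hy' (hneg hi) (hneg hi') h]

theorem squareFold_snake_side_eq_zero {b : ℝ × ℝ} (hb : ‖b‖ = 1) {i : Fin 3}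
    (hi : |stretch i b.1| ≤ 1) (h : boundaryFold b = 0) : squareFold (snake i b) = 0 := by
  obtain ⟨g, y, hy, rfl⟩ := exists_side hb
  rw [boundaryFold_sym, boundaryFold_right hy] at h
  have h0 : fold y = fold 1 := by
    rw [fold_of_one_le le_rfl, ← sym_sym g (fold y), h, map_zero]
  have hfix : ∃ j, |stretch j (sym g (1, 1)).1| ≤ 1 ∧
      snake j (sym g (1, 1)) = sym g (1, 1) := by
    rcases g with ⟨_ | _, _ | _⟩
    · exact ⟨2, by rw [sym_ff]; norm_num, by ext <;> norm_num [sym_ff, snake]⟩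
    · exact ⟨2, by rw [sym_ft]; norm_num, by ext <;> norm_num [sym_ft, snake]⟩
    · exact ⟨0, by rw [sym_tf]; norm_num, by ext <;> norm_num [sym_tf, snake]⟩
    · exact ⟨0, by rw [sym_tt]; norm_num, by ext <;> norm_num [sym_tt, snake]⟩
  obtain ⟨j, hj, hj'⟩ := hfix
  rw [squareFold_snake_side_eq g hy (by simp) hi hj h0, hj', squareFold_sym,
    squareFold_right (by simp), fold_of_one_le le_rfl, map_zero]

/-! ### The factor map of the folded baker map -/

theorem ne_zero_of_norm_eq_one {b : ℝ × ℝ} (hb : ‖b‖ = 1) : b ≠ 0 :=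
  norm_ne_zero_iff.1 (by rw [hb]; exact one_ne_zero)

open Classical in
/-- The baker map in polar coordinates, extended to the blown up origin by the direction of the
linear part. -/
noncomputable def polarStep (i : Fin 3) (b : ℝ × ℝ) (t : ℝ) : ℝ × ℝ :=
  if t = 0 then dir (saddle b) else squareFold (snake i (t • b))

theorem polarStep_zero (i : Fin 3) (b : ℝ × ℝ) : polarStep i b 0 = dir (saddle b) := if_pos rfl

theorem polarStep_of_pos (i : Fin 3) (b : ℝ × ℝ) {t : ℝ} (ht : 0 < t) :
    polarStep i b t = squareFold (snake i (t • b)) := if_neg ht.ne'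

theorem polarStep_one (b : ℝ × ℝ) {t : ℝ} (ht : 0 ≤ t) :
    polarStep 1 b t = polarFold (dir (saddle b)) (t * ‖saddle b‖) := by
  rcases ht.eq_or_lt with rfl | ht'
  · rw [polarStep_zero, zero_mul, polarFold_zero]
  · rw [polarStep_of_pos _ _ ht', snake_one, map_smul, squareFold, dir_smul ht', norm_smul,
      Real.norm_of_nonneg ht]

/-- The relation on the square induced by the baker map. -/
def IsStep (w w' : ℝ × ℝ) : Prop :=
  ∃ b t i, ‖b‖ = 1 ∧ 0 ≤ t ∧ t ≤ 1 ∧ |stretch i (t * b.1)| ≤ 1 ∧ w = polarFold b t ∧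
    w' = polarStep i b t

theorem isStep_squareFold {p : ℝ × ℝ} (hp : ‖p‖ ≤ 1) (hp0 : p ≠ 0) {i : Fin 3}
    (hi : |stretch i p.1| ≤ 1) : IsStep (squareFold p) (squareFold (snake i p)) := by
  refine ⟨dir p, ‖p‖, i, norm_dir hp0, norm_nonneg p, hp, ?_, rfl, ?_⟩
  · rwa [← smul_eq_mul, ← Prod.smul_fst, norm_smul_dir]
  · rw [polarStep_of_pos _ _ (norm_pos_iff.2 hp0), norm_smul_dir]

theorem isStep_polarFold {b : ℝ × ℝ} {t : ℝ} (hb : ‖b‖ = 1) (ht : 0 ≤ t) (ht1 : t ≤ 1)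
    (h : 3 * (t * |b.1|) ≤ 1) :
    IsStep (polarFold b t) (polarFold (dir (saddle b)) (t * ‖saddle b‖)) := by
  refine ⟨b, t, 1, hb, ht, ht1, ?_, rfl, (polarStep_one b ht).symm⟩
  rw [stretch_one, abs_mul, abs_mul, abs_of_nonneg ht]
  norm_num
  exact h

theorem isStep_boundary {b : ℝ × ℝ} (hb : ‖b‖ = 1) : IsStep b (dir (saddle b)) := by
  have := isStep_polarFold hb le_rfl zero_le_one (by norm_num)
  rwa [polarFold_zero, zero_mul, polarFold_zero] at this

theorem IsStep.norm_le {w w' : ℝ × ℝ} (h : IsStep w w') : ‖w‖ ≤ 1 := by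
  obtain ⟨b, t, i, hb, ht, ht1, -, rfl, -⟩ := h
  linarith [norm_polarFold_le hb ht ht1]

theorem IsStep.unique {w w₁ w₂ : ℝ × ℝ} (h₁ : IsStep w w₁) (h₂ : IsStep w w₂) : w₁ = w₂ := by
  obtain ⟨b, t, i, hb, ht, ht1, hi, rfl, rfl⟩ := h₁
  obtain ⟨b', t', i', hb', ht', ht1', hi', he, rfl⟩ := h₂
  rcases polarFold_eq hb hb' ht ht1 ht' ht1' he with ⟨rfl, rfl⟩ | ⟨rfl, rfl, h⟩
  · rcases ht.eq_or_lt with rfl | htp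
    · rw [polarStep_zero, polarStep_zero]
    · rw [polarStep_of_pos _ _ htp, polarStep_of_pos _ _ htp]
      exact squareFold_snake_eq (by rwa [norm_smul, hb, mul_one, Real.norm_of_nonneg ht]) hi hi'
  · rw [polarStep_of_pos _ _ one_pos, polarStep_of_pos _ _ one_pos, one_smul, one_smul]
    rw [one_mul] at hi hi'
    rcases h with ⟨h, h'⟩ | ⟨g, y, y', hy, hy', rfl, rfl, hf⟩
    · rw [squareFold_snake_side_eq_zero hb hi h, squareFold_snake_side_eq_zero hb' hi' h']
    · exact squareFold_snake_side_eq g hy hy' hi hi' hf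

theorem exists_isStep {w : ℝ × ℝ} (hw : ‖w‖ ≤ 1) : ∃ w', IsStep w w' := by
  obtain ⟨b, t, hb, ht, ht1, rfl⟩ := exists_polarFold_eq hw
  have : |t * b.1| ≤ 1 := by
    rw [abs_mul, abs_of_nonneg ht]
    have := abs_fst_le b
    rw [hb] at this
    exact mul_le_one₀ ht1 (abs_nonneg _) this
  obtain ⟨i, hi⟩ := exists_abs_stretch_le this
  exact ⟨_, b, t, i, hb, ht, ht1, hi, rfl, rfl⟩

theorem dir_flip (p : ℝ × ℝ) : dir (flip p) = flip (dir p) := dir_sym (false, true) p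

theorem norm_flip (p : ℝ × ℝ) : ‖flip p‖ = ‖p‖ := norm_sym (false, true) p

theorem IsStep.flip {w w' : ℝ × ℝ} (h : IsStep w w') : IsStep (flip w') (flip w) := by
  obtain ⟨b, t, i, hb, ht, ht1, hi, rfl, rfl⟩ := h
  rcases ht.eq_or_lt with rfl | htp
  · rw [polarStep_zero, polarFold_zero]
    have hs := saddle_ne_zero (ne_zero_of_norm_eq_one hb)
    have := isStep_boundary (b := CarpetDynamics.flip (dir (saddle b)))
      (by rw [norm_flip, norm_dir hs])
    rw [← dir_flip] at this ⊢
    rw [dir, map_smul, dir_smul, saddle_flip_saddle, dir_flip, dir_eq_self hb] at this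
    · exact this
    · exact inv_pos.2 (by rw [norm_flip]; exact norm_pos_iff.2 hs)
  · rw [polarStep_of_pos _ _ htp, ← squareFold_smul hb htp]
    have hp : ‖t • b‖ ≤ 1 := by rwa [norm_smul, hb, mul_one, Real.norm_of_nonneg ht]
    have hp0 : t • b ≠ 0 := smul_ne_zero htp.ne' (ne_zero_of_norm_eq_one hb)
    generalize hpe : t • b = p at *
    have hi' : |stretch i p.1| ≤ 1 := by rw [← hpe]; exact hi
    rw [← squareFold_flip, ← squareFold_flip, ← snake_flip_snake i p]
    refine isStep_squareFold (by rw [norm_flip]; exact norm_snake_le hp hi') ?_ ?_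
    · rw [← norm_ne_zero_iff, norm_flip, norm_ne_zero_iff]
      exact snake_ne_zero hp hp0
    · rw [flip_apply]
      change |stretch i (shrink i p.2)| ≤ 1
      rw [stretch_shrink]
      exact (norm_le_iff_abs.1 hp).2

theorem isCompact_isStep : IsCompact {z : (ℝ × ℝ) × (ℝ × ℝ) | IsStep z.1 z.2} := by
  have hside : ∀ i : Fin 3, i ≠ 1 → IsCompact ((fun p => (squareFold p, squareFold (snake i p))) ''
      {p | ‖p‖ ≤ 1 ∧ |stretch i p.1| ≤ 1}) := by
    intro i hi
    refine IsCompact.image_of_continuousOn ?_ ?_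
    · refine (isCompact_closedBall (0 : ℝ × ℝ) 1).of_isClosed_subset ?_ ?_
      · have : Continuous fun p : ℝ × ℝ => stretch i p.1 := (continuous_snake i).fst
        exact (isClosed_le continuous_norm continuous_const).inter
          (isClosed_le this.abs continuous_const)
      · exact fun p hp => mem_closedBall_zero_iff.2 hp.1
    · rintro p ⟨hp, hp'⟩
      have hp0 : p ≠ 0 := by
        rintro rfl
        rcases fin_three_cases i with rfl | rfl | rfl
        · norm_num at hp'
        · exact hi rfl
        · norm_num at hp'
      exact ((continuousAt_squareFold hp0).prodMk
        (ContinuousAt.comp (g := squareFold) (continuousAt_squareFold (snake_ne_zero hp hp0))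
          (continuous_snake i).continuousAt)).continuousWithinAt
  have hmid : IsCompact ((fun z : (ℝ × ℝ) × ℝ => (polarFold z.1 z.2,
      polarFold (dir (saddle z.1)) (z.2 * ‖saddle z.1‖))) ''
      {z | ‖z.1‖ = 1 ∧ 0 ≤ z.2 ∧ z.2 ≤ 1 ∧ 3 * (z.2 * |z.1.1|) ≤ 1}) := by
    refine IsCompact.image_of_continuousOn ?_ ?_
    · refine ((isCompact_sphere (0 : ℝ × ℝ) 1).prod (isCompact_Icc (a := (0 : ℝ)) (b := 1)))
        |>.of_isClosed_subset ?_ ?_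
      · simp only [ofPred_and]
        exact (isClosed_eq (by fun_prop) (by fun_prop)).inter
          ((isClosed_le (by fun_prop) (by fun_prop)).inter
          ((isClosed_le (by fun_prop) (by fun_prop)).inter
            (isClosed_le (by fun_prop) (by fun_prop))))
      · exact fun z hz => ⟨mem_sphere_zero_iff_norm.2 hz.1, hz.2.1, hz.2.2.1⟩
    · rintro z ⟨hz, -⟩
      have hs := saddle_ne_zero (ne_zero_of_norm_eq_one hz)
      have h1 : ContinuousAt (fun z : (ℝ × ℝ) × ℝ => dir (saddle z.1)) z :=
        ContinuousAt.comp (g := dir) (continuousAt_dir hs) (by fun_prop)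
      have h2 : ContinuousAt (fun z : (ℝ × ℝ) × ℝ => z.2 * ‖saddle z.1‖) z := by fun_prop
      exact (continuous_polarFold.continuousAt.prodMk
        (continuous_polarFold.continuousAt.comp₂ h1 h2)).continuousWithinAt
  convert hmid.union ((hside 0 (by decide)).union (hside 2 (by decide))) using 1
  ext ⟨w, w'⟩
  constructor
  · rintro ⟨b, t, i, hb, ht, ht1, hi, h1, h2⟩
    have hpos : i ≠ 1 → 0 < t := by
      intro hne
      rcases ht.eq_or_lt with rfl | h
      · rcases fin_three_cases i with rfl | rfl | rfl
        · norm_num at hi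
        · exact absurd rfl hne
        · norm_num at hi
      · exact h
    have hp : ‖t • b‖ ≤ 1 := by rwa [norm_smul, hb, mul_one, Real.norm_of_nonneg ht]
    have hgen : i ≠ 1 → (w, w') ∈ (fun p => (squareFold p, squareFold (snake i p))) ''
      {p | ‖p‖ ≤ 1 ∧ |stretch i p.1| ≤ 1} := by
      intro hne
      refine ⟨t • b, ⟨hp, hi⟩, ?_⟩
      change w = _ at h1
      change w' = _ at h2
      rw [h1, h2, polarStep_of_pos _ _ (hpos hne), ← squareFold_smul hb (hpos hne)]
    rcases fin_three_cases i with rfl | rfl | rfl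
    · exact Or.inr (Or.inl (hgen (by decide)))
    · refine Or.inl ⟨(b, t), ⟨hb, ht, ht1, ?_⟩, ?_⟩
      · rw [stretch_one, abs_mul, abs_mul, abs_of_nonneg ht] at hi
        norm_num at hi
        exact hi
      · change w = _ at h1
        change w' = _ at h2
        rw [h1, h2, polarStep_one b ht]
    · exact Or.inr (Or.inr (hgen (by decide)))
  · have hgen : ∀ i : Fin 3, i ≠ 1 → (w, w') ∈ (fun p => (squareFold p, squareFold (snake i p))) ''
      {p | ‖p‖ ≤ 1 ∧ |stretch i p.1| ≤ 1} → IsStep w w' := by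
      rintro i hi ⟨p, ⟨hp, hp'⟩, he⟩
      obtain ⟨rfl, rfl⟩ := Prod.mk.inj he
      refine isStep_squareFold hp ?_ hp'
      rintro rfl
      rcases fin_three_cases i with rfl | rfl | rfl
      · norm_num at hp'
      · exact hi rfl
      · norm_num at hp'
    rintro (⟨⟨b, t⟩, ⟨hb, ht, ht1, h⟩, he⟩ | h | h)
    · obtain ⟨rfl, rfl⟩ := Prod.mk.inj he
      exact isStep_polarFold hb ht ht1 h
    · exact hgen 0 (by decide) h
    · exact hgen 2 (by decide) h

/-- A function with compact graph is continuous on its domain. -/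
theorem continuousOn_of_isCompact_graph {X Y : Type*} [TopologicalSpace X] [T2Space X]
    [TopologicalSpace Y] {f : X → Y} {s : Set X}
    (h : IsCompact {z : X × Y | z.1 ∈ s ∧ z.2 = f z.1}) : ContinuousOn f s := by
  rw [continuousOn_iff_isClosed]
  intro t ht
  refine ⟨Prod.fst '' ({z : X × Y | z.1 ∈ s ∧ z.2 = f z.1} ∩ Prod.snd ⁻¹' t),
    ((h.inter_right (ht.preimage continuous_snd)).image continuous_fst).isClosed, ?_⟩
  ext x
  constructor
  · rintro ⟨hx, hxs⟩
    exact ⟨⟨(x, f x), ⟨⟨hxs, rfl⟩, hx⟩, rfl⟩, hxs⟩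
  · rintro ⟨⟨z, ⟨⟨-, hz⟩, hy⟩, rfl⟩, hxs⟩
    exact ⟨by rw [mem_preimage, ← hz]; exact hy, hxs⟩

/-- The factor on the square of the baker map with blown up origin. -/
theorem exists_bakerFactor : ∃ F : ℝ × ℝ → ℝ × ℝ, ContinuousOn F square ∧ InjOn F square ∧
    F '' square = square ∧ ∀ w w', IsStep w w' → F w = w' := by
  choose! F hF using fun (w : ℝ × ℝ) (hw : ‖w‖ ≤ 1) => exists_isStep hw
  have hstep : ∀ w w', IsStep w w' → F w = w' := fun w w' h => (hF w h.norm_le).unique h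
  have hnorm : ∀ w w', IsStep w w' → ‖w'‖ ≤ 1 := fun w w' h => by
    rw [← norm_flip]; exact h.flip.norm_le
  refine ⟨F, ?_, ?_, ?_, hstep⟩
  · refine continuousOn_of_isCompact_graph ?_
    convert isCompact_isStep using 1
    ext ⟨w, w'⟩
    constructor
    · rintro ⟨h1, h2⟩
      change w' = F w at h2
      subst h2
      exact hF w (mem_square.1 h1)
    · intro h
      exact ⟨mem_square.2 h.norm_le, (hstep _ _ h).symm⟩
  · intro w hw w' hw' he
    have h1 := (hF w (mem_square.1 hw)).flip
    have h2 := (hF w' (mem_square.1 hw')).flip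
    rw [he] at h1
    have := congrArg flip (h1.unique h2)
    simpa using this
  · apply Subset.antisymm
    · rintro _ ⟨w, hw, rfl⟩
      exact mem_square.2 (hnorm _ _ (hF w (mem_square.1 hw)))
    · intro w hw
      obtain ⟨w', h⟩ := exists_isStep (w := flip w) (by rw [norm_flip]; exact mem_square.1 hw)
      have h' := h.flip
      refine ⟨flip w', mem_square.2 h'.norm_le, ?_⟩
      rw [hstep _ _ h']
      simp

/-! ### Differentiability at generic points -/

/-- The formula for `squareFold` on the triangles where it is smooth. -/
noncomputable def foldChart (η s c : ℝ) (p : ℝ × ℝ) : ℝ × ℝ :=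
  (1 - p.1 + (η * p.1 - s * (p.2 - c * p.1)),
    p.2 * p.1⁻¹ - p.2 + c * (η * p.1 - s * (p.2 - c * p.1)))

theorem exists_hasFDerivAt_foldChart {η s c : ℝ} {p : ℝ × ℝ} (hp : 0 < p.1) (hp1 : p.1 ≤ 1)
    (hη : η ≤ 1) (hs : s * s = 1) (hc : 0 < s * (p.2 * p.1⁻¹ - c)) :
    ∃ A : (ℝ × ℝ) →L[ℝ] (ℝ × ℝ), Function.Injective A ∧ HasFDerivAt (foldChart η s c) A p := by
  have h1 : HasFDerivAt (fun p : ℝ × ℝ => p.1) (ContinuousLinearMap.fst ℝ ℝ ℝ) p := hasFDerivAt_fst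
  have h2 : HasFDerivAt (fun p : ℝ × ℝ => p.2) (ContinuousLinearMap.snd ℝ ℝ ℝ) p := hasFDerivAt_snd
  have hinv : HasFDerivAt (fun p : ℝ × ℝ => p.1⁻¹)
      ((-(p.1 ^ 2)⁻¹) • ContinuousLinearMap.fst ℝ ℝ ℝ) p :=
    (hasDerivAt_inv hp.ne').comp_hasFDerivAt p h1
  have h3 := (h1.const_mul η).sub ((h2.sub (h1.const_mul c)).const_mul s)
  have h4 := ((h1.const_sub 1).add h3).prodMk (((h2.mul hinv).sub h2).add (h3.const_mul c))
  refine ⟨_, ?_, h4⟩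
  rw [injective_iff_map_eq_zero]
  rintro ⟨u, v⟩ huv
  have e1 := congrArg Prod.fst huv
  have e2 := congrArg Prod.snd huv
  simp at e1 e2
  rw [← inv_pow] at e2
  have hk : 1 ≤ p.1⁻¹ := (one_le_inv₀ hp).2 hp1
  generalize p.1⁻¹ = k at *
  have hv : v = c * u + s * (η - 1) * u := by linear_combination (-s) * e1 + (c * u - v) * hs
  have hu : u * (k * (s * (p.2 * k - c)) + (k - 1) * (1 - η)) = 0 := by
    have e3 : p.2 * (-(k ^ 2 * u)) + k * v - v + c * u = 0 := by linear_combination e2 - c * e1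
    rw [hv] at e3
    linear_combination (-s) * e3 + (k - 1) * (η - 1) * u * hs
  have hpos : 0 < k * (s * (p.2 * k - c)) + (k - 1) * (1 - η) :=
    add_pos_of_pos_of_nonneg (mul_pos (by linarith) hc) (mul_nonneg (by linarith) (by linarith))
  obtain rfl : u = 0 := (mul_eq_zero.1 hu).resolve_right hpos.ne'
  simp [hv]

/-- No nontrivial rational affine relation holds between the coordinates of `p`. -/
def Generic (p : ℝ × ℝ) : Prop :=
  ∀ a b c : ℚ, (a : ℝ) + b * p.1 + c * p.2 = 0 → b = 0 ∧ c = 0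

theorem Generic.sym {p : ℝ × ℝ} (hp : Generic p) (g : Bool × Bool) : Generic (sym g p) := by
  intro a b c h
  rcases g with ⟨_ | _, _ | _⟩
  · exact hp a b c h
  · exact (hp a c b (by rw [sym_ft] at h; linarith)).symm
  · have := hp a (-b) (-c) (by simp [sym_tf] at h; push_cast; linarith)
    simpa using this
  · have := hp a (-c) (-b) (by simp [sym_tt] at h; push_cast; linarith)
    simpa [and_comm] using this

theorem Generic.ne_zero {p : ℝ × ℝ} (hp : Generic p) : p ≠ 0 := by
  rintro rfl
  simpa using hp 0 1 0

theorem Generic.fst_ne {p : ℝ × ℝ} (hp : Generic p) (q : ℚ) : p.1 ≠ q := by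
  intro h
  simpa using hp (-q) 1 0 (by rw [h]; push_cast; ring)

theorem Generic.snd_ne_mul {p : ℝ × ℝ} (hp : Generic p) (q : ℚ) : p.2 ≠ q * p.1 := by
  intro h
  simpa using hp 0 (-q) 1 (by rw [h]; push_cast; ring)

theorem exists_hasFDerivAt_squareFold_right {p : ℝ × ℝ} (hp : Generic p) (h0 : 0 < p.1)
    (h1 : p.1 ≤ 1) (h2 : |p.2| < p.1) :
    ∃ A : (ℝ × ℝ) →L[ℝ] (ℝ × ℝ), Function.Injective A ∧ HasFDerivAt squareFold A p := by
  have hm : |p.2 * p.1⁻¹| < 1 := by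
    rw [abs_mul, abs_inv, abs_of_pos h0, ← div_eq_mul_inv, div_lt_one h0]
    exact h2
  have hne : ∀ q : ℚ, p.2 * p.1⁻¹ ≠ q := by
    intro q hq
    apply hp.snd_ne_mul q
    rw [← hq]
    field_simp
  rw [abs_lt] at hm
  obtain ⟨j, hj1, hj2⟩ := exists_tent_mem hm.1.le hm.2
  have hj1' : 1 - 2 * (1 / 3) ^ j < p.2 * p.1⁻¹ := lt_of_le_of_ne hj1 (by
    have := hne (1 - 2 * (1 / 3) ^ j)
    push_cast at this
    exact this.symm)
  have hjc : p.2 * p.1⁻¹ - (1 - 4 / 3 * (1 / 3) ^ j) ≠ 0 := by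
    have := hne (1 - 4 / 3 * (1 / 3) ^ j)
    push_cast at this
    exact sub_ne_zero.2 this
  set r : ℝ := (1 / 3) ^ j with hr
  have hr1 : r ≤ 1 := third_pow_le_one j
  obtain ⟨s, hs, hsc⟩ : ∃ s : ℝ, s * s = 1 ∧ 0 < s * (p.2 * p.1⁻¹ - (1 - 4 / 3 * r)) := by
    rcases hjc.lt_or_gt with h | h
    · exact ⟨-1, by norm_num, by linarith⟩
    · exact ⟨1, by norm_num, by linarith⟩
  obtain ⟨A, hA, hd⟩ := exists_hasFDerivAt_foldChart (η := 2 / 3 * r) h0 h1 (by linarith) hs hsc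
  refine ⟨A, hA, hd.congr_of_eventuallyEq ?_⟩
  have hc : ContinuousAt (fun q : ℝ × ℝ => q.2 * q.1⁻¹) p :=
    continuousAt_snd.mul (continuousAt_fst.inv₀ h0.ne')
  have hcs : ContinuousAt (fun q : ℝ × ℝ => s * (q.2 * q.1⁻¹ - (1 - 4 / 3 * r))) p :=
    (hc.sub_const _).const_mul s
  filter_upwards [continuousAt_fst.eventually (lt_mem_nhds h0),
    hc.eventually (lt_mem_nhds hj1'), hc.eventually (gt_mem_nhds hj2),
    hc.eventually (lt_mem_nhds hm.1), hc.eventually (gt_mem_nhds hm.2),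
    hcs.eventually (lt_mem_nhds hsc)] with q hq0 hq1 hq2 hq3 hq4 hqs
  have hqm : |q.2 * q.1⁻¹| ≤ 1 := abs_le.2 ⟨hq3.le, hq4.le⟩
  have e : q = q.1 • ((1 : ℝ), q.2 * q.1⁻¹) := by
    ext
    · simp
    · simp
      field_simp
  have habs : |q.2 * q.1⁻¹ - (1 - 4 / 3 * r)| = s * (q.2 * q.1⁻¹ - (1 - 4 / 3 * r)) := by
    have : |s| = 1 := by
      rcases mul_self_eq_one_iff.1 hs with rfl | rfl <;> simp
    rw [← abs_of_pos hqs, abs_mul, this, one_mul]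
  conv_lhs => rw [e]
  rw [squareFold_smul (norm_one_mk hqm) hq0, polarFold, boundaryFold_right hqm,
    fold_of_mem hq1.le hq2.le, tent_of_mem hq1.le hq2.le, ← hr, habs]
  ext
  · simp only [foldChart, Prod.fst_add, Prod.smul_fst, smul_eq_mul]
    field_simp
  · simp only [foldChart, Prod.snd_add, Prod.smul_snd, smul_eq_mul]
    field_simp

theorem exists_hasFDerivAt_squareFold {p : ℝ × ℝ} (hp : Generic p) (h1 : ‖p‖ ≤ 1) :
    ∃ A : (ℝ × ℝ) →L[ℝ] (ℝ × ℝ), Function.Injective A ∧ HasFDerivAt squareFold A p := by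
  obtain ⟨g, Y, hY, he⟩ := exists_sym_eq p
  have hq := hp.sym g
  have hq' : sym g p = (‖p‖, Y) := by
    conv_lhs => rw [he]
    rw [sym_sym]
  rw [hq'] at hq
  have hpos := norm_pos_iff.2 hp.ne_zero
  have hlt : |Y| < ‖p‖ := by
    refine lt_of_le_of_ne hY fun h => ?_
    rcases abs_eq_abs.1 (h.trans (abs_of_pos hpos).symm) with h | h
    · exact hq.snd_ne_mul 1 (by simpa using h)
    · exact hq.snd_ne_mul (-1) (by simpa using h)
  obtain ⟨A, hA, hd⟩ := exists_hasFDerivAt_squareFold_right hq hpos h1 hlt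
  have hsym : Function.Injective (sym g) := Function.LeftInverse.injective (sym_sym g)
  refine ⟨(sym g).comp (A.comp (sym g)), hsym.comp (hA.comp hsym), ?_⟩
  rw [← hq'] at hd
  have h := (sym g).hasFDerivAt.comp p (hd.comp p (sym g).hasFDerivAt)
  refine h.congr_of_eventuallyEq (Eventually.of_forall fun q => ?_)
  simp [squareFold_sym]

theorem exists_hasFDerivAt_snake (i : Fin 3) (p : ℝ × ℝ) :
    ∃ A : (ℝ × ℝ) →L[ℝ] (ℝ × ℝ), Function.Injective A ∧ HasFDerivAt (snake i) A p := by
  have hinj : Function.Injective saddle := by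
    rw [injective_iff_map_eq_zero]
    exact fun v hv => by_contra fun h => saddle_ne_zero h hv
  have hneg : ∀ i : Fin 3, (∃ k, ∀ q, snake i q = -saddle q + k) →
      ∃ A : (ℝ × ℝ) →L[ℝ] (ℝ × ℝ), Function.Injective A ∧ HasFDerivAt (snake i) A p := by
    rintro i ⟨k, hk⟩
    refine ⟨-saddle, neg_injective.comp hinj, ?_⟩
    rw [funext hk]
    exact (-saddle).hasFDerivAt.add_const k
  rcases fin_three_cases i with rfl | rfl | rfl
  · refine hneg 0 ⟨(2, -2 / 3), fun q => ?_⟩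
    ext <;> simp [snake, saddle_apply]; ring
  · refine ⟨saddle, hinj, ?_⟩
    rw [funext snake_one]
    exact saddle.hasFDerivAt
  · refine hneg 2 ⟨(-2, 2 / 3), fun q => ?_⟩
    ext <;> simp [snake, saddle_apply] <;> ring

/-- `squareFold` has local sections away from its folds. -/
theorem exists_section_squareFold {p : ℝ × ℝ} (hp0 : p ≠ 0) (hp : ‖p‖ < 1) :
    ∃ σ : ℝ × ℝ → ℝ × ℝ, σ (squareFold p) = p ∧ ContinuousAt σ (squareFold p) ∧
      (∀ w, ‖w‖ ≤ 1 → ‖σ w‖ ≤ 1) ∧ ∀ w, ‖w‖ < 1 → σ w ≠ 0 ∧ squareFold (σ w) = w := by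
  choose! b t hb ht ht1 hbt using fun (w : ℝ × ℝ) (hw : ‖w‖ ≤ 1) => exists_polarFold_eq hw
  have hw0 : ‖squareFold p‖ < 1 := norm_squareFold_lt hp.le hp0
  let X := {z : (ℝ × ℝ) × ℝ // z ∈ sphere (0 : ℝ × ℝ) 1 ×ˢ Icc (0 : ℝ) 1}
  have : CompactSpace X :=
    isCompact_iff_compactSpace.1 ((isCompact_sphere (0 : ℝ × ℝ) 1).prod isCompact_Icc)
  let x₀ : X := ⟨(dir p, ‖p‖), by simpa using norm_dir hp0, norm_nonneg p, hp.le⟩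
  have hfib : ∀ x : X, polarFold x.1.1 x.1.2 = polarFold x₀.1.1 x₀.1.2 → x = x₀ := by
    rintro ⟨⟨b', t'⟩, hb', ht', ht1'⟩ h
    rcases polarFold_eq (mem_sphere_zero_iff_norm.1 hb') (norm_dir hp0) ht' ht1' (norm_nonneg p)
      hp.le h with ⟨rfl, rfl⟩ | ⟨-, h, -⟩
    · rfl
    · exact absurd h hp.ne
  have hcont : Continuous fun x : X => polarFold x.1.1 x.1.2 :=
    continuous_polarFold.comp continuous_subtype_val
  have heq : b (squareFold p) = dir p ∧ t (squareFold p) = ‖p‖ := by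
    have := hfib ⟨(b (squareFold p), t (squareFold p)),
      mem_sphere_zero_iff_norm.2 (hb _ hw0.le), ht _ hw0.le, ht1 _ hw0.le⟩ (hbt _ hw0.le)
    have := congrArg Subtype.val this
    exact ⟨congrArg Prod.fst this, congrArg Prod.snd this⟩
  refine ⟨fun w => t w • b w, ?_, ?_, ?_, ?_⟩
  · change t (squareFold p) • b (squareFold p) = p
    rw [heq.1, heq.2, norm_smul_dir]
  · have hτ : ContinuousAt (fun w => (b w, t w)) (squareFold p) := by
      rw [ContinuousAt, heq.1, heq.2, _root_.tendsto_nhds]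
      intro U hU hpU
      obtain ⟨V, hV, hxV, hVU⟩ := exists_open_preimage_subset hcont hfib
        (hU.preimage continuous_subtype_val) (x := x₀) hpU
      filter_upwards [hV.mem_nhds hxV,
        continuous_norm.continuousAt.eventually (gt_mem_nhds hw0)] with w hw hw1
      exact hVU (a := ⟨(b w, t w), mem_sphere_zero_iff_norm.2 (hb _ hw1.le), ht _ hw1.le,
        ht1 _ hw1.le⟩) (by change polarFold (b w) (t w) ∈ V; rwa [hbt w hw1.le])
    exact hτ.snd.smul hτ.fst
  · intro w hw
    change ‖t w • b w‖ ≤ 1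
    rw [norm_smul, hb w hw, mul_one, Real.norm_of_nonneg (ht w hw)]
    exact ht1 w hw
  · intro w hw
    have htp : 0 < t w := by
      refine (ht w hw.le).lt_of_ne fun h => hw.ne ?_
      have h1 := hbt w hw.le
      rw [← h, polarFold_zero] at h1
      rw [← h1, hb w hw.le]
    exact ⟨smul_ne_zero htp.ne' (ne_zero_of_norm_eq_one (hb w hw.le)),
      (squareFold_smul (hb w hw.le) htp).trans (hbt w hw.le)⟩

theorem Generic.norm_ne_one {p : ℝ × ℝ} (hp : Generic p) : ‖p‖ ≠ 1 := by
  intro h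
  obtain ⟨g, Y, -, he⟩ := exists_sym_eq p
  have := hp.sym g
  rw [he, sym_sym, h] at this
  exact this.fst_ne 1 (by simp)

theorem exists_isConical_bakerFactor {F : ℝ × ℝ → ℝ × ℝ} (hF : ∀ w w', IsStep w w' → F w = w')
    {p : ℝ × ℝ} (hp : ‖p‖ < 1) (hg : Generic p) {i : Fin 3} (hi : |stretch i p.1| < 1)
    (hg' : Generic (snake i p)) :
    ∃ A, IsConical A ∧ HasConicalDerivAt F A (squareFold p) := by
  obtain ⟨σ, hσp, hσc, hσ1, hσ⟩ := exists_section_squareFold hg.ne_zero hp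
  obtain ⟨A, hA, hAd⟩ := exists_hasFDerivAt_squareFold hg hp.le
  obtain ⟨B, hB, hBd⟩ := exists_hasFDerivAt_snake i p
  obtain ⟨C, hC, hCd⟩ := exists_hasFDerivAt_squareFold hg' (norm_snake_le hp.le hi.le)
  let A' : (ℝ × ℝ) ≃L[ℝ] (ℝ × ℝ) :=
    (LinearEquiv.ofInjectiveEndo (A : (ℝ × ℝ) →ₗ[ℝ] (ℝ × ℝ)) hA).toContinuousLinearEquiv
  have hA' : (A' : (ℝ × ℝ) →L[ℝ] (ℝ × ℝ)) = A := by
    ext <;> rfl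
  have hw0 := norm_squareFold_lt hp.le hg.ne_zero
  have hball : ∀ᶠ w in 𝓝 (squareFold p), ‖w‖ < 1 :=
    continuous_norm.continuousAt.eventually (gt_mem_nhds hw0)
  have hσd : HasFDerivAt σ (A'.symm : (ℝ × ℝ) →L[ℝ] (ℝ × ℝ)) (squareFold p) := by
    refine HasFDerivAt.of_local_left_inverse hσc (by rwa [hσp, hA']) ?_
    filter_upwards [hball] with w hw using (hσ w hw).2
  have hd : HasFDerivAt (fun w => squareFold (snake i (σ w)))
      (C.comp (B.comp (A'.symm : (ℝ × ℝ) →L[ℝ] (ℝ × ℝ)))) (squareFold p) := by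
    refine HasFDerivAt.comp (g := squareFold) _ (by simpa only [hσp] using hCd)
      (HasFDerivAt.comp (g := snake i) _ (by rwa [hσp]) hσd)
  have hcont : ContinuousAt (fun w => |stretch i (σ w).1|) (squareFold p) := by
    have : Continuous fun q : ℝ × ℝ => |stretch i q.1| := (continuous_snake i).fst.abs
    exact this.continuousAt.comp hσc
  have hlt : (fun w => |stretch i (σ w).1|) (squareFold p) < 1 := by simpa only [hσp] using hi
  have hFd : HasFDerivAt F (C.comp (B.comp (A'.symm : (ℝ × ℝ) →L[ℝ] (ℝ × ℝ))))
      (squareFold p) := by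
    refine hd.congr_of_eventuallyEq ?_
    filter_upwards [hball, hcont.eventually (gt_mem_nhds hlt)] with w hw hw'
    have h := isStep_squareFold (hσ1 w hw.le) (hσ w hw).1 hw'.le
    rw [(hσ w hw).2] at h
    exact hF _ _ h
  exact ⟨C.comp (B.comp (A'.symm : (ℝ × ℝ) →L[ℝ] (ℝ × ℝ))),
    ⟨ContinuousLinearMap.continuous _, fun c _ v => map_smul _ c v,
    hC.comp (hB.comp A'.symm.injective)⟩, hasFDerivAt_iff_isLittleO.1 hFd⟩

/-! ### A homeomorphism of the carpet over the folded baker map -/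

theorem generic_sqrt : Generic (√2, √3) := by
  intro a b c h
  have h2 : √2 * √2 = 2 := Real.mul_self_sqrt (by norm_num)
  have h3 : √3 * √3 = 3 := Real.mul_self_sqrt (by norm_num)
  have h6 : √6 = √2 * √3 := by rw [← Real.sqrt_mul (by norm_num)]; norm_num
  have i2 : Irrational √2 := by norm_num
  have i3 : Irrational √3 := by norm_num
  have i6 : Irrational √6 := by norm_num
  simp only at h
  have key : ∀ {x : ℝ} {u v : ℚ}, Irrational x → (u : ℝ) + v * x = 0 → v = 0 := by
    intro x u v hx h
    by_contra hv
    refine hx ⟨-u / v, ?_⟩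
    have : (v : ℝ) ≠ 0 := by exact_mod_cast hv
    push_cast
    field_simp
    linarith
  have h5 : 2 * b * c = 0 := key (u := 2 * b ^ 2 + 3 * c ^ 2 - a ^ 2) i6 (by
    push_cast
    rw [h6]
    linear_combination ((b : ℝ) * √2 + c * √3 - a) * h - (b : ℝ) ^ 2 * h2 - (c : ℝ) ^ 2 * h3)
  rcases mul_eq_zero.1 h5 with hb | rfl
  · obtain rfl : b = 0 := by simpa using hb
    exact ⟨rfl, key (u := a) i3 (by simpa using h)⟩
  · exact ⟨key (u := a) i2 (by simpa using h), rfl⟩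

/-- The numbers `a + b x` with `a`, `b` rational and `b ≠ 0`. -/
def rationalAffine (x : ℝ) : Set ℝ := {z | ∃ a b : ℚ, b ≠ 0 ∧ z = a + b * x}

theorem countable_rationalAffine (x : ℝ) : (rationalAffine x).Countable := by
  refine (countable_range fun q : ℚ × ℚ => (q.1 : ℝ) + q.2 * x).mono ?_
  rintro _ ⟨a, b, -, rfl⟩
  exact ⟨(a, b), rfl⟩

theorem dense_rationalAffine (x : ℝ) : Dense (rationalAffine x) := by
  have h : DenseRange fun q : ℚ => (q : ℝ) + x :=
    (Homeomorph.addRight x).surjective.denseRange.comp Rat.denseRange_cast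
      (Homeomorph.addRight x).continuous
  refine h.mono ?_
  rintro _ ⟨a, rfl⟩
  exact ⟨a, 1, one_ne_zero, by simp⟩

theorem stretch_mem_rationalAffine (i : Fin 3) {x z : ℝ} (h : z ∈ rationalAffine x) :
    stretch i z ∈ rationalAffine x := by
  obtain ⟨a, b, hb, rfl⟩ := h
  rcases fin_three_cases i with rfl | rfl | rfl
  · exact ⟨3 * a + 2, 3 * b, by simpa, by rw [stretch_zero]; push_cast; ring⟩
  · exact ⟨-3 * a, -3 * b, by simpa, by rw [stretch_one]; push_cast; ring⟩
  · exact ⟨3 * a - 2, 3 * b, by simpa, by rw [stretch_two]; push_cast; ring⟩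

theorem shrink_mem_rationalAffine (i : Fin 3) {x z : ℝ} (h : z ∈ rationalAffine x) :
    shrink i z ∈ rationalAffine x := by
  obtain ⟨a, b, hb, rfl⟩ := h
  rcases fin_three_cases i with rfl | rfl | rfl
  · exact ⟨(a - 2) / 3, b / 3, by simpa, by rw [shrink_zero]; push_cast; ring⟩
  · exact ⟨-a / 3, -b / 3, by simpa, by rw [shrink_one]; push_cast; ring⟩
  · exact ⟨(a + 2) / 3, b / 3, by simpa, by rw [shrink_two]; push_cast; ring⟩

/-- The centres of the blow-ups, before folding. -/
def centres : Set (ℝ × ℝ) := ball 0 1 ∩ rationalAffine √2 ×ˢ rationalAffine √3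

theorem generic_of_mem_prod {p : ℝ × ℝ} (hp : p ∈ rationalAffine √2 ×ˢ rationalAffine √3) :
    Generic p := by
  obtain ⟨x, y⟩ := p
  obtain ⟨⟨a, b, hb, rfl⟩, ⟨c, d, hd, rfl⟩⟩ := hp
  intro u v w h
  simp only at h
  have := generic_sqrt (u + v * a + w * c) (v * b) (w * d) (by push_cast; linarith)
  simpa [hb, hd] using this

theorem mem_centres {p : ℝ × ℝ} (hp : p ∈ rationalAffine √2 ×ˢ rationalAffine √3)
    (h1 : ‖p‖ ≤ 1) : p ∈ centres :=
  ⟨mem_ball_zero_iff.2 (h1.lt_of_ne (generic_of_mem_prod hp).norm_ne_one), hp⟩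

theorem countable_centres : centres.Countable :=
  ((countable_rationalAffine _).prod (countable_rationalAffine _)).mono inter_subset_right

theorem square_subset_closure_centres : square ⊆ closure centres := by
  rw [square, ← closure_ball (0 : ℝ × ℝ) one_ne_zero]
  exact closure_minimal
    (((dense_rationalAffine _).prod (dense_rationalAffine _)).open_subset_closure_inter isOpen_ball)
    isClosed_closure

theorem squareFold_centres_subset : squareFold '' centres ⊆ ball 0 1 := by
  rintro _ ⟨p, hp, rfl⟩
  exact mem_ball_zero_iff.2 (norm_squareFold_lt (mem_ball_zero_iff.1 hp.1).le
    (generic_of_mem_prod hp.2).ne_zero)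

theorem ball_subset_closure_squareFold : ball 0 1 ⊆ closure (squareFold '' centres) := by
  intro w hw
  rw [mem_ball_zero_iff] at hw
  obtain ⟨b, t, hb, ht, ht1, rfl⟩ := exists_polarFold_eq hw.le
  have htp : 0 < t := by
    refine ht.lt_of_ne ?_
    rintro rfl
    rw [polarFold_zero, hb] at hw
    exact lt_irrefl _ hw
  rw [← squareFold_smul hb htp]
  have hp : t • b ∈ closure centres := square_subset_closure_centres (mem_square.2 (by
    rwa [norm_smul, hb, mul_one, Real.norm_of_nonneg ht]))
  exact mem_closure_image
    (continuousAt_squareFold (smul_ne_zero htp.ne' (ne_zero_of_norm_eq_one hb))) hp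

theorem exists_snake_mem_centres {p : ℝ × ℝ} (hp : p ∈ centres) :
    ∃ i, |stretch i p.1| < 1 ∧ snake i p ∈ centres := by
  have h1 := mem_ball_zero_iff.1 hp.1
  obtain ⟨i, hi⟩ := exists_abs_stretch_le (norm_le_iff_abs.1 h1.le).1
  have hm : snake i p ∈ centres :=
    mem_centres ⟨stretch_mem_rationalAffine i hp.2.1, shrink_mem_rationalAffine i hp.2.2⟩
      (norm_snake_le h1.le hi)
  exact ⟨i, (norm_lt_iff_abs.1 (mem_ball_zero_iff.1 hm.1)).1, hm⟩

theorem bakerFactor_image_centres {F : ℝ × ℝ → ℝ × ℝ} (hF : ∀ w w', IsStep w w' → F w = w') :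
    F '' (squareFold '' centres) = squareFold '' centres := by
  apply Subset.antisymm
  · rintro _ ⟨_, ⟨p, hp, rfl⟩, rfl⟩
    obtain ⟨i, hi, hm⟩ := exists_snake_mem_centres hp
    exact ⟨_, hm, (hF _ _ (isStep_squareFold (mem_ball_zero_iff.1 hp.1).le
      (generic_of_mem_prod hp.2).ne_zero hi.le)).symm⟩
  · rintro _ ⟨q, hq, rfl⟩
    have h1 := norm_le_iff_abs.1 (mem_ball_zero_iff.1 hq.1).le
    obtain ⟨i, hi⟩ := exists_abs_stretch_le h1.2
    have hsn : snake i (shrink i q.1, stretch i q.2) = q :=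
      Prod.ext (stretch_shrink i q.1) (shrink_stretch i q.2)
    have hm : (shrink i q.1, stretch i q.2) ∈ centres :=
      mem_centres ⟨shrink_mem_rationalAffine i hq.2.1, stretch_mem_rationalAffine i hq.2.2⟩
        (norm_le_iff_abs.2 ⟨abs_shrink_le i h1.1, hi⟩)
    refine ⟨_, ⟨_, hm, rfl⟩, ?_⟩
    have := hF _ _ (isStep_squareFold (mem_ball_zero_iff.1 hm.1).le
      (generic_of_mem_prod hm.2).ne_zero (i := i) (by
        change |stretch i (shrink i q.1)| ≤ 1
        rw [stretch_shrink]
        exact h1.1))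
    rw [this, hsn]

/-- A homeomorphism of the carpet extending over the baker factor. -/
theorem exists_carpet_baker : ∃ (F : ℝ × ℝ → ℝ × ℝ) (H : sierpinskiCarpet ≃ₜ sierpinskiCarpet)
    (β : sierpinskiCarpet → ℝ × ℝ), (∀ w w', IsStep w w' → F w = w') ∧ Continuous β ∧
    range β = square ∧ (∀ s s', β s = β s' → β s ∉ squareFold '' centres → s = s') ∧
    (∀ s, β (H s) = F (β s)) ∧ Dense {s | β s ∉ squareFold '' centres} := by
  obtain ⟨F, hc, hi, him, hF⟩ := exists_bakerFactor
  obtain ⟨H, β, h⟩ := exists_carpet_lift (countable_centres.image _) squareFold_centres_subset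
    ball_subset_closure_squareFold hc hi him (bakerFactor_image_centres hF) (by
      rintro _ ⟨p, hp, rfl⟩
      obtain ⟨i, hi, hm⟩ := exists_snake_mem_centres hp
      exact exists_isConical_bakerFactor hF (mem_ball_zero_iff.1 hp.1) (generic_of_mem_prod hp.2)
        hi (generic_of_mem_prod hm.2))
  exact ⟨F, H, β, hF, h⟩

/-! ### Failure of specification -/

theorem bakerFactor_polarFold {F : ℝ × ℝ → ℝ × ℝ} (hF : ∀ w w', IsStep w w' → F w = w')
    {u : ℝ × ℝ} {t : ℝ} (hu : u ≠ 0) (ht : 0 ≤ t) (h1 : t * ‖u‖ ≤ 1) (h2 : 3 * (t * |u.1|) ≤ 1) :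
    F (polarFold (dir u) (t * ‖u‖)) = polarFold (dir (saddle u)) (t * ‖saddle u‖) := by
  have hpos := norm_pos_iff.2 hu
  have h := isStep_polarFold (norm_dir hu) (mul_nonneg ht hpos.le) h1 (by
    have : |u.1| = ‖u‖ * |(dir u).1| := by
      conv_lhs => rw [← norm_smul_dir u]
      rw [Prod.smul_fst, smul_eq_mul, abs_mul, abs_norm]
    rwa [mul_assoc, ← this])
  have e1 : dir (saddle (dir u)) = dir (saddle u) := by
    conv_rhs => rw [← norm_smul_dir u]
    rw [map_smul, dir_smul hpos]
  have e2 : t * ‖u‖ * ‖saddle (dir u)‖ = t * ‖saddle u‖ := by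
    conv_rhs => rw [← norm_smul_dir u]
    rw [map_smul, norm_smul, norm_norm, mul_assoc]
  rw [e1, e2] at h
  exact hF _ _ h

theorem norm_sub_le_of_polarFold {b e : ℝ × ℝ} {t ε : ℝ} (hb : ‖b‖ = 1) (he : ‖e‖ = 1)
    (ht : 0 ≤ t) (ht1 : t ≤ 1) (h : ‖polarFold b t - e‖ ≤ ε) : t ≤ 3 * ε ∧ ‖b - e‖ ≤ 7 * ε := by
  have h1 := norm_polarFold_le hb ht ht1
  have h2 := norm_polarFold_sub_le hb ht
  have h3 := norm_sub_norm_le e (polarFold b t)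
  have h4 := norm_sub_le_norm_sub_add_norm_sub b (polarFold b t) e
  rw [norm_sub_rev] at h3
  rw [norm_sub_rev b (polarFold b t)] at h4
  exact ⟨by linarith, by linarith⟩

theorem saddle_pow (v : ℝ × ℝ) (i : ℕ) :
    saddle ((-3) ^ i * v.1, (-1 / 3) ^ i * v.2) =
      ((-3) ^ (i + 1) * v.1, (-1 / 3) ^ (i + 1) * v.2) := by
  rw [saddle_apply]
  ext <;> simp [pow_succ] <;> ring

/-- An orbit of the factor that shadows the flipped pair `(0, ±1)` during a long time keeps the
orientation of that pair for at least as long afterwards. -/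
theorem not_shadow_bakerFactor {F : ℝ × ℝ → ℝ × ℝ} (hF : ∀ w w', IsStep w w' → F w = w')
    {w : ℝ × ℝ} (hw : ‖w‖ ≤ 1) {n : ℕ}
    (h : ∀ i ≤ n, ‖F^[i] w - (0, (-1) ^ i)‖ ≤ 1 / 100) : ¬ ‖F^[2 * n] w - (0, -1)‖ ≤ 1 / 100 := by
  intro hend
  obtain ⟨v, t, hv, ht, ht1, hwv⟩ := exists_polarFold_eq hw
  set L : ℕ → ℝ × ℝ := fun i => ((-3) ^ i * v.1, (-1 / 3) ^ i * v.2) with hL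
  have hunit : ∀ i : ℕ, ‖((0 : ℝ), (-1 : ℝ) ^ i)‖ = 1 := by
    intro i
    rw [Prod.norm_def, norm_pow]
    simp
  have hL0 : L 0 = v := by simp [hL]
  have hLs : ∀ i, saddle (L i) = L (i + 1) := saddle_pow v
  have hLne : ∀ i, L i ≠ 0 := by
    intro i
    induction i with
    | zero => rw [hL0]; exact ne_zero_of_norm_eq_one hv
    | succ i ih => rw [← hLs]; exact saddle_ne_zero ih
  have hstep : ∀ i, F^[i] w = polarFold (dir (L i)) (t * ‖L i‖) → t * ‖L i‖ ≤ 1 →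
      3 * (t * |(L i).1|) ≤ 1 →
      F^[i + 1] w = polarFold (dir (L (i + 1))) (t * ‖L (i + 1)‖) := by
    intro i hi h1 h2
    rw [Function.iterate_succ_apply', hi, bakerFactor_polarFold hF (hLne i) ht h1 h2, hLs]
  have h0 : F^[0] w = polarFold (dir (L 0)) (t * ‖L 0‖) := by
    rw [hL0, hv, mul_one, dir_eq_self hv, hwv]
    rfl
  have hfst : ∀ i, ‖L i‖ * |(dir (L i)).1| = |(L i).1| := by
    intro i
    conv_rhs => rw [← norm_smul_dir (L i)]
    rw [Prod.smul_fst, smul_eq_mul, abs_mul, abs_norm]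
  have habs1 : ∀ i, |(L i).1| = 3 ^ i * |v.1| := by
    intro i
    simp [hL, abs_mul, abs_pow]
  have habs2 : ∀ i, |(L i).2| = (1 / 3) ^ i * |v.2| := by
    intro i
    simp only [hL, abs_mul, abs_pow]
    norm_num [abs_div]
  have hclose : ∀ i ≤ n, F^[i] w = polarFold (dir (L i)) (t * ‖L i‖) → t * ‖L i‖ ≤ 1 →
      t * ‖L i‖ ≤ 3 / 100 ∧ ‖dir (L i) - (0, (-1) ^ i)‖ ≤ 7 / 100 := by
    intro i hi hF' h1
    have := norm_sub_le_of_polarFold (ε := 1 / 100) (norm_dir (hLne i)) (hunit i)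
      (mul_nonneg ht (norm_nonneg _)) h1 (by rw [← hF']; exact h i hi)
    constructor <;> linarith [this.1, this.2]
  have hfstle : ∀ i : ℕ, ‖dir (L i) - (0, (-1) ^ i)‖ ≤ 7 / 100 → |(dir (L i)).1| ≤ 7 / 100 := by
    intro i hi
    have := abs_fst_le (dir (L i) - (0, (-1) ^ i))
    simp only [Prod.fst_sub, sub_zero] at this
    linarith
  have hnormL : ∀ i, ‖L (i + 1)‖ ≤ 3 * ‖L i‖ := by
    intro i
    have h1 := abs_fst_le (L i)
    have h2 := abs_snd_le (L i)
    rw [habs1] at h1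
    rw [habs2] at h2
    rw [norm_le_iff_abs, habs1, habs2, pow_succ, pow_succ]
    have := mul_nonneg (pow_nonneg (by norm_num : (0 : ℝ) ≤ 1 / 3) i) (abs_nonneg v.2)
    constructor <;> linarith
  have hfirst : ∀ i ≤ n, F^[i] w = polarFold (dir (L i)) (t * ‖L i‖) ∧ t * ‖L i‖ ≤ 1 := by
    intro i
    induction i with
    | zero => exact fun _ => ⟨h0, by rwa [hL0, hv, mul_one]⟩
    | succ i ih =>
      intro hi
      obtain ⟨h1, h2⟩ := ih (by omega)
      obtain ⟨h3, h4⟩ := hclose i (by omega) h1 h2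
      have h5 := mul_le_mul_of_nonneg_left (abs_fst_le (L i)) ht
      refine ⟨hstep i h1 h2 (by linarith), ?_⟩
      have := mul_le_mul_of_nonneg_left (hnormL i) ht
      linarith
  obtain ⟨hn1, hn2⟩ := hfirst n le_rfl
  obtain ⟨hn3, hn4⟩ := hclose n le_rfl hn1 hn2
  have hvle := norm_le_iff_abs.1 hv.le
  have hpow : ((1 : ℝ) / 3) ^ n * 3 ^ n = 1 := by rw [← mul_pow]; norm_num
  have h3n : (0 : ℝ) < 3 ^ n := by positivity
  have hthird : (0 : ℝ) < (1 / 3) ^ n := by positivity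
  have hnormn : ‖L n‖ ≤ (1 / 3) ^ n := by
    have h1 : |(L n).1| ≤ 7 / 100 * ‖L n‖ := by
      rw [← hfst, mul_comm]
      exact mul_le_mul_of_nonneg_right (hfstle n hn4) (norm_nonneg _)
    have h2 : |(L n).2| ≤ (1 / 3) ^ n := by
      rw [habs2]
      exact mul_le_of_le_one_right hthird.le hvle.2
    have hpos := norm_pos_iff.2 (hLne n)
    by_contra! hlt
    have : ‖L n‖ < ‖L n‖ := by
      conv_lhs => rw [Prod.norm_def]
      exact max_lt (by rw [Real.norm_eq_abs]; linarith) (by rw [Real.norm_eq_abs]; linarith)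
    exact lt_irrefl _ this
  have hv1 : 3 ^ n * (3 ^ n * |v.1|) ≤ 7 / 100 := by
    have h1 : |(L n).1| ≤ 7 / 100 * (1 / 3) ^ n := by
      rw [← hfst, mul_comm]
      exact mul_le_mul (hfstle n hn4) hnormn (norm_nonneg _) (by norm_num)
    rw [habs1] at h1
    nlinarith
  have hall : ∀ i ≤ 2 * n, 3 ^ i * |v.1| ≤ 7 / 100 := by
    intro i hi
    refine le_trans ?_ hv1
    rw [← mul_assoc, ← pow_add, ← two_mul]
    exact mul_le_mul_of_nonneg_right (pow_le_pow_right₀ (by norm_num) hi) (abs_nonneg _)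
  have hsmall : ∀ i ≤ 2 * n, t * ‖L i‖ ≤ 1 := by
    intro i hi
    refine mul_le_one₀ ht1 (norm_nonneg _) ?_
    rw [norm_le_iff_abs, habs1, habs2]
    exact ⟨by linarith [hall i hi], mul_le_one₀ (third_pow_le_one i) (abs_nonneg _) hvle.2⟩
  have hsecond : ∀ i ≤ 2 * n, F^[i] w = polarFold (dir (L i)) (t * ‖L i‖) := by
    intro i
    induction i with
    | zero => exact fun _ => h0
    | succ i ih =>
      intro hi
      refine hstep i (ih (by omega)) (hsmall i (by omega)) ?_
      rw [habs1]
      have := hall i (by omega)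
      have h0 : 0 ≤ 3 ^ i * |v.1| := by positivity
      nlinarith
  have hclose0 := hclose 0 (Nat.zero_le _) h0 (by rwa [hL0, hv, mul_one])
  have hv2 : 0 < v.2 := by
    have := abs_snd_le (dir (L 0) - (0, (-1) ^ 0))
    rw [hL0, dir_eq_self hv] at hclose0
    rw [hL0, dir_eq_self hv] at this
    simp only [pow_zero, Prod.snd_sub] at this hclose0
    have := (abs_le.1 (this.trans hclose0.2)).1
    linarith
  have hfinal := norm_sub_le_of_polarFold (e := (0, -1)) (ε := 1 / 100)
    (norm_dir (hLne (2 * n))) (by simp) (mul_nonneg ht (norm_nonneg _))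
    (hsmall _ le_rfl) (by rw [← hsecond _ le_rfl]; exact hend)
  have h1 := (abs_snd_le _).trans hfinal.2
  simp only [Prod.snd_sub, sub_neg_eq_add] at h1
  have h2 : 0 < (dir (L (2 * n))).2 := by
    rw [dir, Prod.smul_snd, smul_eq_mul]
    refine mul_pos (inv_pos.2 (norm_pos_iff.2 (hLne _))) ?_
    refine mul_pos ?_ hv2
    rw [pow_mul]
    positivity
  have := (abs_le.1 h1).2
  linarith

theorem not_bowenSpecification {F : ℝ × ℝ → ℝ × ℝ} (hF : ∀ w w', IsStep w w' → F w = w')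
    {X : Type*} [MetricSpace X] [CompactSpace X] {H : X → X} {β : X → ℝ × ℝ}
    (hβ : Continuous β) (hr : range β = square) (hH : ∀ s, β (H s) = F (β s)) :
    ¬ BowenSpecification H := by
  intro hspec
  obtain ⟨δ, hδ, hδβ⟩ := Metric.uniformContinuous_iff.1
    (CompactSpace.uniformContinuous_of_continuous hβ) (1 / 100) (by norm_num)
  obtain ⟨N, hN, h⟩ := hspec δ hδ
  have hiter : ∀ (i : ℕ) (s : X), β (H^[i] s) = F^[i] (β s) := by
    intro i
    induction i with
    | zero => exact fun s => rfl
    | succ i ih => intro s; rw [Function.iterate_succ_apply', hH, ih, Function.iterate_succ_apply']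
  have hstep : ∀ z : ℝ, |z| = 1 → F (0, z) = (0, -z) := by
    intro z hz
    have hn : ‖((0 : ℝ), z)‖ = 1 := by simp [Prod.norm_def, hz]
    rw [hF _ _ (isStep_boundary hn)]
    have : saddle (0, z) = (1 / 3 : ℝ) • ((0 : ℝ), -z) := by
      rw [saddle_apply]
      ext <;> simp; ring
    rw [this, dir_smul (by norm_num), dir_eq_self (by simp [Prod.norm_def, hz])]
  have horb : ∀ (i : ℕ) (z : ℝ), |z| = 1 → F^[i] (0, z) = (0, (-1) ^ i * z) := by
    intro i z hz
    induction i with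
    | zero => simp
    | succ i ih =>
      rw [Function.iterate_succ_apply', ih, hstep _ (by simp [abs_mul, hz])]
      ext <;> simp [pow_succ]
  have hlift : ∀ z : ℝ, |z| = 1 → ∃ s, β s = (0, z) := by
    intro z hz
    have : ((0 : ℝ), z) ∈ range β := by
      rw [hr, mem_square]
      simp [Prod.norm_def, hz]
    exact this
  obtain ⟨s₁, h1⟩ := hlift 1 (by simp)
  obtain ⟨s₂, h2⟩ := hlift (-1) (by simp)
  obtain ⟨x, hx⟩ := h 2 le_rfl (fun m => if m = 0 then s₁ else s₂)
    (fun m => if m = 0 then 0 else 2 * N) (fun m => if m = 0 then N else 2 * N) rfl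
    (by intro m _; by_cases hm : m = 0 <;> simp [hm])
    (by
      intro m hm
      obtain rfl : m = 0 := by omega
      simp
      omega)
  have hxw : ‖β x‖ ≤ 1 := by
    rw [← mem_square, ← hr]
    exact mem_range_self x
  refine not_shadow_bakerFactor hF hxw (n := N) (fun i hi => ?_) ?_
  · have := hδβ (hx 0 (by norm_num) i (by simp) (by simpa using hi))
    simp only [if_pos] at this
    rw [hiter, hiter, h1, horb _ _ (by simp), mul_one, dist_eq_norm] at this
    exact this.le
  · have := hδβ (hx 1 (by norm_num) (2 * N) (by simp) (by simp))
    simp only [one_ne_zero, if_false] at this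
    rw [hiter, hiter, h2, horb _ _ (by simp), dist_eq_norm] at this
    simpa [pow_mul] using this.le

/-! ### Symbolic coding of the baker map -/

theorem dist_shrink (i : Fin 3) (x y : ℝ) : dist (shrink i x) (shrink i y) = 1 / 3 * dist x y := by
  have h : |(1 / 3 : ℝ)| = 1 / 3 := by norm_num
  rw [Real.dist_eq, Real.dist_eq, ← h, ← abs_mul]
  rcases fin_three_cases i with rfl | rfl | rfl <;>
    simp only [shrink_zero, shrink_one, shrink_two]
  · congr 1; ring
  · rw [← abs_neg]; congr 1; ring
  · congr 1; ring

theorem exists_value : ∃ G : (ℕ → Fin 3) → ℝ, Continuous G ∧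
    ∀ a, G a = shrink (a 0) (G fun n => a (n + 1)) :=
  exists_coding (K := 1 / 3) (NNReal.coe_lt_coe.1 (by norm_num)) fun i =>
    LipschitzWith.of_dist_le_mul fun x y => by simp [dist_shrink]

/-- The point of `[-1, 1]` with a given itinerary under the expanding map `stretch`. -/
noncomputable def value : (ℕ → Fin 3) → ℝ := exists_value.choose

theorem continuous_value : Continuous value := exists_value.choose_spec.1

theorem value_eq (a : ℕ → Fin 3) : value a = shrink (a 0) (value fun n => a (n + 1)) :=
  exists_value.choose_spec.2 a

theorem abs_value_le (a : ℕ → Fin 3) : |value a| ≤ 1 := by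
  obtain ⟨m, -, hm⟩ := isCompact_univ.exists_isMaxOn univ_nonempty
    (continuous_value.abs.continuousOn (s := univ))
  refine (hm (mem_univ a)).trans ?_
  have h1 : |value fun n => m (n + 1)| ≤ |value m| := hm (mem_univ _)
  have h2 := value_eq m
  rw [abs_le] at h1
  rcases abs_cases (value m) with h | h <;>
    rcases fin_three_cases (m 0) with h0 | h0 | h0 <;>
    simp only [h0, shrink_zero, shrink_one, shrink_two] at h2 <;> linarith [h1.1, h1.2]

theorem eq_of_value_eq {x : ℝ} {c : Fin 3}
    (hc : ∀ i y, |y| ≤ 1 → shrink i y = x → i = c ∧ y = x) {a : ℕ → Fin 3} (h : value a = x)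
    (n : ℕ) : a n = c := by
  induction n generalizing a with
  | zero => exact (hc _ _ (abs_value_le _) ((value_eq a).symm.trans h)).1
  | succ n ih => exact ih (hc _ _ (abs_value_le _) ((value_eq a).symm.trans h)).2

theorem eq_two_of_value_eq_one {a : ℕ → Fin 3} (h : value a = 1) (n : ℕ) : a n = 2 :=
  eq_of_value_eq (fun i y hy e => by
    rw [abs_le] at hy
    rcases fin_three_cases i with rfl | rfl | rfl <;>
      simp only [shrink_zero, shrink_one, shrink_two] at e
    · linarith
    · linarith
    · exact ⟨rfl, by linarith⟩) h n

theorem eq_zero_of_value_eq_neg_one {a : ℕ → Fin 3} (h : value a = -1) (n : ℕ) : a n = 0 :=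
  eq_of_value_eq (fun i y hy e => by
    rw [abs_le] at hy
    rcases fin_three_cases i with rfl | rfl | rfl <;>
      simp only [shrink_zero, shrink_one, shrink_two] at e
    · exact ⟨rfl, by linarith⟩
    · linarith
    · linarith) h n

theorem eq_one_of_value_eq_zero {a : ℕ → Fin 3} (h : value a = 0) (n : ℕ) : a n = 1 :=
  eq_of_value_eq (fun i y hy e => by
    rw [abs_le] at hy
    rcases fin_three_cases i with rfl | rfl | rfl <;>
      simp only [shrink_zero, shrink_one, shrink_two] at e
    · linarith
    · exact ⟨rfl, by linarith⟩
    · linarith) h n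

/-- Sequences that are not eventually constant. -/
def Varying (a : ℕ → Fin 3) : Prop := ∀ k c, ∃ m, k ≤ m ∧ a m ≠ c

theorem Varying.tail {a : ℕ → Fin 3} (h : Varying a) : Varying fun n => a (n + 1) := by
  intro k c
  obtain ⟨m, hm, hc⟩ := h (k + 1) c
  obtain ⟨m, rfl⟩ := Nat.exists_eq_add_of_le' (show 1 ≤ m by lia)
  exact ⟨m, by lia, hc⟩

theorem Varying.abs_value_lt {a : ℕ → Fin 3} (h : Varying a) : |value a| < 1 := by
  refine (abs_value_le a).lt_of_ne fun e => ?_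
  rcases (abs_eq zero_le_one).1 e with e | e
  · obtain ⟨m, -, hm⟩ := h 0 2
    exact hm (eq_two_of_value_eq_one e m)
  · obtain ⟨m, -, hm⟩ := h 0 0
    exact hm (eq_zero_of_value_eq_neg_one e m)

theorem Varying.value_ne_zero {a : ℕ → Fin 3} (h : Varying a) : value a ≠ 0 := by
  intro e
  obtain ⟨m, -, hm⟩ := h 0 1
  exact hm (eq_one_of_value_eq_zero e m)

theorem shrink_eq_shrink {i j : Fin 3} {x y : ℝ} (hx : |x| < 1) (hy : |y| < 1)
    (h : shrink i x = shrink j y) : i = j ∧ x = y := by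
  rw [abs_lt] at hx hy
  rcases fin_three_cases i with rfl | rfl | rfl <;>
    rcases fin_three_cases j with rfl | rfl | rfl <;>
    simp only [shrink_zero, shrink_one, shrink_two] at h <;>
    first | exact ⟨rfl, by linarith⟩ | (exfalso; linarith)

theorem Varying.value_injective {a b : ℕ → Fin 3} (ha : Varying a) (hb : Varying b)
    (h : value a = value b) : a = b := by
  funext n
  have key : ∀ {a b : ℕ → Fin 3}, Varying a → Varying b → value a = value b →
      a 0 = b 0 ∧ (value fun n => a (n + 1)) = value fun n => b (n + 1) := fun ha hb h =>
    shrink_eq_shrink ha.tail.abs_value_lt hb.tail.abs_value_lt (by rwa [← value_eq, ← value_eq])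
  induction n generalizing a b with
  | zero => exact (key ha hb h).1
  | succ n ih => exact ih ha.tail hb.tail (key ha hb h).2

theorem exists_value_eq {x : ℝ} (hx : |x| ≤ 1) : ∃ a, value a = x := by
  have hd : ∀ x : ℝ, ∃ i, |x| ≤ 1 → |stretch i x| ≤ 1 := fun x => by
    by_cases h : |x| ≤ 1
    · obtain ⟨i, hi⟩ := exists_abs_stretch_le h
      exact ⟨i, fun _ => hi⟩
    · exact ⟨0, fun h' => absurd h' h⟩
  choose d hd using hd
  set f : ℝ → ℝ := fun x => stretch (d x) x with hf
  have key : ∀ (n : ℕ) (x : ℝ), |x| ≤ 1 →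
      |value (fun m => d (f^[m] x)) - x| ≤ 2 * (1 / 3) ^ n := by
    intro n
    induction n with
    | zero =>
      intro x hx
      refine (abs_sub _ _).trans ?_
      linarith [abs_value_le fun m => d (f^[m] x)]
    | succ n ih =>
      intro x hx
      have h : |value (fun m => d (f^[m + 1] x)) - f x| ≤ 2 * (1 / 3) ^ n := ih (f x) (hd x hx)
      have h2 := dist_shrink (d x) (value fun m => d (f^[m + 1] x)) (f x)
      rw [show shrink (d x) (f x) = x from shrink_stretch _ _, Real.dist_eq, Real.dist_eq] at h2
      rw [value_eq]
      refine h2.le.trans ?_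
      rw [pow_succ]
      linarith [h]
  refine ⟨fun m => d (f^[m] x), ?_⟩
  have hlim : Tendsto (fun n : ℕ => 2 * (1 / 3 : ℝ) ^ n) atTop (𝓝 (2 * 0)) :=
    (tendsto_pow_atTop_nhds_zero_of_lt_one (by norm_num) (by norm_num)).const_mul 2
  have := ge_of_tendsto' hlim fun n => key n x hx
  rw [mul_zero] at this
  exact sub_eq_zero.1 (abs_nonpos_iff.1 this)

theorem exists_value_eq_rat (n : ℕ) (a : ℕ → Fin 3) :
    ∃ u v : ℚ, |v| = (1 / 3) ^ n ∧ value a = u + v * value fun m => a (m + n) := by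
  induction n generalizing a with
  | zero => exact ⟨0, 1, by simp, by simp⟩
  | succ n ih =>
    obtain ⟨u, v, hv, h⟩ := ih fun m => a (m + 1)
    have e : (fun m => a (m + (n + 1))) = fun m => a (m + n + 1) := by simp only [add_assoc]
    have h2 := value_eq a
    have h3 : |(1 / 3 : ℚ)| = 1 / 3 := by norm_num
    rw [h] at h2
    rw [e]
    rcases fin_three_cases (a 0) with h0 | h0 | h0 <;>
      simp only [h0, shrink_zero, shrink_one, shrink_two] at h2
    · refine ⟨(u - 2) / 3, v * (1 / 3), by rw [abs_mul, hv, h3, pow_succ], ?_⟩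
      rw [h2]; push_cast; ring
    · refine ⟨-u / 3, -v * (1 / 3), by rw [abs_mul, abs_neg, hv, h3, pow_succ], ?_⟩
      rw [h2]; push_cast; ring
    · refine ⟨(u + 2) / 3, v * (1 / 3), by rw [abs_mul, hv, h3, pow_succ], ?_⟩
      rw [h2]; push_cast; ring

theorem exists_rat_value_eq {n : ℕ} (hn : 0 < n) {a : ℕ → Fin 3} (h : ∀ m, a (m + n) = a m) :
    ∃ q : ℚ, value a = q := by
  obtain ⟨u, v, hv, e⟩ := exists_value_eq_rat n a
  rw [funext h] at e
  have hv1 : v ≠ 1 := by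
    rintro rfl
    have := pow_lt_one₀ (n := n) (show (0 : ℚ) ≤ 1 / 3 by norm_num) (by norm_num) hn.ne'
    rw [← hv, abs_one] at this
    exact lt_irrefl _ this
  have hv2 : (1 - v : ℝ) ≠ 0 := sub_ne_zero.2 (by exact_mod_cast hv1.symm)
  refine ⟨u / (1 - v), ?_⟩
  push_cast
  rw [eq_div_iff hv2]
  linarith

/-- The point of the square with a given bi-infinite itinerary under the baker map. -/
noncomputable def decode (ω : ℤ → Fin 3) : ℝ × ℝ :=
  (value fun n : ℕ => ω n, value fun n : ℕ => ω (-1 - n))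

theorem continuous_decode : Continuous decode :=
  (continuous_value.comp (continuous_pi fun n => continuous_apply (n : ℤ))).prodMk
    (continuous_value.comp (continuous_pi fun n => continuous_apply (-1 - n : ℤ)))

theorem norm_decode_le (ω : ℤ → Fin 3) : ‖decode ω‖ ≤ 1 :=
  norm_le_iff_abs.2 ⟨abs_value_le _, abs_value_le _⟩

theorem snake_decode (ω : ℤ → Fin 3) : snake (ω 0) (decode ω) = decode fun i => ω (i + 1) := by
  refine Prod.ext ?_ ?_
  · have := value_eq fun n : ℕ => ω n
    rw [Nat.cast_zero] at this
    simp only [snake, decode]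
    rw [this, stretch_shrink]
    simp
  · have := value_eq fun n : ℕ => ω (-1 - n + 1)
    simp only [snake, decode]
    rw [this]
    simp only [Nat.cast_zero, Nat.cast_add, Nat.cast_one]
    congr 3
    funext n
    congr 1
    ring

theorem abs_stretch_decode_le (ω : ℤ → Fin 3) : |stretch (ω 0) (decode ω).1| ≤ 1 := by
  have := congrArg Prod.fst (snake_decode ω)
  change stretch (ω 0) (decode ω).1 = _ at this
  rw [this]
  exact abs_value_le _

theorem exists_decode_eq {p : ℝ × ℝ} (hp : ‖p‖ ≤ 1) : ∃ ω, decode ω = p := by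
  obtain ⟨h1, h2⟩ := norm_le_iff_abs.1 hp
  obtain ⟨a, ha⟩ := exists_value_eq h1
  obtain ⟨b, hb⟩ := exists_value_eq h2
  refine ⟨fun i => if 0 ≤ i then a i.toNat else b (-1 - i).toNat, Prod.ext ?_ ?_⟩
  · rw [← ha]
    simp [decode]
  · rw [← hb]
    simp only [decode]
    congr 1
    funext n
    rw [if_neg (by lia)]
    congr 1
    lia

theorem isStep_squareFold_decode {ω : ℤ → Fin 3} (h : decode ω ≠ 0) :
    IsStep (squareFold (decode ω)) (squareFold (decode fun i => ω (i + 1))) := by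
  rw [← snake_decode]
  exact isStep_squareFold (norm_decode_le ω) h (abs_stretch_decode_le ω)

theorem decode_shift_ne_zero {ω : ℤ → Fin 3} (h : decode ω ≠ 0) :
    (decode fun i => ω (i + 1)) ≠ 0 := by
  rw [← snake_decode]
  exact snake_ne_zero (norm_decode_le ω) h

theorem squareFold_injOn {p q : ℝ × ℝ} (hp : p ≠ 0) (hq : q ≠ 0) (hp1 : ‖p‖ ≤ 1) (hq1 : ‖q‖ < 1)
    (h : squareFold p = squareFold q) : p = q := by
  rcases polarFold_eq (norm_dir hp) (norm_dir hq) (norm_nonneg p) hp1 (norm_nonneg q) hq1.le h with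
    ⟨h1, h2⟩ | ⟨-, h2, -⟩
  · rw [← norm_smul_dir p, ← norm_smul_dir q, h1, h2]
  · exact absurd h2 hq1.ne

theorem squareFold_notMem_image_centres {p : ℝ × ℝ} (hp : p ≠ 0) (hp1 : ‖p‖ ≤ 1)
    (hc : p ∉ centres) : squareFold p ∉ squareFold '' centres := by
  rintro ⟨c, hcc, h⟩
  have := squareFold_injOn hp (generic_of_mem_prod hcc.2).ne_zero hp1
    (mem_ball_zero_iff.1 hcc.1) h.symm
  exact hc (this ▸ hcc)

/-! ### Density of periodic points -/

section Cylinders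

variable {X : Type*} [TopologicalSpace X] [CompactSpace X] {β : X → ℝ × ℝ}

theorem exists_squareFold_eq {w : ℝ × ℝ} (hw : ‖w‖ < 1) :
    ∃ p, p ≠ 0 ∧ ‖p‖ ≤ 1 ∧ squareFold p = w := by
  obtain ⟨b, t, hb, ht, ht1, h⟩ := exists_polarFold_eq hw.le
  have ht0 : t ≠ 0 := by
    rintro rfl
    rw [polarFold_zero] at h
    rw [← h, hb] at hw
    exact lt_irrefl _ hw
  refine ⟨t • b, smul_ne_zero ht0 (ne_zero_of_norm_eq_one hb), ?_, ?_⟩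
  · rwa [norm_smul, hb, mul_one, Real.norm_of_nonneg ht]
  · rw [squareFold_smul hb (ht.lt_of_ne' ht0), h]

theorem exists_cylinder_subset {W : Set (ℤ → Fin 3)} {ω : ℤ → Fin 3} (hW : W ∈ 𝓝 ω) :
    ∃ M : ℕ, ∀ ω', (∀ i : ℤ, |i| ≤ M → ω' i = ω i) → ω' ∈ W := by
  obtain ⟨O, hOW, hO, hωO⟩ := mem_nhds_iff.1 hW
  obtain ⟨I, u, hu, hsub⟩ := isOpen_pi_iff.1 hO ω hωO
  refine ⟨I.sup Int.natAbs, fun ω' h => hOW (hsub fun i hi => ?_)⟩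
  rw [h i (by rw [Int.abs_eq_natAbs]; exact_mod_cast Finset.le_sup (f := Int.natAbs) hi)]
  exact (hu i hi).2

theorem exists_cylinder (hβ : Continuous β) (hr : range β = square) {D : Set (ℝ × ℝ)}
    (hinj : ∀ s s', β s = β s' → β s ∉ D → s = s') (hD : Dense {s | β s ∉ D}) {U : Set X}
    (hU : IsOpen U) (hne : U.Nonempty) :
    ∃ (ω : ℤ → Fin 3) (M : ℕ), ∀ ω', (∀ i : ℤ, |i| ≤ M → ω' i = ω i) →
      decode ω' ≠ 0 ∧ ∀ s, β s = squareFold (decode ω') → s ∈ U := by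
  obtain ⟨s, hsU, hs⟩ := hD.inter_open_nonempty U hU hne
  obtain ⟨V, hV, hsV, hVU⟩ :=
    exists_open_preimage_subset hβ (fun x' h => (hinj s x' h.symm hs).symm) hU hsU
  have hcl : β s ∈ closure (ball (0 : ℝ × ℝ) 1) := by
    rw [closure_ball _ one_ne_zero]
    change β s ∈ square
    rw [← hr]
    exact mem_range_self s
  obtain ⟨w, hwV, hw⟩ := mem_closure_iff.1 hcl V hV hsV
  obtain ⟨p, hp0, hp, rfl⟩ := exists_squareFold_eq (mem_ball_zero_iff.1 hw)
  obtain ⟨ω, rfl⟩ := exists_decode_eq hp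
  have hW : {ω' | decode ω' ≠ 0 ∧ squareFold (decode ω') ∈ V} ∈ 𝓝 ω :=
    Filter.inter_mem (continuous_decode.continuousAt.eventually_ne hp0)
      (((continuousAt_squareFold hp0).comp continuous_decode.continuousAt).preimage_mem_nhds
        (hV.mem_nhds hwV))
  obtain ⟨M, hM⟩ := exists_cylinder_subset hW
  exact ⟨ω, M, fun ω' h => ⟨(hM ω' h).1, fun s hs => hVU (by
    rw [mem_preimage, hs]; exact (hM ω' h).2)⟩⟩

end Cylinders

theorem iterate_squareFold_decode {F : ℝ × ℝ → ℝ × ℝ} (hF : ∀ w w', IsStep w w' → F w = w')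
    {ω : ℤ → Fin 3} (h : decode ω ≠ 0) (n : ℕ) :
    F^[n] (squareFold (decode ω)) = squareFold (decode fun i => ω (i + n)) := by
  induction n generalizing ω with
  | zero => simp
  | succ n ih =>
    rw [Function.iterate_succ_apply, hF _ _ (isStep_squareFold_decode h),
      ih (decode_shift_ne_zero h)]
    congr 2
    funext i
    congr 1
    push_cast
    ring

theorem dense_periodic {X : Type*} [TopologicalSpace X] [CompactSpace X] {β : X → ℝ × ℝ}
    {H : X → X} {F : ℝ × ℝ → ℝ × ℝ} (hF : ∀ w w', IsStep w w' → F w = w') (hβ : Continuous β)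
    (hr : range β = square)
    (hinj : ∀ s s', β s = β s' → β s ∉ squareFold '' centres → s = s')
    (hH : ∀ s, β (H s) = F (β s)) (hD : Dense {s | β s ∉ squareFold '' centres}) :
    Dense {x | ∃ n : ℕ, 1 ≤ n ∧ H^[n] x = x} := by
  refine dense_iff_inter_open.2 fun U hU hne => ?_
  obtain ⟨ω, M, hM⟩ := exists_cylinder hβ hr hinj hD hU hne
  set n : ℕ := 2 * M + 1 with hn
  set ω' : ℤ → Fin 3 := fun i => ω ((i + M) % n - M) with hω'
  have hper : ∀ i, ω' (i + n) = ω' i := fun i => by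
    simp only [hω']
    congr 2
    rw [show i + n + M = i + M + (n : ℤ) by ring, Int.add_emod_right]
  obtain ⟨h0, hU'⟩ := hM ω' fun i hi => by
    simp only [hω']
    rw [abs_le] at hi
    rw [Int.emod_eq_of_lt (by lia) (by lia)]
    congr 1
    ring
  obtain ⟨q, hq⟩ := exists_rat_value_eq (n := n) (by lia) (a := fun m : ℕ => ω' m)
    fun m => by push_cast; exact hper m
  have hc : decode ω' ∉ centres := fun h => (generic_of_mem_prod h.2).fst_ne q hq
  have hfold := squareFold_notMem_image_centres h0 (norm_decode_le ω') hc
  have hmem : squareFold (decode ω') ∈ range β := by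
    rw [hr, mem_square]
    exact (norm_squareFold_lt (norm_decode_le ω') h0).le
  obtain ⟨s, hs⟩ := hmem
  refine ⟨s, hU' s hs, n, by lia, (hinj _ _ ?_ (hs ▸ hfold)).symm⟩
  have hsemi : Function.Semiconj β H F := hH
  rw [hsemi.iterate_right n s, hs, iterate_squareFold_decode hF h0 n, funext hper]

/-! ### The Bernoulli measure -/

/-- The uniform measure on three symbols. -/
noncomputable def digitMeasure : Measure (Fin 3) := ProbabilityTheory.uniformOn univ

instance : IsProbabilityMeasure digitMeasure :=
  ProbabilityTheory.isProbabilityMeasure_uniformOn finite_univ univ_nonempty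

theorem digitMeasure_singleton (c : Fin 3) : digitMeasure {c} = 3⁻¹ := by
  rw [digitMeasure, ProbabilityTheory.uniformOn_univ, Measure.count_singleton]
  simp

/-- The uniform Bernoulli measure on bi-infinite sequences of three symbols. -/
noncomputable def shiftMeasure : Measure (ℤ → Fin 3) := Measure.infinitePi fun _ => digitMeasure

instance : IsProbabilityMeasure shiftMeasure := by unfold shiftMeasure; infer_instance

theorem shiftMeasure_cylinder (I : Finset ℤ) (ω : ℤ → Fin 3) :
    shiftMeasure {ω' | ∀ i ∈ I, ω' i = ω i} = 3⁻¹ ^ I.card := by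
  have : {ω' : ℤ → Fin 3 | ∀ i ∈ I, ω' i = ω i} = (I : Set ℤ).pi fun i => {ω i} := by
    ext; simp [Set.mem_pi]
  rw [this, shiftMeasure, Measure.infinitePi_pi _ fun _ _ => MeasurableSet.singleton _]
  simp [digitMeasure_singleton]

theorem measurePreserving_shift :
    MeasurePreserving (fun (ω : ℤ → Fin 3) i => ω (i + 1)) shiftMeasure shiftMeasure :=
  ⟨by fun_prop, Measure.map_infinitePi_infinitePi_of_inj (add_left_injective (1 : ℤ))⟩

theorem ae_exists_ne {T : Set ℤ} (hT : T.Infinite) (ω : ℤ → Fin 3) :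
    ∀ᵐ ω' ∂shiftMeasure, ∃ i ∈ T, ω' i ≠ ω i := by
  rw [ae_iff]
  push Not
  have hlim : Tendsto (fun n : ℕ => (3⁻¹ : ENNReal) ^ n) atTop (𝓝 0) :=
    ENNReal.tendsto_pow_atTop_nhds_zero_of_lt_one (ENNReal.inv_lt_one.2 (by norm_num))
  refine le_antisymm (ge_of_tendsto' hlim fun n => ?_) zero_le
  obtain ⟨I, hI, rfl⟩ := hT.exists_subset_card_eq n
  rw [← shiftMeasure_cylinder I ω]
  exact measure_mono fun ω' h i hi => h i (hI hi)

/-- Itineraries that are not eventually constant in either direction. -/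
def Wandering (ω : ℤ → Fin 3) : Prop :=
  Varying (fun n : ℕ => ω n) ∧ Varying fun n : ℕ => ω (-1 - n)

theorem Wandering.decode_ne_zero {ω : ℤ → Fin 3} (h : Wandering ω) : decode ω ≠ 0 := fun e =>
  h.1.value_ne_zero (congrArg Prod.fst e)

theorem Wandering.norm_decode_lt {ω : ℤ → Fin 3} (h : Wandering ω) : ‖decode ω‖ < 1 :=
  norm_lt_iff_abs.2 ⟨h.1.abs_value_lt, h.2.abs_value_lt⟩

theorem Wandering.decode_injective {ω ω' : ℤ → Fin 3} (h : Wandering ω) (h' : Wandering ω')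
    (e : decode ω = decode ω') : ω = ω' := by
  have h1 := h.1.value_injective h'.1 (congrArg Prod.fst e)
  have h2 := h.2.value_injective h'.2 (congrArg Prod.snd e)
  funext i
  rcases le_or_gt 0 i with hi | hi
  · have := congrFun h1 i.toNat
    simpa [hi] using this
  · have := congrFun h2 (-1 - i).toNat
    simpa only [show (-1 : ℤ) - ((-1 - i).toNat : ℤ) = i by lia] using this

theorem measurableSet_varying : MeasurableSet {a : ℕ → Fin 3 | Varying a} := by
  have : {a : ℕ → Fin 3 | Varying a} = ⋂ k : ℕ, ⋂ c, ⋃ m ∈ Ici k, {a | a m = c}ᶜ := by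
    ext a; simp [Varying]
  rw [this]
  exact MeasurableSet.iInter fun k => MeasurableSet.iInter fun c =>
    MeasurableSet.biUnion (to_countable _) fun m _ =>
      (measurableSet_eq_fun (measurable_pi_apply m) measurable_const).compl

theorem measurableSet_wandering : MeasurableSet {ω | Wandering ω} := by
  have h1 : Measurable fun (ω : ℤ → Fin 3) (n : ℕ) => ω n := by fun_prop
  have h2 : Measurable fun (ω : ℤ → Fin 3) (n : ℕ) => ω (-1 - n) := by fun_prop
  exact (h1 measurableSet_varying).inter (h2 measurableSet_varying)

theorem ae_wandering : ∀ᵐ ω ∂shiftMeasure, Wandering ω := by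
  refine Filter.Eventually.and ?_ ?_ <;>
    refine ae_all_iff.2 fun k => ae_all_iff.2 fun c => ?_
  · have hT : ((fun n : ℕ => (n : ℤ)) '' Ici k).Infinite :=
      (Ici_infinite k).image (Nat.cast_injective.injOn)
    filter_upwards [ae_exists_ne hT fun _ => c] with ω h
    obtain ⟨_, ⟨m, hm, rfl⟩, hc⟩ := h
    exact ⟨m, hm, hc⟩
  · have hT : ((fun n : ℕ => (-1 - n : ℤ)) '' Ici k).Infinite :=
      (Ici_infinite k).image fun a _ b _ h => by simpa using h
    filter_upwards [ae_exists_ne hT fun _ => c] with ω h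
    obtain ⟨_, ⟨m, hm, rfl⟩, hc⟩ := h
    exact ⟨m, hm, hc⟩

/-- Itineraries on which the coding of the carpet is injective. -/
def typical : Set (ℤ → Fin 3) := {ω | Wandering ω ∧ decode ω ∉ centres}

theorem measurableSet_typical : MeasurableSet typical :=
  measurableSet_wandering.inter
    (continuous_decode.measurable countable_centres.measurableSet).compl

theorem ae_typical : ∀ᵐ ω ∂shiftMeasure, ω ∈ typical := by
  have hne : ∀ c ∈ centres, ∀ᵐ ω ∂shiftMeasure, Wandering ω → decode ω ≠ c := by
    intro c _
    by_cases h : ∃ ω₀, Wandering ω₀ ∧ decode ω₀ = c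
    · obtain ⟨ω₀, h0, rfl⟩ := h
      filter_upwards [ae_exists_ne infinite_univ ω₀] with ω ⟨i, _, hi⟩ hω e
      exact hi (congrFun (hω.decode_injective h0 e) i)
    · exact ae_of_all _ fun ω hω e => h ⟨ω, hω, e⟩
  filter_upwards [ae_wandering, (ae_ball_iff countable_centres).2 hne] with ω h1 h2
  exact ⟨h1, fun hc => h2 _ hc h1 rfl⟩

theorem squareFold_decode_notMem {ω : ℤ → Fin 3} (h : ω ∈ typical) :
    squareFold (decode ω) ∉ squareFold '' centres :=
  squareFold_notMem_image_centres h.1.decode_ne_zero (norm_decode_le ω) h.2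

theorem exists_bernoulli_measure {X : Type*} [MetricSpace X] [CompactSpace X] [MeasurableSpace X]
    [BorelSpace X] {β : X → ℝ × ℝ} {H : X → X} {F : ℝ × ℝ → ℝ × ℝ} (hHm : Measurable H)
    (hF : ∀ w w', IsStep w w' → F w = w') (hβ : Continuous β) (hr : range β = square)
    (hinj : ∀ s s', β s = β s' → β s ∉ squareFold '' centres → s = s')
    (hH : ∀ s, β (H s) = F (β s)) (hD : Dense {s | β s ∉ squareFold '' centres}) :
    ∃ μ : Measure X, IsProbabilityMeasure μ ∧
      (∀ A : Set X, MeasurableSet A → μ (H ⁻¹' A) = μ A) ∧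
      (∀ U : Set X, IsOpen U → U.Nonempty → 0 < μ U) ∧ IsBernoulliSystem H μ := by
  classical
  have hsec : ∀ ω, ∃ s, decode ω ≠ 0 → β s = squareFold (decode ω) := by
    intro ω
    by_cases h : decode ω = 0
    · obtain ⟨s, -⟩ : (0 : ℝ × ℝ) ∈ range β := by rw [hr, mem_square]; simp
      exact ⟨s, fun h' => absurd h h'⟩
    · obtain ⟨s, hs⟩ : squareFold (decode ω) ∈ range β := by
        rw [hr, mem_square]
        exact (norm_squareFold_lt (norm_decode_le ω) h).le
      exact ⟨s, fun _ => hs⟩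
  choose σ hσ using hsec
  have hσt : ∀ {ω}, ω ∈ typical → β (σ ω) = squareFold (decode ω) := fun h =>
    hσ _ h.1.decode_ne_zero
  have hcont : ContinuousOn σ typical := by
    refine continuousOn_of_forall_continuousAt fun ω hω => ?_
    have h0 := hω.1.decode_ne_zero
    refine fun U hU => ?_
    obtain ⟨O, hOU, hO, hωO⟩ := _root_.mem_nhds_iff.1 hU
    obtain ⟨V, hV, hωV, hVO⟩ := exists_open_preimage_subset hβ
      (fun x' h => (hinj (σ ω) x' h.symm (hσt hω ▸ squareFold_decode_notMem hω)).symm) hO hωO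
    rw [hσt hω] at hωV
    rw [mem_map]
    filter_upwards [continuous_decode.continuousAt.eventually_ne h0,
      ((continuousAt_squareFold h0).comp continuous_decode.continuousAt).preimage_mem_nhds
        (hV.mem_nhds hωV)] with ω' h1 h2
    refine hOU (hVO ?_)
    rw [mem_preimage, hσ ω' h1]
    exact h2
  set φ : (ℤ → Fin 3) → X := typical.piecewise σ fun _ => σ 0 with hφdef
  have hφ : Measurable φ :=
    hcont.measurable_piecewise continuousOn_const measurableSet_typical
  have hφt : ∀ {ω}, ω ∈ typical → β (φ ω) = squareFold (decode ω) := fun {ω} h => by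
    rw [hφdef, piecewise_eq_of_mem _ _ _ h, hσt h]
  have hφinj : Function.Injective fun ω : typical => φ ω := fun ω ω' h => by
    have h1 := hφt ω.2
    rw [show φ ω = φ ω' from h, hφt ω'.2] at h1
    exact Subtype.ext (ω.2.1.decode_injective ω'.2.1 (squareFold_injOn ω.2.1.decode_ne_zero
      ω'.2.1.decode_ne_zero (norm_decode_le _) ω'.2.1.norm_decode_lt h1.symm))
  have : StandardBorelSpace typical := measurableSet_typical.standardBorel
  obtain ⟨ψ, hψ, hψφ⟩ := ((hφ.comp measurable_subtype_coe).measurableEmbedding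
    hφinj).exists_measurable_extend measurable_subtype_coe fun _ => inferInstance
  have hψφ_ae : ∀ᵐ ω ∂shiftMeasure, ψ (φ ω) = ω :=
    ae_typical.mono fun ω h => congrFun hψφ ⟨ω, h⟩
  have hequi : ∀ᵐ ω ∂shiftMeasure, φ (fun i => ω (i + 1)) = H (φ ω) := by
    filter_upwards [ae_typical,
      measurePreserving_shift.quasiMeasurePreserving.ae ae_typical] with ω h h'
    refine hinj _ _ ?_ (hφt h' ▸ squareFold_decode_notMem h')
    rw [hH, hφt h, hφt h', hF _ _ (isStep_squareFold_decode h.1.decode_ne_zero)]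
  have hpres : MeasurePreserving φ shiftMeasure (shiftMeasure.map φ) := ⟨hφ, rfl⟩
  refine ⟨shiftMeasure.map φ, Measure.isProbabilityMeasure_map hφ.aemeasurable, ?_, ?_, Fin 3,
    inferInstance, digitMeasure, shiftMeasure, inferInstance, inferInstance, ?_, φ, hφ, hpres,
    ⟨ψ, hψ, ⟨hψ, ?_⟩, hψφ_ae, ?_⟩, hequi⟩
  · intro A hA
    rw [Measure.map_apply hφ hA, Measure.map_apply hφ (hHm hA),
      ← measurePreserving_shift.measure_preimage (hφ hA).nullMeasurableSet]
    refine measure_congr (hequi.mono fun ω h => ?_)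
    change (H (φ ω) ∈ A) = (φ (fun i => ω (i + 1)) ∈ A)
    rw [h]
  · intro U hU hne
    obtain ⟨ω, M, hM⟩ := exists_cylinder hβ hr hinj hD hU hne
    rw [Measure.map_apply hφ hU.measurableSet]
    have hpos : 0 < shiftMeasure {ω' | ∀ i ∈ Finset.Icc (-M : ℤ) M, ω' i = ω i} := by
      rw [shiftMeasure_cylinder]
      exact ENNReal.pow_pos (ENNReal.inv_pos.2 (by norm_num)) _
    refine hpos.trans_le (measure_mono_ae (ae_typical.mono fun ω' ht h => ?_))
    exact (hM ω' fun i hi => h i (Finset.mem_Icc.2 (abs_le.1 hi))).2 _ (hφt ht)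
  · intro I B
    exact Measure.infinitePi_pi _ fun _ _ => MeasurableSet.of_discrete
  · rw [Measure.map_map hψ hφ, Measure.map_congr (f := ψ ∘ φ) (g := id) hψφ_ae, Measure.map_id]
  · exact (ae_map_iff hφ.aemeasurable (measurableSet_eq_fun (hφ.comp hψ) measurable_id)).2
      (hψφ_ae.mono fun ω h => congrArg φ h)

end CarpetDynamics

open CarpetDynamics in
/-- The Sierpiński carpet admits a homeomorphism `H` having a fully supported invariant Borel
probability measure `μ` such that `(S, H, μ)` is Bernoulli, having a dense set of periodic
points, but not having Bowen's specification property. -/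
theorem sierpinskiCarpet_bernoulli_dense_periodic_no_specification :
    ∃ (H : ↥sierpinskiCarpet ≃ₜ ↥sierpinskiCarpet) (μ : Measure ↥sierpinskiCarpet),
      IsProbabilityMeasure μ ∧
      (∀ A : Set ↥sierpinskiCarpet, MeasurableSet A → μ (⇑H ⁻¹' A) = μ A) ∧
      (∀ U : Set ↥sierpinskiCarpet, IsOpen U → U.Nonempty → 0 < μ U) ∧
      IsBernoulliSystem (⇑H) μ ∧
      Dense {x : ↥sierpinskiCarpet | ∃ n : ℕ, 1 ≤ n ∧ (⇑H)^[n] x = x} ∧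
      ¬ BowenSpecification (⇑H) := by
  obtain ⟨F, H, β, hF, hβ, hr, hinj, hH, hD⟩ := exists_carpet_baker
  obtain ⟨μ, h1, h2, h3, h4⟩ :=
    exists_bernoulli_measure H.continuous.measurable hF hβ hr hinj hH hD
  exact ⟨H, μ, h1, h2, h3, h4, dense_periodic hF hβ hr hinj hH hD,
    not_bowenSpecification hF hβ hr hH⟩
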